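/- Let ℤ be irreducible with respect to a transition probability function p admitting a reversible measure π. Let q₁, q₂ : ℤ → [0,∞) satisfy ∑_z q_i(z) = 1, ∑_z |z| q_i(z) < ∞ and ∑_z z q_i(z) = 0 for i = 1,2, and assume condition (⋆). If ∑_{x∈ℤ} π(x)/(1+π(x))² = ∞, then the set of extremal invariant measures for the exclusion process is exactly {ν^c : 0 ≤ c ≤ ∞}. -/

import Mathlib

open MeasureTheory Filter Topology

section Defs

variable {S : Type*}

/-- The configuration obtained from `η` by exchanging the values at sites `x` and `y`. -/
def swapConfig [DecidableEq S] (x y : S) (η : S → Bool) : S → Bool :=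
  fun u => if u = x then η y else if u = y then η x else η u

/-- A cylinder function depends on finitely many coordinates. -/
def IsCylinder (f : (S → Bool) → ℝ) : Prop :=
  ∃ F : Finset S, ∀ η ξ : S → Bool, (∀ x ∈ F, η x = ξ x) → f η = f ξ

/-- The exclusion process generator applied to a cylinder function. -/
noncomputable def exclGen [DecidableEq S] (p : S → S → ℝ) (f : (S → Bool) → ℝ)
    (η : S → Bool) : ℝ :=
  ∑' x : S, ∑' y : S,
    (if η x = true ∧ η y = false then p x y * (f (swapConfig x y η) - f η) else 0)

/-- `p` is a transition probability function with bounded column sums. -/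
def IsTransition (p : S → S → ℝ) : Prop :=
  (∀ x y, 0 ≤ p x y) ∧ (∀ x, HasSum (fun y => p x y) 1) ∧
    ∃ C : ℝ, ∀ (y : S) (F : Finset S), ∑ x ∈ F, p x y ≤ C

/-- A probability measure is invariant for the exclusion process. -/
def ExclInvariant [DecidableEq S] (p : S → S → ℝ) (μ : Measure (S → Bool)) : Prop :=
  IsProbabilityMeasure μ ∧ ∀ f : (S → Bool) → ℝ, IsCylinder f → ∫ η, exclGen p f η ∂μ = 0

/-- Extremal invariant probability measures. -/
def IsExtremalInvariant [DecidableEq S] (p : S → S → ℝ) (μ : Measure (S → Bool)) : Prop :=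
  ExclInvariant p μ ∧ ∀ (t : ℝ) (ν₁ ν₂ : Measure (S → Bool)), 0 < t → t < 1 →
    ExclInvariant p ν₁ → ExclInvariant p ν₂ →
    μ = ENNReal.ofReal t • ν₁ + ENNReal.ofReal (1 - t) • ν₂ → ν₁ = μ ∧ ν₂ = μ

/-- A reversible measure `π` for the kernel `p`. -/
def IsReversible (p : S → S → ℝ) (π : S → ℝ) : Prop :=
  (∀ x, 0 < π x) ∧ ∀ x y, π x * p x y = π y * p y x

/-- Irreducibility of `p`. -/
def IrreducibleKernel (p : S → S → ℝ) : Prop :=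
  ∀ x y : S, x ≠ y → ∃ (n : ℕ) (c : ℕ → S), c 0 = x ∧ c n = y ∧ ∀ i < n, 0 < p (c i) (c (i+1))

/-- `ν` is the product (Bernoulli) measure with marginals `α`. -/
def IsBernoulliProduct (ν : Measure (S → Bool)) (α : S → ℝ) : Prop :=
  IsProbabilityMeasure ν ∧ ∀ (F : Finset S) (a : S → Bool),
    ν {η | ∀ x ∈ F, η x = a x} = ∏ x ∈ F, ENNReal.ofReal (if a x then α x else 1 - α x)

/-- A probability measure is reversible for the exclusion process. -/
def IsReversibleMeasure [DecidableEq S] (p : S → S → ℝ) (μ : Measure (S → Bool)) : Prop :=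
  ∀ f g : (S → Bool) → ℝ, IsCylinder f → IsCylinder g →
    ∫ η, f η * exclGen p g η ∂μ = ∫ η, g η * exclGen p f η ∂μ

end Defs

section ZDefs

/-- A mean-zero transition kernel on `ℤ` with finite first moment. -/
def MeanZeroKernel (q : ℤ → ℝ) : Prop :=
  (∀ z, 0 ≤ q z) ∧ HasSum q 1 ∧ Summable (fun z : ℤ => |(z : ℝ)| * q z) ∧
    HasSum (fun z : ℤ => (z : ℝ) * q z) 0

/-- Condition (⋆): asymptotic translation invariance of `p` towards `q₁` at `+∞`
and towards `q₂` at `-∞`. -/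
def StarCond (p : ℤ → ℤ → ℝ) (q₁ q₂ : ℤ → ℝ) : Prop :=
  Tendsto (fun K : ℕ => ∑' x : ℤ, ∑' z : ℤ,
      (if 0 ≤ x ∧ |x - (K : ℤ)| ≤ |z| then ENNReal.ofReal |p x (x + z) - q₁ z| else 0))
    atTop (nhds 0) ∧
  Tendsto (fun K : ℕ => ∑' x : ℤ, ∑' z : ℤ,
      (if x ≤ 0 ∧ |x + (K : ℤ)| ≤ |z| then ENNReal.ofReal |p x (x + z) - q₂ z| else 0))
    atTop (nhds 0)

end ZDefs

namespace Exclusion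

section Basic

variable {S : Type*}

/-- The attempted jump of a particle from `x` to `y`, suppressed unless `x` is occupied and `y` is
empty. -/
def jump [DecidableEq S] (x y : S) (η : S → Bool) : S → Bool :=
  if η x = true ∧ η y = false then swapConfig x y η else η

/-- The generator attempting the move `T x y` at rate `p x y`. -/
noncomputable def gen {Ω : Type*} (p : S → S → ℝ) (T : S → S → Ω → Ω) (F : Ω → ℝ) (ω : Ω) : ℝ :=
  ∑' e : S × S, p e.1 e.2 * (F (T e.1 e.2 ω) - F ω)

/-- The move `T x y` changes `F` by at most `V x + V y`. -/
def JumpBound {Ω : Type*} (T : S → S → Ω → Ω) (F : Ω → ℝ) (V : S → ℝ) : Prop :=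
  ∀ x y ω, |F (T x y ω) - F ω| ≤ V x + V y

theorem _root_.IsTransition.summable_col {p : S → S → ℝ} (hp : IsTransition p) (y : S) :
    Summable fun x => p x y := by
  obtain ⟨C, hC⟩ := hp.2.2
  exact summable_of_sum_le (fun x => hp.1 x y) (hC y)

theorem _root_.IsTransition.exists_col_bound {p : S → S → ℝ} (hp : IsTransition p) :
    ∃ C : ℝ, 0 ≤ C ∧ ∀ y, ∑' x, p x y ≤ C := by
  obtain ⟨C, hC⟩ := hp.2.2
  refine ⟨max C 0, le_max_right _ _, fun y => ?_⟩
  exact (Real.tsum_le_of_sum_le (fun x => hp.1 x y) (hC y)).trans (le_max_left _ _)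

theorem _root_.IsTransition.summable_edge {p : S → S → ℝ} (hp : IsTransition p) {V : S → ℝ}
    (hV : Summable V) (hV0 : ∀ x, 0 ≤ V x) :
    Summable fun e : S × S => p e.1 e.2 * (V e.1 + V e.2) := by
  obtain ⟨C, hC0, hC⟩ := hp.exists_col_bound
  have h1 : Summable fun e : S × S => p e.1 e.2 * V e.1 := by
    have h0 : ∀ e : S × S, 0 ≤ p e.1 e.2 * V e.1 := fun e => mul_nonneg (hp.1 e.1 e.2) (hV0 e.1)
    rw [summable_prod_of_nonneg h0]
    have h1 : ∀ x, Summable fun y => p x y * V x := fun x => (hp.2.1 x).summable.mul_right (V x)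
    refine ⟨h1, ?_⟩
    refine hV.congr fun x => ?_
    simp only [tsum_mul_right, (hp.2.1 x).tsum_eq, one_mul]
  have h2 : Summable fun e : S × S => p e.2 e.1 * V e.1 := by
    have h0 : ∀ e : S × S, 0 ≤ p e.2 e.1 * V e.1 := fun e => mul_nonneg (hp.1 e.2 e.1) (hV0 e.1)
    rw [summable_prod_of_nonneg h0]
    have h1 : ∀ x, Summable fun y => p y x * V x := fun x => (hp.summable_col x).mul_right (V x)
    refine ⟨h1, ?_⟩
    refine Summable.of_nonneg_of_le
      (fun x => tsum_nonneg fun y => mul_nonneg (hp.1 _ _) (hV0 _)) (fun x => ?_) (hV.mul_left C)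
    simp only [tsum_mul_right]
    exact mul_le_mul_of_nonneg_right (hC x) (hV0 x)
  have h3 : Summable fun e : S × S => p e.1 e.2 * V e.2 :=
    (Equiv.prodComm S S).summable_iff.mp h2
  simpa only [mul_add] using h1.add h3

section gen

variable {Ω : Type*} {p : S → S → ℝ} {T : S → S → Ω → Ω} {F : Ω → ℝ} {V : S → ℝ}

theorem norm_gen_term_le (hp : IsTransition p) (hF : JumpBound T F V) (e : S × S) (ω : Ω) :
    ‖p e.1 e.2 * (F (T e.1 e.2 ω) - F ω)‖ ≤ p e.1 e.2 * (V e.1 + V e.2) := by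
  rw [Real.norm_eq_abs, abs_mul, abs_of_nonneg (hp.1 _ _)]
  exact mul_le_mul_of_nonneg_left (hF _ _ _) (hp.1 _ _)

theorem summable_gen (hp : IsTransition p) (hV : Summable V) (hV0 : ∀ x, 0 ≤ V x)
    (hF : JumpBound T F V) (ω : Ω) :
    Summable fun e : S × S => p e.1 e.2 * (F (T e.1 e.2 ω) - F ω) :=
  Summable.of_norm_bounded (hp.summable_edge hV hV0)
    (fun e => norm_gen_term_le hp hF e ω)

theorem integral_gen [Countable S] [MeasurableSpace Ω] {M : Measure Ω} [IsProbabilityMeasure M]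
    (hp : IsTransition p) (hV : Summable V) (hV0 : ∀ x, 0 ≤ V x) (hF : JumpBound T F V)
    (hT : ∀ x y, Measurable (T x y)) (hFm : Measurable F) :
    Summable (fun e : S × S => p e.1 e.2 * ∫ ω, (F (T e.1 e.2 ω) - F ω) ∂M) ∧
    ∫ ω, gen p T F ω ∂M =
      ∑' e : S × S, p e.1 e.2 * ∫ ω, (F (T e.1 e.2 ω) - F ω) ∂M := by
  have hint : ∀ e : S × S, Integrable (fun ω => p e.1 e.2 * (F (T e.1 e.2 ω) - F ω)) M := by
    intro e
    refine Integrable.of_bound (C := p e.1 e.2 * (V e.1 + V e.2)) ?_ ?_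
    · exact (((hFm.comp (hT _ _)).sub hFm).const_mul _).aestronglyMeasurable
    · exact ae_of_all _ (norm_gen_term_le hp hF e)
  have hnorm : ∀ e : S × S, ∫ ω, ‖p e.1 e.2 * (F (T e.1 e.2 ω) - F ω)‖ ∂M ≤
      p e.1 e.2 * (V e.1 + V e.2) := by
    intro e
    calc _ ≤ ∫ _, p e.1 e.2 * (V e.1 + V e.2) ∂M :=
          integral_mono (hint e).norm (integrable_const _) (norm_gen_term_le hp hF e)
      _ = _ := by simp
  have hs : Summable fun e : S × S => ∫ ω, ‖p e.1 e.2 * (F (T e.1 e.2 ω) - F ω)‖ ∂M :=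
    Summable.of_nonneg_of_le (fun e => integral_nonneg fun ω => norm_nonneg _) hnorm
      (hp.summable_edge hV hV0)
  have heq : ∀ e : S × S, ∫ ω, p e.1 e.2 * (F (T e.1 e.2 ω) - F ω) ∂M =
      p e.1 e.2 * ∫ ω, (F (T e.1 e.2 ω) - F ω) ∂M := fun e => integral_const_mul _ _
  constructor
  · simp only [← heq]
    exact Summable.of_norm_bounded hs (fun e => norm_integral_le_integral_norm _)
  · simp only [← heq, gen]
    exact (integral_tsum_of_summable_integral_norm hint hs).symm

end gen

section Cylinder

variable {α : Type*}

theorem _root_.DependsOn.exists_bound [Finite α] {f : (S → α) → ℝ} {F : Finset S}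
    (hf : DependsOn f (F : Set S)) : ∃ K : ℝ, 0 ≤ K ∧ ∀ η, |f η| ≤ K := by
  obtain ⟨g, rfl⟩ := dependsOn_iff_exists_comp.1 hf
  obtain ⟨K, hK⟩ := (Set.finite_range fun z => |g z|).bddAbove
  exact ⟨max K 0, le_max_right _ _, fun η => (hK ⟨_, rfl⟩).trans (le_max_left _ _)⟩

theorem _root_.DependsOn.measurable [Finite α] [MeasurableSpace α] [MeasurableSingletonClass α]
    {f : (S → α) → ℝ} {F : Finset S} (hf : DependsOn f (F : Set S)) : Measurable f := by
  obtain ⟨g, rfl⟩ := dependsOn_iff_exists_comp.1 hf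
  exact (measurable_of_countable g).comp (measurable_pi_lambda _ fun i => measurable_pi_apply _)

theorem _root_.DependsOn.continuous [TopologicalSpace α] [DiscreteTopology α]
    {f : (S → α) → ℝ} {F : Finset S} (hf : DependsOn f (F : Set S)) : Continuous f := by
  obtain ⟨g, rfl⟩ := dependsOn_iff_exists_comp.1 hf
  exact (continuous_of_discreteTopology (f := g)).comp
    (continuous_pi fun i => continuous_apply _)

theorem _root_.DependsOn.integrable [Finite α] [MeasurableSpace α] [MeasurableSingletonClass α]
    {f : (S → α) → ℝ} {F : Finset S} (hf : DependsOn f (F : Set S)) (M : Measure (S → α))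
    [IsFiniteMeasure M] : Integrable f M := by
  obtain ⟨K, -, hK⟩ := hf.exists_bound
  exact Integrable.of_bound hf.measurable.aestronglyMeasurable K (ae_of_all _ hK)

/-- A move which only touches the sites `x` and `y` changes a cylinder function by a bounded
amount, and not at all if both sites are outside its support. -/
theorem _root_.DependsOn.exists_jumpBound [Finite α] {T : S → S → (S → α) → (S → α)}
    (hT : ∀ x y ω u, u ≠ x → u ≠ y → T x y ω u = ω u)
    {f : (S → α) → ℝ} {F : Finset S} (hf : DependsOn f (F : Set S)) :
    ∃ K : ℝ, 0 ≤ K ∧ JumpBound T f (Set.indicator (F : Set S) fun _ => K) := by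
  obtain ⟨K, hK0, hK⟩ := hf.exists_bound
  refine ⟨2 * K, by positivity, fun x y ω => ?_⟩
  have hd : |f (T x y ω) - f ω| ≤ 2 * K := by
    have := abs_sub (f (T x y ω)) (f ω)
    linarith [hK (T x y ω), hK ω]
  have h0 : ∀ x, 0 ≤ Set.indicator (F : Set S) (fun _ => 2 * K) x := fun x =>
    Set.indicator_nonneg (fun _ _ => by positivity) x
  by_cases hx : x ∈ (F : Set S)
  · rw [Set.indicator_of_mem hx]; linarith [h0 y]
  by_cases hy : y ∈ (F : Set S)
  · rw [Set.indicator_of_mem hy]; linarith [h0 x]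
  have : f (T x y ω) = f ω := hf fun i hi => hT x y ω i (by rintro rfl; exact hx hi)
    (by rintro rfl; exact hy hi)
  rw [this, sub_self, abs_zero]
  exact add_nonneg (h0 x) (h0 y)

theorem summable_indicator_finset (F : Finset S) (K : ℝ) :
    Summable (Set.indicator (F : Set S) fun _ => K) :=
  summable_of_ne_finset_zero (s := F) fun x hx =>
    Set.indicator_of_notMem (by simpa using hx) _

end Cylinder

section jump

variable [DecidableEq S]

theorem jump_apply_of_ne {x y u : S} (η : S → Bool) (hx : u ≠ x) (hy : u ≠ y) :
    jump x y η u = η u := by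
  unfold jump swapConfig
  split_ifs <;> simp_all

theorem jump_self (x : S) (η : S → Bool) : jump x x η = η := by
  unfold jump; rw [if_neg]; simp

theorem jump_apply_left {x y : S} (η : S → Bool) : jump x y η x = (η x && η y) := by
  unfold jump swapConfig
  cases h : η x <;> cases h' : η y <;> simp [h]

theorem jump_apply_right {x y : S} (h : x ≠ y) (η : S → Bool) :
    jump x y η y = (η x || η y) := by
  unfold jump swapConfig
  cases h1 : η x <;> cases h2 : η y <;> simp [h2, h.symm]

theorem measurable_swapConfig (x y : S) : Measurable (swapConfig x y) := by
  refine measurable_pi_lambda _ fun u => ?_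
  unfold swapConfig
  split_ifs <;> exact measurable_pi_apply _

theorem continuous_jump (x y : S) : Continuous (jump x y) := by
  refine continuous_pi fun u => ?_
  by_cases hxy : x = y
  · subst hxy; simpa only [jump_self] using continuous_apply u
  by_cases hx : u = x
  · subst hx
    simp only [jump_apply_left]
    have h : Continuous fun η : S → Bool => (η u, η y) := by fun_prop
    exact (continuous_of_discreteTopology (f := fun b : Bool × Bool => b.1 && b.2)).comp h
  by_cases hy : u = y
  · subst hy
    simp only [jump_apply_right hxy]
    have h : Continuous fun η : S → Bool => (η x, η u) := by fun_prop
    exact (continuous_of_discreteTopology (f := fun b : Bool × Bool => b.1 || b.2)).comp h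
  · simpa only [jump_apply_of_ne _ hx hy] using continuous_apply u

theorem measurable_jump (x y : S) : Measurable (jump x y) := by
  refine measurable_pi_lambda _ fun u => ?_
  by_cases hxy : x = y
  · subst hxy; simpa only [jump_self] using measurable_pi_apply u
  by_cases hx : u = x
  · subst hx
    simp only [jump_apply_left]
    have h : Measurable fun η : S → Bool => (η u, η y) := by fun_prop
    exact (measurable_of_countable (fun b : Bool × Bool => b.1 && b.2)).comp h
  by_cases hy : u = y
  · subst hy
    simp only [jump_apply_right hxy]
    have h : Measurable fun η : S → Bool => (η x, η u) := by fun_prop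
    exact (measurable_of_countable (fun b : Bool × Bool => b.1 || b.2)).comp h
  · simpa only [jump_apply_of_ne _ hx hy] using measurable_pi_apply u

theorem exclGen_eq_gen {p : S → S → ℝ} (hp : IsTransition p) {f : (S → Bool) → ℝ}
    (hf : IsCylinder f) : exclGen p f = gen p jump f := by
  obtain ⟨F, hF⟩ := hf
  have hF : DependsOn f (F : Set S) := fun η ξ h => hF η ξ h
  obtain ⟨K, hK0, hK⟩ := DependsOn.exists_jumpBound (T := jump)
    (fun x y ω u hx hy => jump_apply_of_ne ω hx hy) hF
  funext η
  have hs := summable_gen hp (summable_indicator_finset F K)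
    (fun x => Set.indicator_nonneg (fun _ _ => hK0) x) hK η
  unfold gen exclGen
  rw [hs.tsum_prod]
  refine tsum_congr fun x => tsum_congr fun y => ?_
  unfold jump
  split_ifs <;> simp

end jump

end Basic

section Weight

variable {S : Type*}

/-- A configuration functional is `V`-Lipschitz if changing the value at `u` changes it by at most
`V u`. -/
def SiteLip [DecidableEq S] (f : (S → Bool) → ℝ) (V : S → ℝ) : Prop :=
  ∀ η u b, |f (Function.update η u b) - f η| ≤ V u

theorem exists_weight [Countable S] {p : S → S → ℝ} (hp : IsTransition p) :
    ∃ (V : S → ℝ) (C : ℝ), (∀ x, 0 < V x) ∧ Summable V ∧ 0 ≤ C ∧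
      ∀ (x : S) (F : Finset S), ∑ y ∈ F, (p x y + p y x) * V y ≤ C * V x := by
  obtain ⟨B, hB0, hB⟩ := hp.exists_col_bound
  obtain ⟨w, hw0, hw1⟩ := ENNReal.exists_pos_sum_of_countable (ε := 1) one_ne_zero S
  let r : S → S → ENNReal := fun x y => ENNReal.ofReal (p x y + p y x)
  let G : (S → ENNReal) → S → ENNReal := fun v x => ∑' y, r x y * v y
  let A : ENNReal := ENNReal.ofReal (1 + B)
  have hA0 : A ≠ 0 := by simp [A]; linarith
  have hAt : A ≠ ⊤ := ENNReal.ofReal_ne_top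
  have hr : ∀ y, ∑' x, r x y ≤ A := by
    intro y
    have hs : Summable fun x => p x y + p y x := (hp.summable_col y).add (hp.2.1 y).summable
    rw [← ENNReal.ofReal_tsum_of_nonneg (fun x => add_nonneg (hp.1 _ _) (hp.1 _ _)) hs]
    refine ENNReal.ofReal_le_ofReal ?_
    rw [(hp.summable_col y).tsum_add (hp.2.1 y).summable, (hp.2.1 y).tsum_eq]
    linarith [hB y]
  have hG : ∀ v, ∑' x, G v x ≤ A * ∑' x, v x := by
    intro v
    simp only [G]
    rw [ENNReal.tsum_comm, ← ENNReal.tsum_mul_left]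
    refine ENNReal.tsum_le_tsum fun y => ?_
    rw [ENNReal.tsum_mul_right]
    exact mul_le_mul_left (hr y) _
  let W : S → ENNReal := fun x => ∑' k : ℕ, (2 * A)⁻¹ ^ k * (G^[k] (fun x => (w x : ENNReal))) x
  have hGk : ∀ k, ∑' x, (G^[k] (fun x => (w x : ENNReal))) x ≤ A ^ k := by
    intro k
    induction k with
    | zero => simpa using hw1.le
    | succ k ih =>
      rw [Function.iterate_succ_apply', pow_succ']
      exact (hG _).trans (mul_le_mul_right ih _)
  have h2A0 : 2 * A ≠ 0 := mul_ne_zero two_ne_zero hA0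
  have h2At : 2 * A ≠ ⊤ := ENNReal.mul_ne_top ENNReal.ofNat_ne_top hAt
  have hWsum : ∑' x, W x ≤ 2 := by
    simp only [W]
    rw [ENNReal.tsum_comm]
    calc _ ≤ ∑' k : ℕ, (2 : ENNReal)⁻¹ ^ k := by
          refine ENNReal.tsum_le_tsum fun k => ?_
          rw [ENNReal.tsum_mul_left]
          refine (mul_le_mul_right (hGk k) _).trans ?_
          rw [← mul_pow, ENNReal.mul_inv (Or.inl two_ne_zero) (Or.inl ENNReal.ofNat_ne_top),
            mul_assoc, ENNReal.inv_mul_cancel hA0 hAt, mul_one]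
      _ = 2 := by rw [ENNReal.tsum_geometric]; simp
  have hWtop : ∀ x, W x ≠ ⊤ := fun x =>
    ne_top_of_le_ne_top ENNReal.ofNat_ne_top ((ENNReal.le_tsum x).trans hWsum)
  have hWpos : ∀ x, 0 < W x := by
    intro x
    refine lt_of_lt_of_le (ENNReal.coe_pos.2 (hw0 x)) ?_
    have h := ENNReal.le_tsum (f := fun k : ℕ =>
      (2 * A)⁻¹ ^ k * (G^[k] (fun x => (w x : ENNReal))) x) 0
    simpa only [pow_zero, one_mul, Function.iterate_zero, id] using h
  have hGW : ∀ x, G W x ≤ (2 * A) * W x := by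
    intro x
    simp only [G, W]
    have : ∀ y, r x y * ∑' k : ℕ, (2 * A)⁻¹ ^ k * (G^[k] (fun x => (w x : ENNReal))) y =
        ∑' k : ℕ, (2 * A)⁻¹ ^ k * (r x y * (G^[k] (fun x => (w x : ENNReal))) y) := by
      intro y
      rw [← ENNReal.tsum_mul_left]
      exact tsum_congr fun k => by ring
    rw [tsum_congr this]
    rw [ENNReal.tsum_comm]
    refine le_trans ?_ (mul_le_mul_right (le_of_le_of_eq (le_add_left le_rfl)
      (tsum_eq_zero_add' (f := fun k : ℕ =>
        (2 * A)⁻¹ ^ k * (G^[k] (fun x => (w x : ENNReal))) x) ENNReal.summable).symm) (2 * A))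
    rw [← ENNReal.tsum_mul_left]
    refine ENNReal.tsum_le_tsum fun k => ?_
    rw [ENNReal.tsum_mul_left, Function.iterate_succ_apply', pow_succ', ← mul_assoc, ← mul_assoc,
      ENNReal.mul_inv_cancel h2A0 h2At, one_mul]
  refine ⟨fun x => (W x).toReal, (2 * A).toReal,
    fun x => ENNReal.toReal_pos (hWpos x).ne' (hWtop x),
    ENNReal.summable_toReal (ne_top_of_le_ne_top ENNReal.ofNat_ne_top hWsum), ENNReal.toReal_nonneg,
    fun x F => ?_⟩
  have h1 : ∑ y ∈ F, r x y * W y ≤ 2 * A * W x := (ENNReal.sum_le_tsum F).trans (hGW x)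
  have h2 := ENNReal.toReal_mono (ENNReal.mul_ne_top h2At (hWtop x)) h1
  rw [ENNReal.toReal_mul, ENNReal.toReal_sum
    (fun y _ => ENNReal.mul_ne_top ENNReal.ofReal_ne_top (hWtop y))] at h2
  refine le_trans (le_of_eq (Finset.sum_congr rfl fun y _ => ?_)) h2
  rw [ENNReal.toReal_mul, ENNReal.toReal_ofReal (add_nonneg (hp.1 _ _) (hp.1 _ _))]

variable [DecidableEq S]

theorem SiteLip.jumpBound {f : (S → Bool) → ℝ} {V : S → ℝ} (hf : SiteLip f V) :
    JumpBound jump f V := by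
  intro x y η
  have h : jump x y η = Function.update (Function.update η x (jump x y η x)) y (jump x y η y) := by
    funext u
    by_cases hy : u = y
    · subst hy; simp
    by_cases hx : u = x
    · subst hx; simp [hy]
    · simp [hx, hy, jump_apply_of_ne]
  rw [h]
  have h1 := hf η x (jump x y η x)
  have h2 := hf (Function.update η x (jump x y η x)) y (jump x y η y)
  have := abs_sub_le (f (Function.update (Function.update η x (jump x y η x)) y (jump x y η y)))
    (f (Function.update η x (jump x y η x))) (f η)
  linarith

/-- Two configurations which agree off `{x, y}`. -/
theorem SiteLip.abs_sub_le_of_eq_off {f : (S → Bool) → ℝ} {V : S → ℝ} (hf : SiteLip f V)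
    {x y : S} {η ξ : S → Bool} (h : ∀ u, u ≠ x → u ≠ y → η u = ξ u) :
    |f η - f ξ| ≤ V x + V y := by
  have e : η = Function.update (Function.update ξ x (η x)) y (η y) := by
    funext u
    by_cases hy : u = y
    · subst hy; simp
    by_cases hx : u = x
    · subst hx; simp [hy]
    · simp [hx, hy, h]
  rw [e]
  have h1 := hf ξ x (η x)
  have h2 := hf (Function.update ξ x (η x)) y (η y)
  have := abs_sub_le (f (Function.update (Function.update ξ x (η x)) y (η y)))
    (f (Function.update ξ x (η x))) (f ξ)
  linarith

theorem SiteLip.comp_jump {f : (S → Bool) → ℝ} {V : S → ℝ} (hf : SiteLip f V)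
    (hV : ∀ x, 0 ≤ V x) (x y : S) :
    SiteLip (fun η => f (jump x y η))
      (fun u => V u + ((if u = x then V y else 0) + (if u = y then V x else 0))) := by
  intro η u b
  by_cases hux : u = x
  · subst hux
    refine (hf.abs_sub_le_of_eq_off (x := u) (y := y) fun v h1 h2 => ?_).trans ?_
    · rw [jump_apply_of_ne _ h1 h2, jump_apply_of_ne _ h1 h2, Function.update_of_ne h1]
    · have : 0 ≤ if u = y then V u else 0 := by split_ifs <;> simp [hV]
      simp only [if_true]; linarith
  by_cases huy : u = y
  · subst huy
    refine (hf.abs_sub_le_of_eq_off (x := x) (y := u) fun v h1 h2 => ?_).trans ?_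
    · rw [jump_apply_of_ne _ h1 h2, jump_apply_of_ne _ h1 h2, Function.update_of_ne h2]
    · simp only [if_true, hux, if_false]; linarith
  · have : jump x y (Function.update η u b) = Function.update (jump x y η) u b := by
      funext v
      by_cases hvx : v = x
      · subst hvx
        rw [jump_apply_left, Function.update_of_ne (Ne.symm hux),
          Function.update_of_ne (Ne.symm hux),
          Function.update_of_ne (Ne.symm huy), jump_apply_left]
      by_cases hvy : v = y
      · subst hvy
        rw [jump_apply_right (Ne.symm hvx), Function.update_of_ne (Ne.symm hux),
          Function.update_of_ne (Ne.symm huy), Function.update_of_ne (Ne.symm huy),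
          jump_apply_right (Ne.symm hvx)]
      rw [jump_apply_of_ne _ hvx hvy]
      by_cases hvu : v = u
      · subst hvu; simp
      · rw [Function.update_of_ne hvu, Function.update_of_ne hvu, jump_apply_of_ne _ hvx hvy]
    simp only [this, hux, huy, if_false, add_zero]
    exact hf _ _ _

theorem _root_.DependsOn.exists_siteLip {f : (S → Bool) → ℝ} {F : Finset S}
    (hf : DependsOn f (F : Set S)) {V : S → ℝ} (hV : ∀ x, 0 < V x) :
    ∃ L : ℝ, 0 ≤ L ∧ SiteLip f (fun x => L * V x) := by
  obtain ⟨K, hK0, hK⟩ := hf.exists_bound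
  refine ⟨∑ x ∈ F, 2 * K / V x, Finset.sum_nonneg fun x _ => div_nonneg (by positivity) (hV x).le,
    fun η u b => ?_⟩
  by_cases hu : u ∈ F
  · have h1 : |f (Function.update η u b) - f η| ≤ 2 * K := by
      have := abs_sub (f (Function.update η u b)) (f η)
      linarith [hK (Function.update η u b), hK η]
    have h2 : 2 * K / V u ≤ ∑ x ∈ F, 2 * K / V x :=
      Finset.single_le_sum (f := fun x => 2 * K / V x)
        (fun x _ => div_nonneg (by positivity) (hV x).le) hu
    have h3 := mul_le_mul_of_nonneg_right h2 (hV u).le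
    rw [div_mul_cancel₀ _ (hV u).ne'] at h3
    linarith
  · rw [hf (fun i hi => Function.update_of_ne (by rintro rfl; exact hu hi) _ _), sub_self, abs_zero]
    exact mul_nonneg (Finset.sum_nonneg fun x _ => div_nonneg (by positivity) (hV x).le) (hV u).le

end Weight

section Step

variable {S : Type*}

/-- One step of a discrete time approximation to the dynamics: each move `T x y` with `(x, y) ∈ E`
is made with probability `w (x, y)`. -/
noncomputable def stepMeasure {Ω : Type*} [MeasurableSpace Ω] (w : S × S → ℝ) (E : Finset (S × S))
    (T : S → S → Ω → Ω) (m : Measure Ω) : Measure Ω :=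
  ENNReal.ofReal (1 - ∑ e ∈ E, w e) • m + ∑ e ∈ E, ENNReal.ofReal (w e) • m.map (T e.1 e.2)

section

variable {Ω : Type*} [MeasurableSpace Ω] {w : S × S → ℝ} {E : Finset (S × S)}
  {T : S → S → Ω → Ω} {m : Measure Ω}

theorem isProbabilityMeasure_stepMeasure (hw : ∀ e, 0 ≤ w e) (hE : ∑ e ∈ E, w e ≤ 1)
    (hT : ∀ x y, Measurable (T x y)) [IsProbabilityMeasure m] :
    IsProbabilityMeasure (stepMeasure w E T m) := by
  constructor
  have h : ∀ e : S × S, (m.map (T e.1 e.2)) Set.univ = 1 := fun e => by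
    rw [Measure.map_apply (hT _ _) MeasurableSet.univ, Set.preimage_univ, measure_univ]
  simp only [stepMeasure, Measure.coe_add, Measure.coe_smul, Measure.coe_finsetSum, Pi.add_apply,
    Pi.smul_apply, Finset.sum_apply, h, measure_univ, smul_eq_mul, mul_one]
  rw [← ENNReal.ofReal_sum_of_nonneg (fun e _ => hw e),
    ← ENNReal.ofReal_add (by linarith) (Finset.sum_nonneg fun e _ => hw e)]
  simp

theorem integral_stepMeasure (hw : ∀ e, 0 ≤ w e) (hE : ∑ e ∈ E, w e ≤ 1)
    (hT : ∀ x y, Measurable (T x y)) [IsProbabilityMeasure m] {F : Ω → ℝ} (hF : Measurable F)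
    {K : ℝ} (hK : ∀ ω, |F ω| ≤ K) :
    ∫ ω, F ω ∂(stepMeasure w E T m) =
      ∫ ω, F ω ∂m + ∑ e ∈ E, w e * ∫ ω, (F (T e.1 e.2 ω) - F ω) ∂m := by
  have hi : ∀ (m' : Measure Ω) [IsFiniteMeasure m'], Integrable F m' := fun m' _ =>
    Integrable.of_bound hF.aestronglyMeasurable K (ae_of_all _ hK)
  have hp : ∀ e : S × S, IsProbabilityMeasure (m.map (T e.1 e.2)) := fun e =>
    Measure.isProbabilityMeasure_map (hT _ _).aemeasurable
  have hs : ∀ e ∈ E, Integrable F (ENNReal.ofReal (w e) • m.map (T e.1 e.2)) := fun e _ =>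
    (hi (m.map (T e.1 e.2))).smul_measure ENNReal.ofReal_ne_top
  have h1 : ∀ e : S × S, ∫ ω, (F (T e.1 e.2 ω) - F ω) ∂m =
      ∫ ω, F ω ∂(m.map (T e.1 e.2)) - ∫ ω, F ω ∂m := by
    intro e
    rw [integral_map (hT _ _).aemeasurable hF.aestronglyMeasurable, integral_sub _ (hi m)]
    exact Integrable.of_bound (hF.comp (hT _ _)).aestronglyMeasurable K (ae_of_all _ fun ω => hK _)
  rw [stepMeasure, integral_add_measure ((hi m).smul_measure ENNReal.ofReal_ne_top)
    (integrable_finsetSum_measure.2 hs), integral_finsetSum_measure hs]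
  simp only [integral_smul_measure, h1, mul_sub, Finset.sum_sub_distrib, smul_eq_mul,
    ENNReal.toReal_ofReal (hw _)]
  rw [ENNReal.toReal_ofReal (by linarith), ← Finset.sum_mul]
  ring

theorem map_stepMeasure {Ω' : Type*} [MeasurableSpace Ω'] {T' : S → S → Ω' → Ω'} {φ : Ω → Ω'}
    (hφ : Measurable φ) (hT : ∀ x y, Measurable (T x y)) (hT' : ∀ x y, Measurable (T' x y))
    (h : ∀ x y ω, φ (T x y ω) = T' x y (φ ω)) :
    (stepMeasure w E T m).map φ = stepMeasure w E T' (m.map φ) := by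
  have hmm : ∀ e : S × S, (m.map (T e.1 e.2)).map φ = (m.map φ).map (T' e.1 e.2) := by
    intro e
    rw [Measure.map_map hφ (hT _ _), Measure.map_map (hT' _ _) hφ]
    congr 1; funext ω; exact h _ _ _
  unfold stepMeasure
  rw [Measure.map_add _ _ hφ, Measure.map_smul]
  congr 1
  ext s hs
  rw [Measure.map_apply hφ hs]
  simp only [Measure.coe_finsetSum, Finset.sum_apply, Measure.smul_apply, ← hmm]
  exact Finset.sum_congr rfl fun e _ => by rw [Measure.map_apply hφ hs]

end

variable [DecidableEq S]

/-- The action of one step on functions. -/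
noncomputable def stepFun (w : S × S → ℝ) (E : Finset (S × S)) (f : (S → Bool) → ℝ)
    (η : S → Bool) : ℝ :=
  f η + ∑ e ∈ E, w e * (f (jump e.1 e.2 η) - f η)

theorem dependsOn_stepFun {w : S × S → ℝ} {E : Finset (S × S)} {f : (S → Bool) → ℝ} {F : Finset S}
    (hf : DependsOn f (F : Set S)) :
    DependsOn (stepFun w E f) ((F ∪ (E.image Prod.fst ∪ E.image Prod.snd) : Finset S) : Set S) := by
  intro η ξ h
  have h0 : f η = f ξ := hf fun i hi => h i (by simp at hi; simp [hi])
  unfold stepFun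
  rw [h0]
  congr 1
  refine Finset.sum_congr rfl fun e he => ?_
  congr 2
  refine hf fun i hi => ?_
  have hi' := h i (by simp at hi; simp [hi])
  have hx := h e.1 (by
    simp only [Finset.coe_union, Finset.coe_image, Set.mem_union, Set.mem_image]
    exact Or.inr (Or.inl ⟨e, he, rfl⟩))
  have hy := h e.2 (by
    simp only [Finset.coe_union, Finset.coe_image, Set.mem_union, Set.mem_image]
    exact Or.inr (Or.inr ⟨e, he, rfl⟩))
  unfold jump swapConfig
  rw [hx, hy]
  split_ifs <;> simp_all

theorem siteLip_stepFun {p : S → S → ℝ} (hp : IsTransition p) {V : S → ℝ} {C : ℝ}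
    (hV : ∀ x, 0 < V x) (hC : ∀ (x : S) (F : Finset S), ∑ y ∈ F, (p x y + p y x) * V y ≤ C * V x)
    {ε : ℝ} (hε : 0 ≤ ε) {E : Finset (S × S)} (hE : ∑ e ∈ E, ε * p e.1 e.2 ≤ 1)
    {f : (S → Bool) → ℝ} {L : ℝ} (hL : 0 ≤ L) (hf : SiteLip f (fun x => L * V x)) :
    SiteLip (stepFun (fun e => ε * p e.1 e.2) E f) (fun x => L * (1 + ε * C) * V x) := by
  intro η u b
  have hw : ∀ e : S × S, 0 ≤ ε * p e.1 e.2 := fun e => mul_nonneg hε (hp.1 _ _)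
  set ξ := Function.update η u b
  have hrw : stepFun (fun e => ε * p e.1 e.2) E f ξ - stepFun (fun e => ε * p e.1 e.2) E f η =
      (1 - ∑ e ∈ E, ε * p e.1 e.2) * (f ξ - f η) +
        ∑ e ∈ E, ε * p e.1 e.2 * (f (jump e.1 e.2 ξ) - f (jump e.1 e.2 η)) := by
    simp only [stepFun, mul_sub, Finset.sum_sub_distrib, sub_mul, ← Finset.sum_mul]
    ring
  have hLV : ∀ x, 0 ≤ L * V x := fun x => mul_nonneg hL (hV x).le
  have h1 : |(1 - ∑ e ∈ E, ε * p e.1 e.2) * (f ξ - f η)| ≤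
      (1 - ∑ e ∈ E, ε * p e.1 e.2) * (L * V u) := by
    rw [abs_mul, abs_of_nonneg (by linarith)]
    exact mul_le_mul_of_nonneg_left (hf η u b) (by linarith)
  have h2 : |∑ e ∈ E, ε * p e.1 e.2 * (f (jump e.1 e.2 ξ) - f (jump e.1 e.2 η))| ≤
      ∑ e ∈ E, ε * p e.1 e.2 * (L * V u + ((if u = e.1 then L * V e.2 else 0) +
        (if u = e.2 then L * V e.1 else 0))) := by
    refine (Finset.abs_sum_le_sum_abs _ _).trans (Finset.sum_le_sum fun e _ => ?_)
    rw [abs_mul, abs_of_nonneg (hw e)]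
    exact mul_le_mul_of_nonneg_left (hf.comp_jump hLV e.1 e.2 η u b) (hw e)
  have h3 : ∑ e ∈ E, p e.1 e.2 * ((if u = e.1 then V e.2 else 0) +
      (if u = e.2 then V e.1 else 0)) ≤ C * V u := by
    set A : Finset S := insert u (E.image Prod.fst ∪ E.image Prod.snd) with hA
    have huA : u ∈ A := Finset.mem_insert_self _ _
    have hsub : E ⊆ A ×ˢ A := by
      intro e he
      simp only [Finset.mem_product, hA, Finset.mem_insert, Finset.mem_union, Finset.mem_image]
      exact ⟨Or.inr (Or.inl ⟨e, he, rfl⟩), Or.inr (Or.inr ⟨e, he, rfl⟩)⟩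
    refine (Finset.sum_le_sum_of_subset_of_nonneg hsub fun e _ _ => ?_).trans ?_
    · refine mul_nonneg (hp.1 _ _) (add_nonneg ?_ ?_) <;> split_ifs <;> simp [(hV _).le]
    · rw [Finset.sum_product]
      simp only [mul_add, Finset.sum_add_distrib, mul_ite, mul_zero]
      rw [Finset.sum_comm (f := fun x y => if u = x then p x y * V y else 0)]
      simp only [Finset.sum_ite_eq, huA, if_true]
      refine le_trans (le_of_eq ?_) (hC u A)
      simp only [add_mul, Finset.sum_add_distrib]
  have h4 : ∑ e ∈ E, ε * p e.1 e.2 * (L * V u + ((if u = e.1 then L * V e.2 else 0) +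
        (if u = e.2 then L * V e.1 else 0))) = (∑ e ∈ E, ε * p e.1 e.2) * (L * V u) +
        ε * L * ∑ e ∈ E, p e.1 e.2 * ((if u = e.1 then V e.2 else 0) +
      (if u = e.2 then V e.1 else 0)) := by
    rw [Finset.sum_mul, Finset.mul_sum, ← Finset.sum_add_distrib]
    refine Finset.sum_congr rfl fun e _ => ?_
    split_ifs <;> ring
  rw [hrw]
  refine (abs_add_le _ _).trans ?_
  have h5 := mul_le_mul_of_nonneg_left h3 (mul_nonneg hε hL)
  rw [h4] at h2
  nlinarith

theorem abs_integral_step_sub_le [Countable S] {p : S → S → ℝ} (hp : IsTransition p) {V : S → ℝ}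
    (hV : ∀ x, 0 < V x) (hVs : Summable V)
    {E : Finset (S × S)} {δ : ℝ}
    (hδ : ∑' e : {e : S × S // e ∉ E}, p e.1.1 e.1.2 * (V e.1.1 + V e.1.2) ≤ δ)
    {μ : Measure (S → Bool)} (hμ : ExclInvariant p μ) {f : (S → Bool) → ℝ} {F : Finset S}
    (hfF : DependsOn f (F : Set S)) {L : ℝ} (hL : 0 ≤ L) (hf : SiteLip f (fun x => L * V x)) :
    |∑ e ∈ E, p e.1 e.2 * ∫ η, (f (jump e.1 e.2 η) - f η) ∂μ| ≤ L * δ := by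
  have := hμ.1
  have hLV : ∀ x, 0 ≤ L * V x := fun x => mul_nonneg hL (hV x).le
  obtain ⟨hs, heq⟩ := integral_gen (M := μ) hp (hVs.mul_left L) hLV hf.jumpBound measurable_jump
    hfF.measurable
  have h0 : ∑' e : S × S, p e.1 e.2 * ∫ η, (f (jump e.1 e.2 η) - f η) ∂μ = 0 := by
    rw [← heq, ← exclGen_eq_gen hp ⟨F, fun η ξ h => hfF h⟩]
    exact hμ.2 f ⟨F, fun η ξ h => hfF h⟩
  rw [← hs.sum_add_tsum_subtype_compl E] at h0
  have h1 : ∑ e ∈ E, p e.1 e.2 * ∫ η, (f (jump e.1 e.2 η) - f η) ∂μ =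
      - ∑' e : {e : S × S // e ∉ E}, p e.1.1 e.1.2 * ∫ η, (f (jump e.1.1 e.1.2 η) - f η) ∂μ := by
    linarith
  rw [h1, abs_neg]
  have hVe := hp.summable_edge hVs (fun x => (hV x).le)
  have hVe' : Summable fun e : {e : S × S // e ∉ E} =>
      L * (p e.1.1 e.1.2 * (V e.1.1 + V e.1.2)) := (hVe.subtype _).mul_left L
  have hb : ∀ e : {e : S × S // e ∉ E},
      ‖p e.1.1 e.1.2 * ∫ η, (f (jump e.1.1 e.1.2 η) - f η) ∂μ‖ ≤
        L * (p e.1.1 e.1.2 * (V e.1.1 + V e.1.2)) := by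
    intro e
    rw [norm_mul, Real.norm_of_nonneg (hp.1 _ _)]
    have h2 : ‖∫ η, (f (jump e.1.1 e.1.2 η) - f η) ∂μ‖ ≤ L * V e.1.1 + L * V e.1.2 := by
      refine (norm_integral_le_of_norm_le_const (ae_of_all _ fun η => hf.jumpBound _ _ η)).trans ?_
      simp
    have := mul_le_mul_of_nonneg_left h2 (hp.1 e.1.1 e.1.2)
    linarith
  refine (tsum_of_norm_bounded hVe'.hasSum hb).trans ?_
  rw [tsum_mul_left]
  exact mul_le_mul_of_nonneg_left hδ hL

theorem abs_integral_iterate_step_sub_le [Countable S] {p : S → S → ℝ} (hp : IsTransition p)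
    {V : S → ℝ} {C : ℝ} (hV : ∀ x, 0 < V x) (hVs : Summable V) (hC0 : 0 ≤ C)
    (hC : ∀ (x : S) (F : Finset S), ∑ y ∈ F, (p x y + p y x) * V y ≤ C * V x)
    {ε : ℝ} (hε : 0 ≤ ε) {E : Finset (S × S)} (hE : ∑ e ∈ E, ε * p e.1 e.2 ≤ 1) {δ : ℝ}
    (hδ : ∑' e : {e : S × S // e ∉ E}, p e.1.1 e.1.2 * (V e.1.1 + V e.1.2) ≤ δ)
    {μ : Measure (S → Bool)} (hμ : ExclInvariant p μ) (j : ℕ) :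
    ∀ {f : (S → Bool) → ℝ} {F : Finset S}, DependsOn f (F : Set S) → ∀ {L : ℝ}, 0 ≤ L →
      SiteLip f (fun x => L * V x) →
      |∫ η, f η ∂((stepMeasure (fun e => ε * p e.1 e.2) E jump)^[j] μ) - ∫ η, f η ∂μ| ≤
        j * (ε * δ * L * (1 + ε * C) ^ j) := by
  have hw : ∀ e : S × S, 0 ≤ ε * p e.1 e.2 := fun e => mul_nonneg hε (hp.1 _ _)
  have hpr : ∀ j, IsProbabilityMeasure ((stepMeasure (fun e => ε * p e.1 e.2) E jump)^[j] μ) := by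
    intro j
    induction j with
    | zero => exact hμ.1
    | succ j ih =>
      rw [Function.iterate_succ_apply']
      exact isProbabilityMeasure_stepMeasure hw hE measurable_jump
  have hδ0 : 0 ≤ δ := le_trans (tsum_nonneg fun e => mul_nonneg (hp.1 _ _)
    (add_nonneg (hV _).le (hV _).le)) hδ
  have key : ∀ (m : Measure (S → Bool)) [IsProbabilityMeasure m] {f : (S → Bool) → ℝ}
      {F : Finset S}, DependsOn f (F : Set S) →
      ∫ η, f η ∂(stepMeasure (fun e => ε * p e.1 e.2) E jump m) =
        ∫ η, stepFun (fun e => ε * p e.1 e.2) E f η ∂m := by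
    intro m _ f F hf
    obtain ⟨K, -, hK⟩ := hf.exists_bound
    have hi : ∀ e : S × S, Integrable (fun η => f (jump e.1 e.2 η) - f η) m := fun e =>
      (Integrable.of_bound (hf.measurable.comp (measurable_jump _ _)).aestronglyMeasurable K
        (ae_of_all _ fun ω => hK _)).sub (hf.integrable m)
    rw [integral_stepMeasure hw hE measurable_jump hf.measurable hK]
    unfold stepFun
    rw [integral_add (hf.integrable m) (integrable_finsetSum _ fun e _ => (hi e).const_mul _),
      integral_finsetSum _ fun e _ => (hi e).const_mul _]
    simp only [integral_const_mul]
  have hc1 : 1 ≤ 1 + ε * C := by nlinarith [mul_nonneg hε hC0]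
  induction j with
  | zero => intro f F _ L _ _; simp
  | succ j ih =>
    intro f F hfF L hL hf
    have := hpr j
    have := hμ.1
    rw [Function.iterate_succ_apply', key _ hfF]
    have h1 := ih (dependsOn_stepFun (w := fun e => ε * p e.1 e.2) (E := E) hfF)
      (L := L * (1 + ε * C)) (by positivity) (siteLip_stepFun hp hV hC hε hE hL hf)
    have h2 := abs_integral_step_sub_le hp hV hVs hδ hμ hfF hL hf
    obtain ⟨K, -, hK⟩ := hfF.exists_bound
    have h3 : ∫ η, stepFun (fun e => ε * p e.1 e.2) E f η ∂μ - ∫ η, f η ∂μ =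
        ε * ∑ e ∈ E, p e.1 e.2 * ∫ η, (f (jump e.1 e.2 η) - f η) ∂μ := by
      rw [← key μ hfF, integral_stepMeasure hw hE measurable_jump hfF.measurable hK,
        Finset.mul_sum, add_sub_cancel_left]
      exact Finset.sum_congr rfl fun e _ => by ring
    have h4 : |∫ η, stepFun (fun e => ε * p e.1 e.2) E f η ∂μ - ∫ η, f η ∂μ| ≤
        ε * δ * L * (1 + ε * C) ^ (j + 1) := by
      rw [h3, abs_mul, abs_of_nonneg hε]
      calc _ ≤ ε * (L * δ) := mul_le_mul_of_nonneg_left h2 hε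
        _ = ε * δ * L * 1 := by ring
        _ ≤ _ := mul_le_mul_of_nonneg_left (one_le_pow₀ hc1) (by positivity)
    have h5 := abs_sub_le
      (∫ η, stepFun (fun e => ε * p e.1 e.2) E f η
        ∂((stepMeasure (fun e => ε * p e.1 e.2) E jump)^[j] μ))
      (∫ η, stepFun (fun e => ε * p e.1 e.2) E f η ∂μ) (∫ η, f η ∂μ)
    refine h5.trans ((add_le_add h1 h4).trans (le_of_eq ?_))
    push_cast
    ring

end Step

section Coupling

variable {S : Type*}

/-- First component of a pair of configurations. -/
def fstConf (ω : S → Bool × Bool) : S → Bool := fun u => (ω u).1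

/-- Second component of a pair of configurations. -/
def sndConf (ω : S → Bool × Bool) : S → Bool := fun u => (ω u).2

theorem measurable_fstConf : Measurable (fstConf (S := S)) :=
  measurable_pi_lambda _ fun u => measurable_fst.comp (measurable_pi_apply u)

theorem measurable_sndConf : Measurable (sndConf (S := S)) :=
  measurable_pi_lambda _ fun u => measurable_snd.comp (measurable_pi_apply u)

/-- Attempted jump performed in both components simultaneously. -/
def coupledJump [DecidableEq S] (x y : S) (ω : S → Bool × Bool) : S → Bool × Bool :=
  fun u => (jump x y (fstConf ω) u, jump x y (sndConf ω) u)

theorem measurable_coupledJump [DecidableEq S] (x y : S) : Measurable (coupledJump x y) :=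
  measurable_pi_lambda _ fun u =>
    ((measurable_pi_apply u).comp ((measurable_jump x y).comp measurable_fstConf)).prodMk
      ((measurable_pi_apply u).comp ((measurable_jump x y).comp measurable_sndConf))

theorem continuous_coupledJump [DecidableEq S] (x y : S) : Continuous (coupledJump x y) := by
  have h1 : Continuous (fstConf (S := S)) := continuous_pi fun u =>
    continuous_fst.comp (continuous_apply u)
  have h2 : Continuous (sndConf (S := S)) := continuous_pi fun u =>
    continuous_snd.comp (continuous_apply u)
  exact continuous_pi fun u =>
    ((continuous_apply u).comp ((continuous_jump x y).comp h1)).prodMk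
      ((continuous_apply u).comp ((continuous_jump x y).comp h2))

theorem coupledJump_apply_of_ne [DecidableEq S] {x y u : S} (ω : S → Bool × Bool) (hx : u ≠ x)
    (hy : u ≠ y) : coupledJump x y ω u = ω u := by
  simp only [coupledJump, jump_apply_of_ne _ hx hy, fstConf, sndConf]

/-- Finite measures on configurations are determined by the probabilities of all sites in a finite
set being occupied. -/
theorem ext_of_forall_true {μ ν : Measure (S → Bool)} [IsFiniteMeasure μ]
    (h : ∀ F : Finset S, μ {η | ∀ x ∈ F, η x = true} = ν {η | ∀ x ∈ F, η x = true}) : μ = ν := by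
  classical
  refine ext_of_generate_finite (C := Set.range fun F : Finset S =>
    {η : S → Bool | ∀ x ∈ F, η x = true}) ?_ ?_ ?_ ?_
  · refine le_antisymm ?_ ?_
    · refine iSup_le fun x => ?_
      rintro _ ⟨s, -, rfl⟩
      have hx : MeasurableSet[MeasurableSpace.generateFrom (Set.range fun F : Finset S =>
          {η : S → Bool | ∀ x ∈ F, η x = true})] {η : S → Bool | η x = true} :=
        MeasurableSpace.measurableSet_generateFrom ⟨{x}, by simp⟩
      by_cases ht : true ∈ s <;> by_cases hf : false ∈ s
      · convert @MeasurableSet.univ _ (MeasurableSpace.generateFrom _) using 1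
        ext η; cases h : η x <;> simp [h, ht, hf]
      · convert hx using 1
        ext η; cases h : η x <;> simp [h, ht, hf]
      · convert hx.compl using 1
        ext η; cases h : η x <;> simp [h, ht, hf]
      · convert @MeasurableSet.empty _ (MeasurableSpace.generateFrom _) using 1
        ext η; cases h : η x <;> simp [h, ht, hf]
    · refine MeasurableSpace.generateFrom_le ?_
      rintro _ ⟨F, rfl⟩
      have : {η : S → Bool | ∀ x ∈ F, η x = true} = ⋂ x ∈ F, {η | η x = true} := by ext; simp
      simp only [this]
      exact Finset.measurableSet_biInter _ fun x _ =>
        measurableSet_eq_fun (measurable_pi_apply x) measurable_const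
  · rintro _ ⟨F, rfl⟩ _ ⟨G, rfl⟩ -
    refine ⟨F ∪ G, ?_⟩
    ext η
    simp only [Finset.mem_union, Set.mem_ofPred_eq, Set.mem_inter_iff]
    exact ⟨fun h => ⟨fun x hx => h x (Or.inl hx), fun x hx => h x (Or.inr hx)⟩,
      fun h x hx => hx.elim (h.1 x) (h.2 x)⟩
  · rintro _ ⟨F, rfl⟩; exact h F
  · simpa using h ∅

theorem measurableSet_forall_eq (F : Finset S) (a : S → Bool) :
    MeasurableSet {η : S → Bool | ∀ x ∈ F, η x = a x} := by
  have : {η : S → Bool | ∀ x ∈ F, η x = a x} = ⋂ x ∈ F, {η | η x = a x} := by ext; simp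
  rw [this]
  exact Finset.measurableSet_biInter _ fun x _ =>
    measurableSet_eq_fun (measurable_pi_apply x) measurable_const

theorem ext_of_integral_cylinder {μ ν : Measure (S → Bool)} [IsFiniteMeasure μ] [IsFiniteMeasure ν]
    (h : ∀ (f : (S → Bool) → ℝ) (F : Finset S), DependsOn f (F : Set S) →
      ∫ η, f η ∂μ = ∫ η, f η ∂ν) : μ = ν := by
  refine ext_of_forall_true fun F => ?_
  have hm := measurableSet_forall_eq F fun _ => true
  have h1 := h ({η : S → Bool | ∀ x ∈ F, η x = true}.indicator 1) F (by
    intro η ξ hηξ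
    have : (∀ x ∈ F, η x = true) ↔ (∀ x ∈ F, ξ x = true) :=
      forall₂_congr fun x hx => by rw [hηξ x hx]
    simp only [Set.indicator, Set.mem_ofPred_eq, this, Pi.one_apply])
  rw [integral_indicator_one hm, integral_indicator_one hm] at h1
  exact (measureReal_eq_measureReal_iff).1 h1

variable [DecidableEq S]

theorem exists_approx_coupling [Countable S] {p : S → S → ℝ} (hp : IsTransition p)
    {V : S → ℝ} {C : ℝ} (hV : ∀ x, 0 < V x) (hVs : Summable V) (hC0 : 0 ≤ C)
    (hC : ∀ (x : S) (F : Finset S), ∑ y ∈ F, (p x y + p y x) * V y ≤ C * V x)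
    {μ ν : Measure (S → Bool)} (hμ : ExclInvariant p μ) (hν : ExclInvariant p ν) {t : ℝ}
    (ht : 0 < t) :
    ∃ (M : ProbabilityMeasure (S → Bool × Bool)) (E : Finset (S × S)),
      (∀ (f : (S → Bool) → ℝ) (F : Finset S), DependsOn f (F : Set S) → ∀ L, 0 ≤ L →
        SiteLip f (fun x => L * V x) →
        |∫ ω, f (fstConf ω) ∂(M : Measure (S → Bool × Bool)) - ∫ η, f η ∂μ| ≤ L / t ∧
        |∫ ω, f (sndConf ω) ∂(M : Measure (S → Bool × Bool)) - ∫ η, f η ∂ν| ≤ L / t) ∧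
      (∀ (F : (S → Bool × Bool) → ℝ) (K : ℝ), Measurable F → (∀ ω, |F ω| ≤ K) →
        |∑ e ∈ E, p e.1 e.2 * ∫ ω, (F (coupledJump e.1 e.2 ω) - F ω)
          ∂(M : Measure (S → Bool × Bool))| ≤ 2 * K / t) ∧
      ∑' e : {e : S × S // e ∉ E}, p e.1.1 e.1.2 * (V e.1.1 + V e.1.2) ≤
        Real.exp (-(C * t)) / t ^ 2 := by
  have := hμ.1
  have := hν.1
  obtain ⟨E, hE⟩ := ((tendsto_order.1 (tendsto_tsum_compl_atTop_zero
    (fun e : S × S => p e.1 e.2 * (V e.1 + V e.2)))).2 (Real.exp (-(C * t)) / t ^ 2)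
    (by positivity)).exists
  set R := ∑ e ∈ E, p e.1 e.2 with hR
  have hR0 : 0 ≤ R := Finset.sum_nonneg fun e _ => hp.1 _ _
  obtain ⟨k, hk⟩ := exists_nat_ge (t * R + 1)
  have hk0 : (0 : ℝ) < k := by nlinarith
  set ε := t / k with hεdef
  have hε : 0 ≤ ε := by positivity
  have hkε : k * ε = t := by rw [hεdef]; field_simp
  have hE1 : ∑ e ∈ E, ε * p e.1 e.2 ≤ 1 := by
    rw [← Finset.mul_sum, ← hR, hεdef, div_mul_eq_mul_div, div_le_one hk0]
    linarith
  have hw : ∀ e : S × S, 0 ≤ ε * p e.1 e.2 := fun e => mul_nonneg hε (hp.1 _ _)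
  let m₀ : Measure (S → Bool × Bool) := (μ.prod ν).map fun q u => (q.1 u, q.2 u)
  have hφ : Measurable fun (q : (S → Bool) × (S → Bool)) (u : S) => (q.1 u, q.2 u) := by
    fun_prop
  have hm₀ : IsProbabilityMeasure m₀ := Measure.isProbabilityMeasure_map hφ.aemeasurable
  let m : ℕ → Measure (S → Bool × Bool) := fun j =>
    (stepMeasure (fun e => ε * p e.1 e.2) E coupledJump)^[j] m₀
  have hms : ∀ j, m (j + 1) = stepMeasure (fun e => ε * p e.1 e.2) E coupledJump (m j) := fun j =>
    Function.iterate_succ_apply' _ _ _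
  have hmp : ∀ j, IsProbabilityMeasure (m j) := by
    intro j
    induction j with
    | zero => exact hm₀
    | succ j ih =>
      rw [hms]
      exact isProbabilityMeasure_stepMeasure hw hE1 measurable_coupledJump
  have hm1 : ∀ j, (m j).map fstConf = (stepMeasure (fun e => ε * p e.1 e.2) E jump)^[j] μ := by
    intro j
    induction j with
    | zero =>
      change (Measure.map _ (μ.prod ν)).map fstConf = μ
      rw [Measure.map_map measurable_fstConf hφ]
      change (μ.prod ν).map Prod.fst = μ
      simp
    | succ j ih =>
      rw [hms, Function.iterate_succ_apply', ← ih]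
      exact map_stepMeasure measurable_fstConf measurable_coupledJump measurable_jump
        fun x y ω => rfl
  have hm2 : ∀ j, (m j).map sndConf = (stepMeasure (fun e => ε * p e.1 e.2) E jump)^[j] ν := by
    intro j
    induction j with
    | zero =>
      change (Measure.map _ (μ.prod ν)).map sndConf = ν
      rw [Measure.map_map measurable_sndConf hφ]
      change (μ.prod ν).map Prod.snd = ν
      simp
    | succ j ih =>
      rw [hms, Function.iterate_succ_apply', ← ih]
      exact map_stepMeasure measurable_sndConf measurable_coupledJump measurable_jump
        fun x y ω => rfl
  let M : Measure (S → Bool × Bool) := ∑ j ∈ Finset.range k, ENNReal.ofReal (1 / k) • m j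
  have hMp : IsProbabilityMeasure M := by
    constructor
    simp only [M, Measure.coe_finsetSum, Measure.coe_smul, Finset.sum_apply, Pi.smul_apply,
      measure_univ, smul_eq_mul, mul_one, Finset.sum_const, Finset.card_range, nsmul_eq_mul]
    rw [← ENNReal.ofReal_natCast, ← ENNReal.ofReal_mul hk0.le, mul_one_div_cancel hk0.ne',
      ENNReal.ofReal_one]
  have hMi : ∀ (F : (S → Bool × Bool) → ℝ) (K : ℝ), Measurable F → (∀ ω, |F ω| ≤ K) →
      ∫ ω, F ω ∂M = 1 / k * ∑ j ∈ Finset.range k, ∫ ω, F ω ∂(m j) := by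
    intro F K hF hK
    have hi : ∀ j ∈ Finset.range k, Integrable F (ENNReal.ofReal (1 / k) • m j) := fun j _ =>
      (Integrable.of_bound hF.aestronglyMeasurable K (ae_of_all _ hK)).smul_measure
        ENNReal.ofReal_ne_top
    simp only [M]
    rw [integral_finsetSum_measure hi]
    simp only [integral_smul_measure, smul_eq_mul, ENNReal.toReal_ofReal (one_div_nonneg.2 hk0.le),
      Finset.mul_sum]
  have havg : ∀ (a : ℕ → ℝ) (b c : ℝ), (∀ j ∈ Finset.range k, |a j - b| ≤ c) →
      |1 / k * ∑ j ∈ Finset.range k, a j - b| ≤ c := by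
    intro a b c h
    have h1 : 1 / k * ∑ j ∈ Finset.range k, a j - b =
        1 / k * ∑ j ∈ Finset.range k, (a j - b) := by
      rw [Finset.sum_sub_distrib, Finset.sum_const, Finset.card_range, nsmul_eq_mul]
      field_simp
    rw [h1, abs_mul, abs_of_nonneg (one_div_nonneg.2 hk0.le)]
    have h2 := (Finset.abs_sum_le_sum_abs (fun j => a j - b) (Finset.range k)).trans
      (Finset.sum_le_sum h)
    rw [Finset.sum_const, Finset.card_range, nsmul_eq_mul] at h2
    calc _ ≤ 1 / (k : ℝ) * (k * c) := mul_le_mul_of_nonneg_left h2 (one_div_nonneg.2 hk0.le)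
      _ = c := by field_simp
  have hmarg : ∀ {ρ : Measure (S → Bool)}, ExclInvariant p ρ →
      ∀ (f : (S → Bool) → ℝ) (F : Finset S), DependsOn f (F : Set S) → ∀ L, 0 ≤ L →
        SiteLip f (fun x => L * V x) → ∀ j ∈ Finset.range k,
        |∫ η, f η ∂((stepMeasure (fun e => ε * p e.1 e.2) E jump)^[j] ρ) - ∫ η, f η ∂ρ| ≤ L / t := by
    intro ρ hρ f F hfF L hL hf j hj
    refine (abs_integral_iterate_step_sub_le hp hV hVs hC0 hC hε hE1 hE.le hρ j hfF hL hf).trans ?_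
    have hjk : (j : ℝ) ≤ k := by exact_mod_cast (Finset.mem_range.1 hj).le
    have h1 : (1 + ε * C) ^ j ≤ Real.exp (C * t) := by
      calc (1 + ε * C) ^ j ≤ (1 + ε * C) ^ k :=
            pow_le_pow_right₀ (by nlinarith [mul_nonneg hε hC0]) (Finset.mem_range.1 hj).le
        _ ≤ (Real.exp (ε * C)) ^ k := by
            refine pow_le_pow_left₀ (by positivity) ?_ _
            linarith [Real.add_one_le_exp (ε * C)]
        _ = Real.exp (C * t) := by rw [← Real.exp_nat_mul, ← mul_assoc, hkε, mul_comm]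
    calc (j : ℝ) * (ε * (Real.exp (-(C * t)) / t ^ 2) * L * (1 + ε * C) ^ j)
        ≤ k * (ε * (Real.exp (-(C * t)) / t ^ 2) * L * Real.exp (C * t)) := by gcongr
      _ = (k * ε) * L / t ^ 2 * (Real.exp (-(C * t)) * Real.exp (C * t)) := by ring
      _ = L / t := by
          rw [hkε, ← Real.exp_add, neg_add_cancel, Real.exp_zero]; field_simp
  refine ⟨⟨M, hMp⟩, E, fun f F hfF L hL hf => ⟨?_, ?_⟩, fun F K hF hK => ?_, hE.le⟩
  · obtain ⟨K, -, hK⟩ := hfF.exists_bound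
    change |∫ ω, f (fstConf ω) ∂M - _| ≤ _
    rw [hMi (fun ω => f (fstConf ω)) K (hfF.measurable.comp measurable_fstConf) fun ω => hK _]
    refine havg _ _ _ fun j hj => ?_
    rw [← integral_map measurable_fstConf.aemeasurable hfF.measurable.aestronglyMeasurable, hm1]
    exact hmarg hμ f F hfF L hL hf j hj
  · obtain ⟨K, -, hK⟩ := hfF.exists_bound
    change |∫ ω, f (sndConf ω) ∂M - _| ≤ _
    rw [hMi (fun ω => f (sndConf ω)) K (hfF.measurable.comp measurable_sndConf) fun ω => hK _]
    refine havg _ _ _ fun j hj => ?_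
    rw [← integral_map measurable_sndConf.aemeasurable hfF.measurable.aestronglyMeasurable, hm2]
    exact hmarg hν f F hfF L hL hf j hj
  · change |∑ e ∈ E, p e.1 e.2 * ∫ ω, (F (coupledJump e.1 e.2 ω) - F ω) ∂M| ≤ _
    have h1 : ∀ e : S × S, ∫ ω, (F (coupledJump e.1 e.2 ω) - F ω) ∂M = 1 / k *
        ∑ j ∈ Finset.range k, ∫ ω, (F (coupledJump e.1 e.2 ω) - F ω) ∂(m j) := fun e =>
      hMi _ (K + K) ((hF.comp (measurable_coupledJump _ _)).sub hF) fun ω =>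
        (abs_sub _ _).trans (add_le_add (hK _) (hK _))
    have h2 : ∀ j, ∫ ω, F ω ∂(m (j + 1)) - ∫ ω, F ω ∂(m j) =
        ∑ e ∈ E, ε * p e.1 e.2 * ∫ ω, (F (coupledJump e.1 e.2 ω) - F ω) ∂(m j) := by
      intro j
      have := hmp j
      rw [hms, integral_stepMeasure hw hE1 measurable_coupledJump hF hK, add_sub_cancel_left]
    have h3 := Finset.sum_range_sub (fun j => ∫ ω, F ω ∂(m j)) k
    simp only [h2] at h3
    have h4 : ∑ e ∈ E, p e.1 e.2 * ∫ ω, (F (coupledJump e.1 e.2 ω) - F ω) ∂M =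
        (∫ ω, F ω ∂(m k) - ∫ ω, F ω ∂(m 0)) / t := by
      rw [← h3, Finset.sum_comm, ← hkε, eq_div_iff (by rw [hkε]; exact ht.ne'), Finset.sum_mul]
      refine Finset.sum_congr rfl fun e _ => ?_
      rw [h1, ← Finset.mul_sum]
      field_simp
    have h5 : ∀ j, |∫ ω, F ω ∂(m j)| ≤ K := fun j => by
      have := hmp j
      simpa using norm_integral_le_of_norm_le_const (μ := m j) (f := F) (ae_of_all _ hK)
    rw [h4, abs_div, abs_of_pos ht]
    gcongr
    have := abs_sub (∫ ω, F ω ∂(m k)) (∫ ω, F ω ∂(m 0))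
    linarith [h5 k, h5 0]

/-- Two invariant measures have a coupling which is invariant for the coupled dynamics. -/
theorem exists_invariant_coupling [Countable S] {p : S → S → ℝ} (hp : IsTransition p)
    {μ ν : Measure (S → Bool)} (hμ : ExclInvariant p μ) (hν : ExclInvariant p ν) :
    ∃ M : Measure (S → Bool × Bool), IsProbabilityMeasure M ∧ M.map fstConf = μ ∧
      M.map sndConf = ν ∧ ∀ (F : (S → Bool × Bool) → ℝ) (A : Finset S), DependsOn F (A : Set S) →
        ∫ ω, gen p coupledJump F ω ∂M = 0 := by
  have := hμ.1
  have := hν.1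
  obtain ⟨V, C, hV, hVs, hC0, hC⟩ := exists_weight hp
  have ht : ∀ n : ℕ, (0 : ℝ) < n + 1 := fun n => by positivity
  choose M E hmarg hinv htail using fun n : ℕ =>
    exists_approx_coupling hp hV hVs hC0 hC hμ hν (ht n)
  let U : Ultrafilter ℕ := hyperfilter ℕ
  have hU : (U : Filter ℕ) ≤ atTop := by
    rw [← Nat.cofinite_eq_atTop]; exact hyperfilter_le_cofinite
  obtain ⟨N, -, hN⟩ := (isCompact_univ (X :=
    ProbabilityMeasure (S → Bool × Bool))).ultrafilter_le_nhds
    (U.map M) (by simp)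
  have hN : Tendsto M U (𝓝 N) := hN
  have hlim : ∀ F : (S → Bool × Bool) → ℝ, Continuous F → (∃ K, ∀ ω, |F ω| ≤ K) →
      Tendsto (fun n => ∫ ω, F ω ∂(M n : Measure (S → Bool × Bool))) U
        (𝓝 (∫ ω, F ω ∂(N : Measure (S → Bool × Bool)))) := by
    rintro F hF ⟨K, hK⟩
    exact (ProbabilityMeasure.tendsto_iff_forall_integral_tendsto.1 hN)
      (BoundedContinuousFunction.ofNormedAddCommGroup F hF K hK)
  have hinvt : ∀ L : ℝ, Tendsto (fun n : ℕ => L / ((n : ℝ) + 1)) U (𝓝 0) := fun L =>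
    (tendsto_const_div_atTop_nhds_zero_nat L |>.comp (tendsto_add_atTop_nat 1)).congr
      (fun n => by simp) |>.mono_left hU
  refine ⟨N, inferInstance, ?_, ?_, fun F A hF => ?_⟩
  · have : IsProbabilityMeasure ((N : Measure (S → Bool × Bool)).map fstConf) :=
      Measure.isProbabilityMeasure_map measurable_fstConf.aemeasurable
    refine ext_of_integral_cylinder fun f F hf => ?_
    rw [integral_map measurable_fstConf.aemeasurable hf.measurable.aestronglyMeasurable]
    obtain ⟨L, hL, hfL⟩ := hf.exists_siteLip hV
    obtain ⟨K, -, hK⟩ := hf.exists_bound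
    refine tendsto_nhds_unique (hlim (fun ω => f (fstConf ω)) (hf.continuous.comp
      (continuous_pi fun u => continuous_fst.comp (continuous_apply u))) ⟨K, fun ω => hK _⟩) ?_
    refine tendsto_iff_dist_tendsto_zero.2 (squeeze_zero (fun _ => dist_nonneg) (fun n => ?_)
      (hinvt L))
    exact (hmarg n f F hf L hL hfL).1
  · have : IsProbabilityMeasure ((N : Measure (S → Bool × Bool)).map sndConf) :=
      Measure.isProbabilityMeasure_map measurable_sndConf.aemeasurable
    refine ext_of_integral_cylinder fun f F hf => ?_
    rw [integral_map measurable_sndConf.aemeasurable hf.measurable.aestronglyMeasurable]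
    obtain ⟨L, hL, hfL⟩ := hf.exists_siteLip hV
    obtain ⟨K, -, hK⟩ := hf.exists_bound
    refine tendsto_nhds_unique (hlim (fun ω => f (sndConf ω)) (hf.continuous.comp
      (continuous_pi fun u => continuous_snd.comp (continuous_apply u))) ⟨K, fun ω => hK _⟩) ?_
    refine tendsto_iff_dist_tendsto_zero.2 (squeeze_zero (fun _ => dist_nonneg) (fun n => ?_)
      (hinvt L))
    exact (hmarg n f F hf L hL hfL).2
  · obtain ⟨K, hK0, hK⟩ := hF.exists_bound
    obtain ⟨B, hB0, hB⟩ := hF.exists_jumpBound (T := coupledJump)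
      fun x y ω u hx hy => coupledJump_apply_of_ne ω hx hy
    have hB' : ∀ x, 0 ≤ Set.indicator (A : Set S) (fun _ => B) x := fun x =>
      Set.indicator_nonneg (fun _ _ => hB0) x
    obtain ⟨-, heq⟩ := integral_gen (M := (N : Measure (S → Bool × Bool))) hp
      (summable_indicator_finset A B) hB' hB measurable_coupledJump hF.measurable
    rw [heq]
    have hedge := hp.summable_edge (summable_indicator_finset A B) hB'
    have hterm : ∀ (m : Measure (S → Bool × Bool)) [IsProbabilityMeasure m] (e : S × S),
        ‖p e.1 e.2 * ∫ ω, (F (coupledJump e.1 e.2 ω) - F ω) ∂m‖ ≤ p e.1 e.2 *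
          (Set.indicator (A : Set S) (fun _ => B) e.1 +
            Set.indicator (A : Set S) (fun _ => B) e.2) := by
      intro m _ e
      rw [norm_mul, Real.norm_of_nonneg (hp.1 _ _)]
      refine mul_le_mul_of_nonneg_left ?_ (hp.1 _ _)
      refine (norm_integral_le_of_norm_le_const (ae_of_all _ fun η => hB _ _ η)).trans ?_
      simp
    have h1 : Tendsto (fun n => ∑' e : S × S, p e.1 e.2 * ∫ ω, (F (coupledJump e.1 e.2 ω) - F ω)
        ∂(M n : Measure (S → Bool × Bool))) U
        (𝓝 (∑' e : S × S, p e.1 e.2 * ∫ ω, (F (coupledJump e.1 e.2 ω) - F ω)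
          ∂(N : Measure (S → Bool × Bool)))) := by
      refine tendsto_tsum_of_dominated_convergence hedge (fun e => ?_)
        (Eventually.of_forall fun n e => hterm _ e)
      refine (hlim _ ((hF.continuous.comp (continuous_coupledJump _ _)).sub hF.continuous)
        ⟨K + K, fun ω => (abs_sub _ _).trans (add_le_add (hK _) (hK _))⟩).const_mul _
    refine tendsto_nhds_unique h1 ?_
    set W := ∑ x ∈ A, B / V x
    have hWB : ∀ x, Set.indicator (A : Set S) (fun _ => B) x ≤ W * V x := by
      intro x
      have hW0 : 0 ≤ W := Finset.sum_nonneg fun x _ => div_nonneg hB0 (hV x).le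
      by_cases hx : x ∈ A
      · rw [Set.indicator_of_mem (by exact hx)]
        have := Finset.single_le_sum (f := fun x => B / V x)
          (fun x _ => div_nonneg hB0 (hV x).le) hx
        exact (div_le_iff₀ (hV x)).1 this
      · rw [Set.indicator_of_notMem (by exact hx)]
        exact mul_nonneg hW0 (hV x).le
    have hVe := hp.summable_edge hVs (fun x => (hV x).le)
    have hW0 : 0 ≤ W := Finset.sum_nonneg fun x _ => div_nonneg hB0 (hV x).le
    refine squeeze_zero_norm (a := fun n : ℕ => (2 * K + W) / ((n : ℝ) + 1)) (fun n => ?_) (hinvt _)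
    have hs : Summable fun e : S × S => p e.1 e.2 * ∫ ω, (F (coupledJump e.1 e.2 ω) - F ω)
        ∂(M n : Measure (S → Bool × Bool)) := Summable.of_norm_bounded hedge fun e => hterm _ e
    rw [← hs.sum_add_tsum_subtype_compl (E n)]
    refine (norm_add_le _ _).trans ?_
    rw [add_div]
    refine add_le_add (hinv n F K hF.measurable hK) ?_
    have h2 : ∀ e : {e : S × S // e ∉ E n},
        ‖p e.1.1 e.1.2 * ∫ ω, (F (coupledJump e.1.1 e.1.2 ω) - F ω)
          ∂(M n : Measure (S → Bool × Bool))‖ ≤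
          W * (p e.1.1 e.1.2 * (V e.1.1 + V e.1.2)) := by
      intro e
      refine (hterm _ e.1).trans ?_
      have := mul_le_mul_of_nonneg_left (add_le_add (hWB e.1.1) (hWB e.1.2)) (hp.1 e.1.1 e.1.2)
      linarith
    refine (tsum_of_norm_bounded ((hVe.subtype _).mul_left W).hasSum h2).trans ?_
    rw [tsum_mul_left, div_eq_mul_inv W]
    refine mul_le_mul_of_nonneg_left ((htail n).trans ?_) hW0
    have h3 : Real.exp (-(C * ((n : ℝ) + 1))) ≤ 1 :=
      Real.exp_le_one_iff.2 (by have := mul_nonneg hC0 (ht n).le; linarith)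
    have h4 : (1 : ℝ) ≤ n + 1 := by linarith [Nat.cast_nonneg (α := ℝ) n]
    rw [div_le_iff₀ (pow_pos (ht n) 2), pow_two, ← mul_assoc, inv_mul_cancel₀ (ht n).ne']
    linarith

end Coupling

section Pairs

variable {S : Type*}

/-- Indicator of the pair of occupation values at `x` being `s`. -/
def pairInd (s : Bool × Bool) (x : S) (ω : S → Bool × Bool) : ℝ := if ω x = s then 1 else 0

theorem pairInd_nonneg (s : Bool × Bool) (x : S) (ω : S → Bool × Bool) : 0 ≤ pairInd s x ω := by
  unfold pairInd; split_ifs <;> simp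

theorem pairInd_le_one (s : Bool × Bool) (x : S) (ω : S → Bool × Bool) : pairInd s x ω ≤ 1 := by
  unfold pairInd; split_ifs <;> simp

theorem measurable_pairInd (s : Bool × Bool) (x : S) : Measurable (pairInd s x) :=
  (measurable_of_countable fun b : Bool × Bool => if b = s then (1 : ℝ) else 0).comp
    (measurable_pi_apply x)

/-- Current of positive discrepancies for the attempt `(x, y)`. -/
def pairCurrent (x y : S) (ω : S → Bool × Bool) : ℝ :=
  pairInd (true, false) x ω * pairInd (false, false) y ω -
    pairInd (true, false) y ω * pairInd (true, true) x ω

theorem pairCurrent_sub (x y : S) (ω : S → Bool × Bool) :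
    pairCurrent x y ω - pairCurrent y x ω =
      pairInd (true, false) x ω - pairInd (true, false) y ω -
        pairInd (true, false) x ω * pairInd (false, true) y ω +
        pairInd (true, false) y ω * pairInd (false, true) x ω := by
  unfold pairCurrent pairInd
  rcases ω x with ⟨_ | _, _ | _⟩ <;> rcases ω y with ⟨_ | _, _ | _⟩ <;> norm_num

theorem abs_pairCurrent_le (x y : S) (ω : S → Bool × Bool) : |pairCurrent x y ω| ≤ 1 := by
  unfold pairCurrent pairInd
  rcases ω x with ⟨_ | _, _ | _⟩ <;> rcases ω y with ⟨_ | _, _ | _⟩ <;> norm_num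

variable [DecidableEq S]

/-- Real valued indicator of a finite set. -/
def ind (A : Finset S) (x : S) : ℝ := if x ∈ A then 1 else 0

theorem ind_nonneg (A : Finset S) (x : S) : 0 ≤ ind A x := by unfold ind; split_ifs <;> simp

theorem ind_le_one (A : Finset S) (x : S) : ind A x ≤ 1 := by unfold ind; split_ifs <;> simp

theorem summable_ind (A : Finset S) : Summable (ind A) :=
  summable_of_ne_finset_zero (s := A) fun x hx => by simp [ind, hx]

theorem ind_mono {A B : Finset S} (h : A ⊆ B) (x : S) : ind A x ≤ ind B x := by
  unfold ind
  by_cases hx : x ∈ A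
  · simp [hx, h hx]
  · simp only [hx, if_false]; split_ifs <;> simp

/-- The total rate of attempted jumps across the boundary of `A`. -/
noncomputable def flux (p : S → S → ℝ) (A : Finset S) : ℝ :=
  ∑' e : S × S, p e.1 e.2 * |ind A e.2 - ind A e.1|

theorem abs_ind_sub_le (A : Finset S) (x y : S) : |ind A y - ind A x| ≤ ind A x + ind A y := by
  have := abs_sub (ind A y) (ind A x)
  rw [abs_of_nonneg (ind_nonneg A x), abs_of_nonneg (ind_nonneg A y)] at this
  linarith

theorem summable_flux {p : S → S → ℝ} (hp : IsTransition p) (A : Finset S) :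
    Summable fun e : S × S => p e.1 e.2 * |ind A e.2 - ind A e.1| :=
  Summable.of_nonneg_of_le (fun _ => mul_nonneg (hp.1 _ _) (abs_nonneg _))
    (fun _ => mul_le_mul_of_nonneg_left (abs_ind_sub_le A _ _) (hp.1 _ _))
    (hp.summable_edge (summable_ind A) (ind_nonneg A))

/-- Along `Λ`, gradient currents have vanishing average flux through the boundary. -/
def NoFlux (p : S → S → ℝ) (Λ : ℕ → Finset S) : Prop :=
  ∀ (g : S → ℝ) (d j : S → S → ℝ), (∀ x, 0 ≤ g x) → (∀ x, g x ≤ 1) → (∀ x y, |j x y| ≤ 1) →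
    (∀ x y, 0 ≤ d x y) → (∀ x y, j x y - j y x = g x - g y - d x y + d y x) →
    Summable (fun e : S × S => p e.1 e.2 * (d e.1 e.2 + d e.2 e.1)) →
    Tendsto (fun N : ℕ => (∑ n ∈ Finset.range N,
      ∑' e : S × S, p e.1 e.2 * ((ind (Λ n) e.2 - ind (Λ n) e.1) * j e.1 e.2)) / N) atTop (𝓝 0)

theorem coupledJump_left (x y : S) (ω : S → Bool × Bool) :
    coupledJump x y ω x = ((ω x).1 && (ω y).1, (ω x).2 && (ω y).2) := by
  simp only [coupledJump, jump_apply_left, fstConf, sndConf]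

theorem coupledJump_right {x y : S} (h : x ≠ y) (ω : S → Bool × Bool) :
    coupledJump x y ω y = ((ω x).1 || (ω y).1, (ω x).2 || (ω y).2) := by
  simp only [coupledJump, jump_apply_right h, fstConf, sndConf]

theorem coupledJump_self (x : S) (ω : S → Bool × Bool) : coupledJump x x ω = ω := by
  funext u; simp only [coupledJump, jump_self, fstConf, sndConf]

theorem sum_pairInd_coupledJump (A : Finset S) (x y : S) (ω : S → Bool × Bool) :
    ∑ u ∈ A, pairInd (true, false) u (coupledJump x y ω) - ∑ u ∈ A, pairInd (true, false) u ω =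
      (ind A y - ind A x) * pairCurrent x y ω -
        (ind A x * (pairInd (true, false) x ω * pairInd (false, true) y ω) +
          ind A y * (pairInd (true, false) y ω * pairInd (false, true) x ω)) := by
  rw [← Finset.sum_sub_distrib]
  by_cases hxy : x = y
  · subst hxy
    simp only [coupledJump_self, sub_self, Finset.sum_const_zero]
    unfold pairInd
    rcases ω x with ⟨_ | _, _ | _⟩ <;> norm_num
  set D : S → ℝ := fun u => pairInd (true, false) u (coupledJump x y ω) - pairInd (true, false) u ω
  have h0 : ∀ u, D u = (if u = x then D x else 0) + (if u = y then D y else 0) := by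
    intro u
    by_cases hx : u = x
    · subst hx; simp [hxy]
    by_cases hy : u = y
    · subst hy; simp [hx]
    simp only [hx, hy, if_false, add_zero, D, pairInd, coupledJump_apply_of_ne ω hx hy, sub_self]
  have h1 : ∑ u ∈ A, D u = ind A x * D x + ind A y * D y := by
    rw [Finset.sum_congr rfl fun u _ => h0 u, Finset.sum_add_distrib, Finset.sum_ite_eq',
      Finset.sum_ite_eq']
    simp only [ind, ite_mul, one_mul, zero_mul]
  have h2 : D x = - pairCurrent x y ω - pairInd (true, false) x ω * pairInd (false, true) y ω := by
    simp only [D, pairInd, pairCurrent, coupledJump_left]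
    rcases ω x with ⟨_ | _, _ | _⟩ <;> rcases ω y with ⟨_ | _, _ | _⟩ <;> norm_num
  have h3 : D y = pairCurrent x y ω - pairInd (true, false) y ω * pairInd (false, true) x ω := by
    simp only [D, pairInd, pairCurrent, coupledJump_right hxy]
    rcases ω x with ⟨_ | _, _ | _⟩ <;> rcases ω y with ⟨_ | _, _ | _⟩ <;> norm_num
  rw [h1, h2, h3]; ring

/-- An invariant coupling has no discrepancies of opposite sign across an edge. -/
theorem rate_mul_integral_pair_eq_zero [Countable S] {p : S → S → ℝ} (hp : IsTransition p)
    {Λ : ℕ → Finset S} (hΛ : Monotone Λ) (hcov : ∀ x, ∃ n, x ∈ Λ n) {B : ℝ}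
    (hB : ∀ n, flux p (Λ n) ≤ B) (hno : NoFlux p Λ) {M : Measure (S → Bool × Bool)}
    [IsProbabilityMeasure M]
    (hM : ∀ (F : (S → Bool × Bool) → ℝ) (A : Finset S), DependsOn F (A : Set S) →
      ∫ ω, gen p coupledJump F ω ∂M = 0) (x y : S) :
    p x y * ∫ ω, pairInd (true, false) x ω * pairInd (false, true) y ω ∂M = 0 := by
  set g : S → ℝ := fun x => ∫ ω, pairInd (true, false) x ω ∂M with hg
  set d : S → S → ℝ := fun x y =>
    ∫ ω, pairInd (true, false) x ω * pairInd (false, true) y ω ∂M with hd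
  set j : S → S → ℝ := fun x y => ∫ ω, pairCurrent x y ω ∂M with hj
  have hi1 : ∀ s (x : S), Integrable (pairInd s x) M := fun s x =>
    Integrable.of_bound (measurable_pairInd s x).aestronglyMeasurable 1 (ae_of_all _ fun ω => by
      rw [Real.norm_of_nonneg (pairInd_nonneg _ _ _)]; exact pairInd_le_one _ _ _)
  have hi2 : ∀ s s' (x y : S), Integrable (fun ω => pairInd s x ω * pairInd s' y ω) M :=
    fun s s' x y => Integrable.of_bound
      ((measurable_pairInd s x).mul (measurable_pairInd s' y)).aestronglyMeasurable 1
      (ae_of_all _ fun ω => by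
        rw [Real.norm_of_nonneg (mul_nonneg (pairInd_nonneg _ _ _) (pairInd_nonneg _ _ _))]
        exact mul_le_one₀ (pairInd_le_one _ _ _) (pairInd_nonneg _ _ _) (pairInd_le_one _ _ _))
  have hi3 : ∀ x y : S, Integrable (pairCurrent x y) M := fun x y => (hi2 _ _ _ _).sub (hi2 _ _ _ _)
  have hd0 : ∀ x y, 0 ≤ d x y := fun x y => integral_nonneg fun ω =>
    mul_nonneg (pairInd_nonneg _ _ _) (pairInd_nonneg _ _ _)
  have hd1 : ∀ x y, d x y ≤ 1 := fun x y => by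
    have := integral_mono (hi2 (true, false) (false, true) x y) (integrable_const 1) fun ω =>
      mul_le_one₀ (pairInd_le_one (true, false) x ω) (pairInd_nonneg _ _ _)
        (pairInd_le_one (false, true) y ω)
    simpa using this
  have hj1 : ∀ x y, |j x y| ≤ 1 := fun x y => by
    have := norm_integral_le_of_norm_le_const (μ := M) (f := pairCurrent x y)
      (ae_of_all _ (abs_pairCurrent_le x y))
    simpa using this
  have hjd : ∀ x y, j x y - j y x = g x - g y - d x y + d y x := by
    intro x y
    simp only [hj, hg, hd]
    have e1 : Integrable (fun ω => pairInd (true, false) x ω - pairInd (true, false) y ω) M :=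
      (hi1 _ _).sub (hi1 _ _)
    have e2 : Integrable (fun ω => pairInd (true, false) x ω - pairInd (true, false) y ω -
        pairInd (true, false) x ω * pairInd (false, true) y ω) M := e1.sub (hi2 _ _ _ _)
    rw [← integral_sub (hi3 _ _) (hi3 _ _), ← integral_sub (hi1 _ _) (hi1 _ _),
      ← integral_sub e1 (hi2 _ _ _ _), ← integral_add e2 (hi2 _ _ _ _)]
    exact integral_congr_ae (ae_of_all _ fun ω => pairCurrent_sub x y ω)
  have hsj : ∀ n, Summable fun e : S × S =>
      p e.1 e.2 * ((ind (Λ n) e.2 - ind (Λ n) e.1) * j e.1 e.2) := by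
    intro n
    refine Summable.of_norm_bounded (summable_flux hp (Λ n)) fun e => ?_
    rw [norm_mul, norm_mul, Real.norm_of_nonneg (hp.1 _ _)]
    exact mul_le_mul_of_nonneg_left (mul_le_of_le_one_right (norm_nonneg _) (hj1 _ _)) (hp.1 _ _)
  have hD0 : ∀ n (e : S × S), 0 ≤ p e.1 e.2 *
      (ind (Λ n) e.1 * d e.1 e.2 + ind (Λ n) e.2 * d e.2 e.1) := fun n e =>
    mul_nonneg (hp.1 _ _) (add_nonneg (mul_nonneg (ind_nonneg _ _) (hd0 _ _))
        (mul_nonneg (ind_nonneg _ _) (hd0 _ _)))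
  have hsd : ∀ n, Summable fun e : S × S =>
      p e.1 e.2 * (ind (Λ n) e.1 * d e.1 e.2 + ind (Λ n) e.2 * d e.2 e.1) := by
    intro n
    refine Summable.of_nonneg_of_le (hD0 n) (fun e => ?_)
      (hp.summable_edge (summable_ind (Λ n)) (ind_nonneg _))
    exact mul_le_mul_of_nonneg_left (add_le_add
      (mul_le_of_le_one_right (ind_nonneg _ _) (hd1 _ _))
      (mul_le_of_le_one_right (ind_nonneg _ _) (hd1 _ _))) (hp.1 _ _)
  set D : ℕ → ℝ := fun n => ∑' e : S × S,
    p e.1 e.2 * (ind (Λ n) e.1 * d e.1 e.2 + ind (Λ n) e.2 * d e.2 e.1) with hD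
  have hbal : ∀ n, ∑' e : S × S, p e.1 e.2 * ((ind (Λ n) e.2 - ind (Λ n) e.1) * j e.1 e.2) =
      D n := by
    intro n
    have hF : DependsOn (fun ω : S → Bool × Bool => ∑ u ∈ Λ n, pairInd (true, false) u ω)
        (Λ n : Set S) := fun ω ω' h =>
      Finset.sum_congr rfl fun u hu => by unfold pairInd; rw [h u hu]
    obtain ⟨K, hK0, hK⟩ := hF.exists_jumpBound (T := coupledJump)
      fun x y ω u hx hy => coupledJump_apply_of_ne ω hx hy
    obtain ⟨-, heq⟩ := integral_gen (M := M) hp (summable_indicator_finset _ K)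
      (fun x => Set.indicator_nonneg (fun _ _ => hK0) x) hK measurable_coupledJump hF.measurable
    rw [hM _ _ hF] at heq
    simp only [sum_pairInd_coupledJump] at heq
    have h1 : ∀ e : S × S, ∫ ω, ((ind (Λ n) e.2 - ind (Λ n) e.1) * pairCurrent e.1 e.2 ω -
        (ind (Λ n) e.1 * (pairInd (true, false) e.1 ω * pairInd (false, true) e.2 ω) +
          ind (Λ n) e.2 * (pairInd (true, false) e.2 ω * pairInd (false, true) e.1 ω))) ∂M =
        (ind (Λ n) e.2 - ind (Λ n) e.1) * j e.1 e.2 -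
          (ind (Λ n) e.1 * d e.1 e.2 + ind (Λ n) e.2 * d e.2 e.1) := by
      intro e
      have e1 : Integrable (fun ω =>
          ind (Λ n) e.1 * (pairInd (true, false) e.1 ω * pairInd (false, true) e.2 ω) +
          ind (Λ n) e.2 * (pairInd (true, false) e.2 ω * pairInd (false, true) e.1 ω)) M :=
        ((hi2 _ _ _ _).const_mul _).add ((hi2 _ _ _ _).const_mul _)
      rw [integral_sub ((hi3 _ _).const_mul _) e1,
        integral_add ((hi2 _ _ _ _).const_mul _) ((hi2 _ _ _ _).const_mul _)]
      simp only [integral_const_mul, hj, hd]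
    simp only [h1] at heq
    rw [tsum_congr fun e : S × S => mul_sub (p e.1 e.2) _ _, (hsj n).tsum_sub (hsd n)] at heq
    simp only [hD]
    linarith
  have hDB : ∀ n, D n ≤ B := by
    intro n
    rw [← hbal]
    refine le_trans ?_ (hB n)
    refine (hsj n).tsum_le_tsum (fun e => ?_) (summable_flux hp (Λ n))
    refine mul_le_mul_of_nonneg_left ((le_abs_self _).trans ?_) (hp.1 _ _)
    rw [abs_mul]
    exact mul_le_of_le_one_right (abs_nonneg _) (hj1 _ _)
  have hDmono : Monotone D := fun n m hnm => (hsd n).tsum_le_tsum (fun e =>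
    mul_le_mul_of_nonneg_left (add_le_add
      (mul_le_mul_of_nonneg_right (ind_mono (hΛ hnm) _) (hd0 _ _))
      (mul_le_mul_of_nonneg_right (ind_mono (hΛ hnm) _) (hd0 _ _))) (hp.1 _ _)) (hsd m)
  have hsum : Summable fun e : S × S => p e.1 e.2 * (d e.1 e.2 + d e.2 e.1) := by
    refine summable_of_sum_le (c := B)
      (fun e => mul_nonneg (hp.1 _ _) (add_nonneg (hd0 _ _) (hd0 _ _))) fun E => ?_
    have : ∃ n, ∀ e ∈ E, e.1 ∈ Λ n ∧ e.2 ∈ Λ n := by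
      choose k hk using hcov
      refine ⟨E.sup fun e => max (k e.1) (k e.2), fun e he => ?_⟩
      have := Finset.le_sup (f := fun e : S × S => max (k e.1) (k e.2)) he
      exact ⟨hΛ ((le_max_left _ _).trans this) (hk _), hΛ ((le_max_right _ _).trans this) (hk _)⟩
    obtain ⟨n, hn⟩ := this
    refine le_trans (le_trans (le_of_eq ?_) ((hsd n).sum_le_tsum E fun e _ => hD0 n e)) (hDB n)
    refine Finset.sum_congr rfl fun e he => ?_
    simp only [ind, (hn e he).1, (hn e he).2, if_true, one_mul]
  have hces := hno g d j (fun x => integral_nonneg fun ω => pairInd_nonneg _ _ _)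
    (fun x => by
      have := integral_mono (hi1 (true, false) x) (integrable_const 1) fun ω =>
        pairInd_le_one (true, false) x ω
      simpa using this) hj1 hd0 hjd hsum
  simp only [hbal] at hces
  have hDn0 : ∀ n, 0 ≤ D n := fun n => tsum_nonneg (hD0 n)
  have hlim : Tendsto D atTop (𝓝 (⨆ n, D n)) :=
    tendsto_atTop_ciSup hDmono ⟨B, by rintro _ ⟨n, rfl⟩; exact hDB n⟩
  have hsup : (⨆ n, D n) = 0 := by
    have h1 := hlim.cesaro
    refine tendsto_nhds_unique h1 (hces.congr fun N => ?_)
    rw [div_eq_inv_mul]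
  obtain ⟨n, hn⟩ := hcov x
  have hDn : D n ≤ 0 := hsup ▸ le_ciSup (f := D) ⟨B, by rintro _ ⟨n, rfl⟩; exact hDB n⟩ n
  have h1 := (hsd n).le_tsum (x, y) fun e _ => hD0 n e
  have h2 : p x y * d x y ≤ p x y * (ind (Λ n) x * d x y + ind (Λ n) y * d y x) := by
    refine mul_le_mul_of_nonneg_left ?_ (hp.1 _ _)
    simp only [ind, hn, if_true, one_mul]
    exact le_add_of_nonneg_right (mul_nonneg (by split_ifs <;> simp) (hd0 _ _))
  have h3 := mul_nonneg (hp.1 x y) (hd0 x y)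
  change p x y * d x y = 0
  simp only [hD] at hDn
  linarith

end Pairs

section Ordering

variable {S : Type*}

/-- The event of a positive discrepancy somewhere in `A`. -/
def posEvent (A : Set S) : Set (S → Bool × Bool) := {ω | ∃ x ∈ A, ω x = (true, false)}

theorem measurableSet_posEvent [Countable S] (A : Set S) : MeasurableSet (posEvent A) := by
  have : posEvent A = ⋃ x ∈ A, {ω | ω x = (true, false)} := by ext; simp [posEvent]
  rw [this]
  exact MeasurableSet.biUnion A.to_countable fun x _ =>
    measurableSet_eq_fun (measurable_pi_apply x) measurable_const

variable [DecidableEq S]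

/-- `M` is annihilated by the coupled generator. -/
def CoupledInvariant (p : S → S → ℝ) (M : Measure (S → Bool × Bool)) : Prop :=
  ∀ (F : (S → Bool × Bool) → ℝ) (A : Finset S), DependsOn F (A : Set S) →
    ∫ ω, gen p coupledJump F ω ∂M = 0

theorem CoupledInvariant.summable_and_tsum_eq_zero [Countable S] {p : S → S → ℝ}
    (hp : IsTransition p) {M : Measure (S → Bool × Bool)} [IsProbabilityMeasure M]
    (hM : CoupledInvariant p M) {F : (S → Bool × Bool) → ℝ} {A : Finset S}
    (hF : DependsOn F (A : Set S)) :
    Summable (fun e : S × S => p e.1 e.2 * ∫ ω, (F (coupledJump e.1 e.2 ω) - F ω) ∂M) ∧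
      ∑' e : S × S, p e.1 e.2 * ∫ ω, (F (coupledJump e.1 e.2 ω) - F ω) ∂M = 0 := by
  obtain ⟨K, hK0, hK⟩ := hF.exists_jumpBound (T := coupledJump)
    fun x y ω u hx hy => coupledJump_apply_of_ne ω hx hy
  obtain ⟨hs, heq⟩ := integral_gen (M := M) hp (summable_indicator_finset _ K)
    (fun x => Set.indicator_nonneg (fun _ _ => hK0) x) hK measurable_coupledJump hF.measurable
  exact ⟨hs, by rw [← heq, hM _ _ hF]⟩

open Classical in
/-- A cylinder event of probability zero cannot be reached in one jump. -/
theorem CoupledInvariant.ae_not_comp_jump [Countable S] {p : S → S → ℝ} (hp : IsTransition p)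
    {M : Measure (S → Bool × Bool)} [IsProbabilityMeasure M] (hM : CoupledInvariant p M)
    {Q : (S → Bool × Bool) → Prop} {A : Finset S} (hQ : DependsOn Q (A : Set S))
    (h0 : ∀ᵐ ω ∂M, ¬ Q ω) {x y : S} (hxy : 0 < p x y) : ∀ᵐ ω ∂M, ¬ Q (coupledJump x y ω) := by
  set F : (S → Bool × Bool) → ℝ := fun ω => if Q ω then 1 else 0 with hFdef
  have hF : DependsOn F (A : Set S) := fun ω ω' h => by simp only [hFdef, hQ h]
  have hF0 : ∀ ω, 0 ≤ F ω := fun ω => by simp only [hFdef]; split_ifs <;> simp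
  have hFae : ∀ᵐ ω ∂M, F ω = 0 := h0.mono fun ω h => by simp [hFdef, h]
  obtain ⟨hs, heq⟩ := hM.summable_and_tsum_eq_zero hp hF
  have h1 : ∀ e : S × S, ∫ ω, (F (coupledJump e.1 e.2 ω) - F ω) ∂M =
      ∫ ω, F (coupledJump e.1 e.2 ω) ∂M := fun e =>
    integral_congr_ae (hFae.mono fun ω h => by simp only [h, sub_zero])
  simp only [h1] at hs heq
  have h2 := (hasSum_zero_iff_of_nonneg fun e : S × S => mul_nonneg (hp.1 e.1 e.2)
    (integral_nonneg fun ω => hF0 (coupledJump e.1 e.2 ω))).1 (heq ▸ hs.hasSum)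
  have h3 : ∫ ω, F (coupledJump x y ω) ∂M = 0 := by
    have := congrFun h2 (x, y)
    exact (mul_eq_zero.1 this).resolve_left hxy.ne'
  obtain ⟨K, -, hK⟩ := hF.exists_bound
  have h4 := (integral_eq_zero_iff_of_nonneg (fun ω => hF0 _)
    (Integrable.of_bound (hF.measurable.comp (measurable_coupledJump x y)).aestronglyMeasurable K
      (ae_of_all _ fun ω => hK _))).1 h3
  refine h4.mono fun ω h hq => ?_
  simp [hFdef, hq] at h

/-- Almost surely an invariant coupling has no pair of discrepancies of opposite signs. -/
theorem ae_no_opposite_pairs [Countable S] {p : S → S → ℝ} (hp : IsTransition p)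
    (hirr : IrreducibleKernel p) (hsym : ∀ x y, 0 < p x y → 0 < p y x)
    {Λ : ℕ → Finset S} (hΛ : Monotone Λ) (hcov : ∀ x, ∃ n, x ∈ Λ n) {B : ℝ}
    (hB : ∀ n, flux p (Λ n) ≤ B) (hno : NoFlux p Λ) {M : Measure (S → Bool × Bool)}
    [IsProbabilityMeasure M] (hM : CoupledInvariant p M) :
    ∀ᵐ ω ∂M, ∀ x y, ¬ (ω x = (true, false) ∧ ω y = (false, true)) := by
  have hedge : ∀ x y, 0 < p x y → ∀ᵐ ω ∂M, ¬ (ω x = (true, false) ∧ ω y = (false, true)) := by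
    intro x y hxy
    have h1 := (mul_eq_zero.1 (rate_mul_integral_pair_eq_zero hp hΛ hcov hB hno hM x y)).resolve_left
      hxy.ne'
    have h2 := (integral_eq_zero_iff_of_nonneg (fun ω => mul_nonneg (pairInd_nonneg _ _ _)
      (pairInd_nonneg _ _ _)) (Integrable.of_bound ((measurable_pairInd _ x).mul
      (measurable_pairInd _ y)).aestronglyMeasurable 1 (ae_of_all _ fun ω => by
        rw [Real.norm_of_nonneg (mul_nonneg (pairInd_nonneg _ _ _) (pairInd_nonneg _ _ _))]
        exact mul_le_one₀ (pairInd_le_one _ _ _) (pairInd_nonneg _ _ _)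
          (pairInd_le_one _ _ _)))).1 h1
    refine h2.mono fun ω h hq => ?_
    simp [pairInd, hq.1, hq.2] at h
  have hpath : ∀ (n : ℕ) (c : ℕ → S), (∀ i < n, 0 < p (c i) (c (i + 1))) →
      ∀ᵐ ω ∂M, ¬ (ω (c 0) = (true, false) ∧ ω (c n) = (false, true)) := by
    intro n
    induction n with
    | zero => exact fun c _ => ae_of_all _ fun ω h => by simp [h.1] at h
    | succ n ih =>
      intro c hc
      have hih := ih (fun i => c (i + 1)) fun i hi => hc (i + 1) (by omega)
      have hxz := hc 0 (by omega)
      simp only [zero_add] at hih hxz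
      generalize c 0 = x at *
      generalize c 1 = z at *
      generalize c (n + 1) = y at *
      by_cases hxy : x = y
      · subst hxy; exact ae_of_all _ fun ω h => by simp [h.1] at h
      by_cases hzy : z = y
      · subst hzy; exact hedge _ _ hxz
      by_cases hxz' : x = z
      · subst hxz'; exact hih
      have hQ : DependsOn (fun ω : S → Bool × Bool => ω z = (true, false) ∧ ω y = (false, true))
          (({z, y} : Finset S) : Set S) := by
        intro ω ω' h
        simp only [h z (by simp), h y (by simp)]
      have h1 := hM.ae_not_comp_jump hp hQ hih hxz
      have h2 := hM.ae_not_comp_jump hp hQ hih (hsym _ _ hxz)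
      filter_upwards [hih, hedge _ _ hxz, h1, h2] with ω a1 a2 a3 a4
      rintro ⟨b1, b2⟩
      rw [coupledJump_right hxz', coupledJump_apply_of_ne _ (Ne.symm hxy) (Ne.symm hzy), b1, b2] at a3
      rw [coupledJump_left, coupledJump_apply_of_ne _ (Ne.symm hzy) (Ne.symm hxy), b1, b2] at a4
      rw [b2] at a1
      rw [b1] at a2
      rcases hz : ω z with ⟨_ | _, _ | _⟩ <;> simp_all
  rw [ae_all_iff]; intro x
  rw [ae_all_iff]; intro y
  by_cases hxy : x = y
  · subst hxy; exact ae_of_all _ fun ω h => by simp [h.1] at h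
  obtain ⟨n, c, rfl, rfl, hc⟩ := hirr x y hxy
  exact hpath n c hc

/-- A positive discrepancy can enter `A` only by a jump across the boundary of `A`. -/
theorem indicator_posEvent_coupledJump_sub_le (A : Finset S) (x y : S) (ω : S → Bool × Bool) :
    (posEvent (A : Set S)).indicator (1 : (S → Bool × Bool) → ℝ) (coupledJump x y ω) -
      (posEvent (A : Set S)).indicator 1 ω ≤ |ind A y - ind A x| *
        (posEvent Set.univ \ posEvent (A : Set S)).indicator 1 ω := by
  have hnn : 0 ≤ |ind A y - ind A x| *
      (posEvent Set.univ \ posEvent (A : Set S)).indicator (1 : (S → Bool × Bool) → ℝ) ω :=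
    mul_nonneg (abs_nonneg _) (Set.indicator_nonneg (fun _ _ => zero_le_one) _)
  by_cases h1 : coupledJump x y ω ∈ posEvent (A : Set S)
  swap
  · rw [Set.indicator_of_notMem h1]
    have : 0 ≤ (posEvent (A : Set S)).indicator (1 : (S → Bool × Bool) → ℝ) ω :=
      Set.indicator_nonneg (fun _ _ => zero_le_one) _
    linarith
  by_cases h2 : ω ∈ posEvent (A : Set S)
  · rw [Set.indicator_of_mem h1, Set.indicator_of_mem h2]
    simpa using hnn
  have hA : ∀ u ∈ A, ω u ≠ (true, false) := fun u hu h => h2 ⟨u, hu, h⟩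
  obtain ⟨u, hu, hu1⟩ := h1
  have hxy : x ≠ y := by
    rintro rfl
    rw [coupledJump_self] at hu1
    exact hA u hu hu1
  have hmem : coupledJump x y ω ∈ posEvent (A : Set S) := ⟨u, hu, hu1⟩
  suffices h : ω ∈ posEvent Set.univ ∧ |ind A y - ind A x| = 1 by
    rw [Set.indicator_of_mem hmem, Set.indicator_of_notMem h2, h.2,
      Set.indicator_of_mem (show ω ∈ posEvent Set.univ \ posEvent (A : Set S) from ⟨h.1, h2⟩)]
    simp
  by_cases hux : u = x
  · subst hux
    have hωx := hA u hu
    rw [coupledJump_left] at hu1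
    have hy : ω y = (true, false) := by
      rcases hx' : ω u with ⟨_ | _, _ | _⟩ <;> rcases hy' : ω y with ⟨_ | _, _ | _⟩ <;> simp_all
    have hyA : y ∉ A := fun h => hA y h hy
    exact ⟨⟨y, trivial, hy⟩, by simp [ind, hyA, Finset.mem_coe.1 hu]⟩
  by_cases huy : u = y
  · subst huy
    have hωx := hA u hu
    rw [coupledJump_right hxy] at hu1
    have hy : ω x = (true, false) := by
      rcases hx' : ω u with ⟨_ | _, _ | _⟩ <;> rcases hy' : ω x with ⟨_ | _, _ | _⟩ <;> simp_all
    have hyA : x ∉ A := fun h => hA x h hy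
    exact ⟨⟨x, trivial, hy⟩, by simp [ind, hyA, Finset.mem_coe.1 hu]⟩
  · rw [coupledJump_apply_of_ne _ hux huy] at hu1
    exact absurd hu1 (hA u hu)

/-- The restriction of an invariant coupling to the event that a positive discrepancy exists is
again annihilated by the coupled generator. -/
theorem CoupledInvariant.tsum_setIntegral_posEvent [Countable S] {p : S → S → ℝ}
    (hp : IsTransition p)
    {Λ : ℕ → Finset S} (hΛ : Monotone Λ) (hcov : ∀ x, ∃ n, x ∈ Λ n) {B : ℝ}
    (hB : ∀ n, flux p (Λ n) ≤ B) {M : Measure (S → Bool × Bool)}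
    [IsProbabilityMeasure M] (hM : CoupledInvariant p M) {F : (S → Bool × Bool) → ℝ} {A : Finset S}
    (hF : DependsOn F (A : Set S)) :
    ∑' e : S × S, p e.1 e.2 * ∫ ω in posEvent Set.univ, (F (coupledJump e.1 e.2 ω) - F ω) ∂M = 0 := by
  set E : Set (S → Bool × Bool) := posEvent Set.univ with hEdef
  set En : ℕ → Set (S → Bool × Bool) := fun n => posEvent (Λ n : Set S) with hEndef
  have hEm : MeasurableSet E := measurableSet_posEvent _
  have hEnm : ∀ n, MeasurableSet (En n) := fun n => measurableSet_posEvent _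
  have hEnmono : Monotone En := fun n m hnm ω ⟨x, hx, h⟩ => ⟨x, hΛ hnm hx, h⟩
  have hEU : ⋃ n, En n = E := by
    ext ω
    simp only [Set.mem_iUnion]
    constructor
    · rintro ⟨n, x, -, h⟩; exact ⟨x, trivial, h⟩
    · rintro ⟨x, -, h⟩
      obtain ⟨n, hn⟩ := hcov x
      exact ⟨n, x, hn, h⟩
  obtain ⟨K, hK0, hK⟩ := hF.exists_bound
  obtain ⟨L, hL0, hL⟩ := hF.exists_jumpBound (T := coupledJump)
    fun x y ω u hx hy => coupledJump_apply_of_ne ω hx hy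
  have hedge := hp.summable_edge (summable_indicator_finset A L)
    (fun x => Set.indicator_nonneg (fun _ _ => hL0) x)
  have hIdep : ∀ n, DependsOn ((En n).indicator (1 : (S → Bool × Bool) → ℝ)) (Λ n : Set S) := by
    intro n ω ω' h
    have : ω ∈ En n ↔ ω' ∈ En n := by
      constructor
      · rintro ⟨x, hx, h1⟩; exact ⟨x, hx, by rw [← h x hx]; exact h1⟩
      · rintro ⟨x, hx, h1⟩; exact ⟨x, hx, by rw [h x hx]; exact h1⟩
    by_cases h1 : ω ∈ En n
    · rw [Set.indicator_of_mem h1, Set.indicator_of_mem (this.1 h1)]; rfl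
    · rw [Set.indicator_of_notMem h1, Set.indicator_of_notMem (mt this.2 h1)]
  have hI1 : ∀ n ω, |(En n).indicator (1 : (S → Bool × Bool) → ℝ) ω| ≤ 1 := by
    intro n ω
    by_cases h : ω ∈ En n
    · rw [Set.indicator_of_mem h]; simp
    · rw [Set.indicator_of_notMem h]; simp
  have hbd : ∀ (G : (S → Bool × Bool) → ℝ) (C : ℝ), Measurable G → (∀ ω, |G ω| ≤ C) →
      Integrable G M := fun G C hG hC =>
    Integrable.of_bound hG.aestronglyMeasurable C (ae_of_all _ hC)
  -- the total rate at which the indicator of `En n` changes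
  set I : ℕ → (S → Bool × Bool) → ℝ := fun n => (En n).indicator 1 with hIdef
  have hIm : ∀ n, Measurable (I n) := fun n => (hIdep n).measurable
  have hIi : ∀ n (e : S × S), Integrable (fun ω => I n (coupledJump e.1 e.2 ω) - I n ω) M :=
    fun n e => hbd _ (1 + 1) (((hIm n).comp (measurable_coupledJump _ _)).sub (hIm n)) fun ω =>
      (abs_sub _ _).trans (add_le_add (hI1 _ _) (hI1 _ _))
  set ρ : ℕ → ℝ := fun n => M.real (E \ En n) with hρdef
  have hch : ∀ n (e : S × S), ∫ ω, |I n (coupledJump e.1 e.2 ω) - I n ω| ∂M ≤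
      2 * (|ind (Λ n) e.2 - ind (Λ n) e.1| * ρ n) -
        ∫ ω, (I n (coupledJump e.1 e.2 ω) - I n ω) ∂M := by
    intro n e
    have hm : MeasurableSet (E \ En n) := hEm.diff (hEnm n)
    have h1 : ∀ ω, |I n (coupledJump e.1 e.2 ω) - I n ω| ≤
        2 * (|ind (Λ n) e.2 - ind (Λ n) e.1| * (E \ En n).indicator 1 ω) -
          (I n (coupledJump e.1 e.2 ω) - I n ω) := by
      intro ω
      have h := indicator_posEvent_coupledJump_sub_le (Λ n) e.1 e.2 ω
      have h0 : 0 ≤ |ind (Λ n) e.2 - ind (Λ n) e.1| *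
          (E \ En n).indicator (1 : (S → Bool × Bool) → ℝ) ω :=
        mul_nonneg (abs_nonneg _) (Set.indicator_nonneg (fun _ _ => zero_le_one) _)
      rw [abs_le]
      constructor <;> simp only [hIdef, hEndef, hEdef] at * <;> linarith
    have hi : Integrable (fun ω => 2 * (|ind (Λ n) e.2 - ind (Λ n) e.1| *
        (E \ En n).indicator (1 : (S → Bool × Bool) → ℝ) ω)) M :=
      (((integrable_const (1 : ℝ)).indicator hm).const_mul _).const_mul _
    refine (integral_mono (hIi n e).abs (hi.sub (hIi n e)) h1).trans (le_of_eq ?_)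
    rw [integral_sub' hi (hIi n e), integral_const_mul, integral_const_mul, integral_indicator_one hm]
  have hsI : ∀ n, Summable (fun e : S × S => p e.1 e.2 * ∫ ω, |I n (coupledJump e.1 e.2 ω) - I n ω| ∂M)
      ∧ ∑' e : S × S, p e.1 e.2 * ∫ ω, |I n (coupledJump e.1 e.2 ω) - I n ω| ∂M ≤ 2 * B * ρ n := by
    intro n
    obtain ⟨hs, h0⟩ := hM.summable_and_tsum_eq_zero hp (hIdep n)
    have hfl := (summable_flux hp (Λ n)).mul_left (2 * ρ n)
    have hle : ∀ e : S × S, p e.1 e.2 * ∫ ω, |I n (coupledJump e.1 e.2 ω) - I n ω| ∂M ≤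
        2 * ρ n * (p e.1 e.2 * |ind (Λ n) e.2 - ind (Λ n) e.1|) -
          p e.1 e.2 * ∫ ω, (I n (coupledJump e.1 e.2 ω) - I n ω) ∂M := by
      intro e
      have := mul_le_mul_of_nonneg_left (hch n e) (hp.1 e.1 e.2)
      linarith
    have hsum : Summable fun e : S × S =>
        p e.1 e.2 * ∫ ω, |I n (coupledJump e.1 e.2 ω) - I n ω| ∂M :=
      Summable.of_nonneg_of_le (fun e => mul_nonneg (hp.1 _ _)
        (integral_nonneg fun ω => abs_nonneg _)) hle (hfl.sub hs)
    refine ⟨hsum, ?_⟩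
    have h1 := hsum.tsum_le_tsum hle (hfl.sub hs)
    rw [hfl.tsum_sub hs, tsum_mul_left, h0, sub_zero] at h1
    have h2 : 2 * ρ n * flux p (Λ n) ≤ 2 * ρ n * B :=
      mul_le_mul_of_nonneg_left (hB n) (by positivity)
    unfold flux at h2
    linarith
  have hFi : ∀ e : S × S, Integrable (fun ω => F (coupledJump e.1 e.2 ω) - F ω) M := fun e =>
    hbd _ (K + K) ((hF.measurable.comp (measurable_coupledJump _ _)).sub hF.measurable) fun ω =>
      (abs_sub _ _).trans (add_le_add (hK _) (hK _))
  have hterm : ∀ (U : Set (S → Bool × Bool)) (e : S × S),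
      ‖p e.1 e.2 * ∫ ω in U, (F (coupledJump e.1 e.2 ω) - F ω) ∂M‖ ≤ p e.1 e.2 *
        (Set.indicator (A : Set S) (fun _ => L) e.1 +
          Set.indicator (A : Set S) (fun _ => L) e.2) := by
    intro U e
    rw [norm_mul, Real.norm_of_nonneg (hp.1 _ _)]
    refine mul_le_mul_of_nonneg_left ?_ (hp.1 _ _)
    refine (norm_integral_le_of_norm_le_const (ae_of_all _ fun η => hL _ _ η)).trans ?_
    refine mul_le_of_le_one_right ((abs_nonneg _).trans (hL e.1 e.2 fun _ => (true, true))) ?_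
    simp only [Measure.real, Measure.restrict_apply_univ]
    exact ENNReal.toReal_le_of_le_ofReal zero_le_one (by simpa using prob_le_one)
  have hlim1 : Tendsto (fun n => ∑' e : S × S,
      p e.1 e.2 * ∫ ω in En n, (F (coupledJump e.1 e.2 ω) - F ω) ∂M) atTop
      (𝓝 (∑' e : S × S, p e.1 e.2 * ∫ ω in E, (F (coupledJump e.1 e.2 ω) - F ω) ∂M)) := by
    refine tendsto_tsum_of_dominated_convergence hedge (fun e => ?_)
      (Eventually.of_forall fun n e => hterm _ e)
    refine Tendsto.const_mul _ ?_
    rw [← hEU]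
    exact tendsto_setIntegral_of_monotone hEnm hEnmono (hFi e).integrableOn
  have hρ : Tendsto ρ atTop (𝓝 0) := by
    have h1 : Tendsto (fun n => M.real (En n)) atTop (𝓝 (M.real E)) := by
      rw [← hEU]
      exact (ENNReal.tendsto_toReal (measure_ne_top _ _)).comp
        (tendsto_measure_iUnion_atTop hEnmono)
    have h2 := (tendsto_const_nhds (x := M.real E)).sub h1
    rw [sub_self] at h2
    refine h2.congr fun n => ?_
    rw [hρdef]
    exact (measureReal_sdiff (by rw [← hEU]; exact Set.subset_iUnion _ n) (hEnm n)).symm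
  refine tendsto_nhds_unique hlim1 (squeeze_zero_norm (a := fun n => K * (2 * B * ρ n))
    (fun n => ?_) (by simpa using (hρ.const_mul (2 * B)).const_mul K))
  have hIF : DependsOn (fun ω => I n ω * F ω) ((Λ n ∪ A : Finset S) : Set S) := by
    intro ω ω' h
    have h1 := hIdep n (fun i hi => h i (by simp at hi; simp [hi]) : ∀ i ∈ (Λ n : Set S), ω i = ω' i)
    have h2 := hF (fun i hi => h i (by simp at hi; simp [hi]) : ∀ i ∈ (A : Set S), ω i = ω' i)
    simp only [hIdef]
    rw [h1, h2]
  obtain ⟨hs, h0⟩ := hM.summable_and_tsum_eq_zero hp hIF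
  have hsE : Summable fun e : S × S =>
      p e.1 e.2 * ∫ ω in En n, (F (coupledJump e.1 e.2 ω) - F ω) ∂M :=
    Summable.of_norm_bounded hedge (hterm _)
  have hdiff : ∀ e : S × S, p e.1 e.2 * ∫ ω in En n, (F (coupledJump e.1 e.2 ω) - F ω) ∂M -
      p e.1 e.2 * ∫ ω, (I n (coupledJump e.1 e.2 ω) * F (coupledJump e.1 e.2 ω) - I n ω * F ω) ∂M =
      - (p e.1 e.2 * ∫ ω, (I n (coupledJump e.1 e.2 ω) - I n ω) * F (coupledJump e.1 e.2 ω) ∂M) := by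
    intro e
    have hi1 : Integrable (fun ω => I n ω * (F (coupledJump e.1 e.2 ω) - F ω)) M :=
      (hFi e).bdd_mul (c := 1) (hIm n).aestronglyMeasurable (ae_of_all _ (hI1 n))
    have hi2 : Integrable (fun ω => (I n (coupledJump e.1 e.2 ω) - I n ω) *
        F (coupledJump e.1 e.2 ω)) M :=
      (hIi n e).mul_bdd (c := K) (hF.measurable.comp (measurable_coupledJump _ _)).aestronglyMeasurable
        (ae_of_all _ fun ω => hK _)
    have h1 : ∫ ω in En n, (F (coupledJump e.1 e.2 ω) - F ω) ∂M =
        ∫ ω, I n ω * (F (coupledJump e.1 e.2 ω) - F ω) ∂M := by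
      rw [← integral_indicator (hEnm n)]
      refine integral_congr_ae (ae_of_all _ fun ω => ?_)
      by_cases h : ω ∈ En n
      · simp [hIdef, h]
      · simp [hIdef, h]
    have h2 : ∫ ω, (I n (coupledJump e.1 e.2 ω) * F (coupledJump e.1 e.2 ω) - I n ω * F ω) ∂M =
        ∫ ω, I n ω * (F (coupledJump e.1 e.2 ω) - F ω) ∂M +
          ∫ ω, (I n (coupledJump e.1 e.2 ω) - I n ω) * F (coupledJump e.1 e.2 ω) ∂M := by
      rw [← integral_add hi1 hi2]
      exact integral_congr_ae (ae_of_all _ fun ω => by ring)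
    rw [h1, h2]; ring
  have heq : ∑' e : S × S, p e.1 e.2 * ∫ ω in En n, (F (coupledJump e.1 e.2 ω) - F ω) ∂M =
      ∑' e : S × S, - (p e.1 e.2 *
        ∫ ω, (I n (coupledJump e.1 e.2 ω) - I n ω) * F (coupledJump e.1 e.2 ω) ∂M) := by
    rw [← tsum_congr hdiff, hsE.tsum_sub hs, h0, sub_zero]
  rw [heq]
  refine (tsum_of_norm_bounded ((hsI n).1.mul_left K).hasSum fun e => ?_).trans ?_
  · rw [norm_neg, norm_mul, Real.norm_of_nonneg (hp.1 _ _), mul_left_comm]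
    refine mul_le_mul_of_nonneg_left ?_ (hp.1 _ _)
    rw [← integral_const_mul]
    refine norm_integral_le_of_norm_le ((hIi n e).abs.const_mul K) (ae_of_all _ fun ω => ?_)
    rw [norm_mul, mul_comm]
    exact mul_le_mul_of_nonneg_right (hK _) (norm_nonneg _)
  · rw [tsum_mul_left]
    exact mul_le_mul_of_nonneg_left (hsI n).2 hK0

end Ordering

section Dichotomy

variable {S : Type*}

theorem fstConf_coupledJump [DecidableEq S] (x y : S) (ω : S → Bool × Bool) :
    fstConf (coupledJump x y ω) = jump x y (fstConf ω) := rfl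

theorem sndConf_coupledJump [DecidableEq S] (x y : S) (ω : S → Bool × Bool) :
    sndConf (coupledJump x y ω) = jump x y (sndConf ω) := rfl

theorem map_apply_le_of_ae {M : Measure (S → Bool × Bool)} {φ ψ : (S → Bool × Bool) → S → Bool}
    (hφ : Measurable φ) (hψ : Measurable ψ)
    (h : ∀ᵐ ω ∂M, ∀ x, φ ω x = true → ψ ω x = true) (F : Finset S) :
    M.map φ {η | ∀ x ∈ F, η x = true} ≤ M.map ψ {η | ∀ x ∈ F, η x = true} := by
  rw [Measure.map_apply hφ (measurableSet_forall_eq F fun _ => true),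
    Measure.map_apply hψ (measurableSet_forall_eq F fun _ => true)]
  exact measure_mono_ae (h.mono fun ω hω h1 x hx => hω x (h1 x hx))

variable [DecidableEq S] [Countable S] {p : S → S → ℝ}

theorem summable_rate_mul_integral (hp : IsTransition p) {μ : Measure (S → Bool)}
    [IsProbabilityMeasure μ] {f : (S → Bool) → ℝ} {F : Finset S} (hf : DependsOn f (F : Set S)) :
    Summable fun e : S × S => p e.1 e.2 * ∫ η, (f (jump e.1 e.2 η) - f η) ∂μ := by
  obtain ⟨K, hK0, hK⟩ := hf.exists_jumpBound (T := jump)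
    fun x y ω u hx hy => jump_apply_of_ne ω hx hy
  exact (integral_gen hp (summable_indicator_finset F K)
    (fun x => Set.indicator_nonneg (fun _ _ => hK0) x) hK measurable_jump hf.measurable).1

theorem integral_exclGen (hp : IsTransition p) {μ : Measure (S → Bool)}
    [IsProbabilityMeasure μ] {f : (S → Bool) → ℝ} {F : Finset S} (hf : DependsOn f (F : Set S)) :
    ∫ η, exclGen p f η ∂μ =
      ∑' e : S × S, p e.1 e.2 * ∫ η, (f (jump e.1 e.2 η) - f η) ∂μ := by
  obtain ⟨K, hK0, hK⟩ := hf.exists_jumpBound (T := jump)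
    fun x y ω u hx hy => jump_apply_of_ne ω hx hy
  rw [exclGen_eq_gen hp ⟨F, fun η ξ h => hf h⟩]
  exact (integral_gen hp (summable_indicator_finset F K)
    (fun x => Set.indicator_nonneg (fun _ _ => hK0) x) hK measurable_jump hf.measurable).2

theorem exclInvariant_iff (hp : IsTransition p) {μ : Measure (S → Bool)} [IsProbabilityMeasure μ] :
    ExclInvariant p μ ↔ ∀ (f : (S → Bool) → ℝ) (F : Finset S), DependsOn f (F : Set S) →
      ∑' e : S × S, p e.1 e.2 * ∫ η, (f (jump e.1 e.2 η) - f η) ∂μ = 0 := by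
  constructor
  · intro h f F hf
    rw [← integral_exclGen hp hf]
    exact h.2 f ⟨F, fun η ξ h => hf h⟩
  · rintro h
    refine ⟨inferInstance, ?_⟩
    rintro f ⟨F, hF⟩
    have hf : DependsOn f (F : Set S) := fun η ξ h => hF η ξ h
    rw [integral_exclGen hp hf, h f F hf]

theorem exclInvariant_map_cond (hp : IsTransition p) {M : Measure (S → Bool × Bool)}
    [IsProbabilityMeasure M] {E : Set (S → Bool × Bool)} (hE0 : M E ≠ 0)
    (hE : ∀ (F : (S → Bool × Bool) → ℝ) (A : Finset S), DependsOn F (A : Set S) →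
      ∑' e : S × S, p e.1 e.2 * ∫ ω in E, (F (coupledJump e.1 e.2 ω) - F ω) ∂M = 0)
    {φ : (S → Bool × Bool) → S → Bool} (hφm : Measurable φ)
    (hφ : ∀ x y ω, φ (coupledJump x y ω) = jump x y (φ ω))
    (hφd : ∀ ω ω' u, ω u = ω' u → φ ω u = φ ω' u) :
    ExclInvariant p ((ProbabilityTheory.cond M E).map φ) := by
  have h1 : IsProbabilityMeasure (ProbabilityTheory.cond M E) :=
    ProbabilityTheory.cond_isProbabilityMeasure hE0
  have h2 : IsProbabilityMeasure ((ProbabilityTheory.cond M E).map φ) :=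
    Measure.isProbabilityMeasure_map hφm.aemeasurable
  refine (exclInvariant_iff hp).2 fun f F hf => ?_
  have hd : DependsOn (f ∘ φ) (F : Set S) := fun ω ω' h => hf fun u hu => hφd _ _ _ (h u hu)
  have h3 := hE _ _ hd
  rw [← mul_zero ((M E)⁻¹.toReal), ← h3, ← tsum_mul_left]
  refine tsum_congr fun e => ?_
  have hm : Measurable fun η => f (jump e.1 e.2 η) - f η :=
    (hf.measurable.comp (measurable_jump _ _)).sub hf.measurable
  rw [integral_map hφm.aemeasurable hm.aestronglyMeasurable,
    ProbabilityTheory.cond, integral_smul_measure]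
  simp only [Function.comp_apply, hφ, smul_eq_mul]
  ring

/-- Two extremal invariant measures are stochastically comparable. -/
theorem IsExtremalInvariant.le_or_le (hp : IsTransition p)
    (hirr : IrreducibleKernel p) (hsym : ∀ x y, 0 < p x y → 0 < p y x)
    {Λ : ℕ → Finset S} (hΛ : Monotone Λ) (hcov : ∀ x, ∃ n, x ∈ Λ n) {B : ℝ}
    (hB : ∀ n, flux p (Λ n) ≤ B) (hno : NoFlux p Λ) {μ ν : Measure (S → Bool)}
    (hμ : IsExtremalInvariant p μ) (hν : IsExtremalInvariant p ν) :
    (∀ F : Finset S, ν {η | ∀ x ∈ F, η x = true} ≤ μ {η | ∀ x ∈ F, η x = true}) ∨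
      ∀ F : Finset S, μ {η | ∀ x ∈ F, η x = true} ≤ ν {η | ∀ x ∈ F, η x = true} := by
  obtain ⟨M, hMp, hM1, hM2, hM⟩ := exists_invariant_coupling hp hμ.1 hν.1
  have hM : CoupledInvariant p M := hM
  have hno := ae_no_opposite_pairs hp hirr hsym hΛ hcov hB hno hM
  set E : Set (S → Bool × Bool) := posEvent Set.univ with hEdef
  have hEm : MeasurableSet E := measurableSet_posEvent _
  have hposE : ∀ᵐ ω ∂M, ω ∈ E → ∀ x, sndConf ω x = true → fstConf ω x = true := by
    filter_upwards [hno] with ω h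
    rintro ⟨x, -, hx⟩ y hy
    by_contra h1
    refine h x y ⟨hx, Prod.ext ?_ hy⟩
    simpa [fstConf] using h1
  have hnE : ∀ ω, ω ∉ E → ∀ x, fstConf ω x = true → sndConf ω x = true := by
    intro ω h x hx
    by_contra h1
    exact h ⟨x, trivial, Prod.ext hx (by simpa [sndConf] using h1)⟩
  by_cases h0 : M E = 0
  · right
    intro F
    rw [← hM1, ← hM2]
    refine map_apply_le_of_ae measurable_fstConf measurable_sndConf ?_ F
    filter_upwards [measure_eq_zero_iff_ae_notMem.1 h0] with ω h using hnE ω h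
  left
  by_cases h1 : M Eᶜ = 0
  · intro F
    rw [← hM1, ← hM2]
    refine map_apply_le_of_ae measurable_sndConf measurable_fstConf ?_ F
    filter_upwards [measure_eq_zero_iff_ae_notMem.1 h1, hposE] with ω h h'
    exact h' (by simpa using h)
  have hEI : ∀ (F : (S → Bool × Bool) → ℝ) (A : Finset S), DependsOn F (A : Set S) →
      ∑' e : S × S, p e.1 e.2 * ∫ ω in E, (F (coupledJump e.1 e.2 ω) - F ω) ∂M = 0 :=
    fun F A hF => hM.tsum_setIntegral_posEvent hp hΛ hcov hB hF
  have hcI : ∀ (F : (S → Bool × Bool) → ℝ) (A : Finset S), DependsOn F (A : Set S) →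
      ∑' e : S × S, p e.1 e.2 * ∫ ω in Eᶜ, (F (coupledJump e.1 e.2 ω) - F ω) ∂M = 0 := by
    intro F A hF
    obtain ⟨hs, h2⟩ := hM.summable_and_tsum_eq_zero hp hF
    obtain ⟨K, hK0, hK⟩ := hF.exists_bound
    have hi : ∀ e : S × S, Integrable (fun ω => F (coupledJump e.1 e.2 ω) - F ω) M := fun e =>
      Integrable.of_bound ((hF.measurable.comp (measurable_coupledJump _ _)).sub
        hF.measurable).aestronglyMeasurable (K + K) (ae_of_all _ fun ω =>
          (abs_sub _ _).trans (add_le_add (hK _) (hK _)))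
    obtain ⟨L, hL0, hL⟩ := hF.exists_jumpBound (T := coupledJump)
      fun x y ω u hx hy => coupledJump_apply_of_ne ω hx hy
    have hsE : Summable fun e : S × S =>
        p e.1 e.2 * ∫ ω in E, (F (coupledJump e.1 e.2 ω) - F ω) ∂M := by
      refine Summable.of_norm_bounded (hp.summable_edge (summable_indicator_finset A L)
        (fun x => Set.indicator_nonneg (fun _ _ => hL0) x)) fun e => ?_
      rw [norm_mul, Real.norm_of_nonneg (hp.1 _ _)]
      refine mul_le_mul_of_nonneg_left ?_ (hp.1 _ _)
      refine (norm_integral_le_of_norm_le_const (ae_of_all _ fun η => hL _ _ η)).trans ?_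
      refine mul_le_of_le_one_right ((abs_nonneg _).trans (hL e.1 e.2 fun _ => (true, true))) ?_
      simp only [Measure.real, Measure.restrict_apply_univ]
      exact ENNReal.toReal_le_of_le_ofReal zero_le_one (by simpa using prob_le_one)
    have h3 : ∀ e : S × S, p e.1 e.2 * ∫ ω in Eᶜ, (F (coupledJump e.1 e.2 ω) - F ω) ∂M =
        p e.1 e.2 * ∫ ω, (F (coupledJump e.1 e.2 ω) - F ω) ∂M -
          p e.1 e.2 * ∫ ω in E, (F (coupledJump e.1 e.2 ω) - F ω) ∂M := fun e => by
      rw [← integral_add_compl hEm (hi e)]; ring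
    rw [tsum_congr h3, hs.tsum_sub hsE, h2, hEI F A hF, sub_zero]
  have hsplit : ∀ φ : (S → Bool × Bool) → S → Bool, Measurable φ → M.map φ =
      ENNReal.ofReal (M.real E) • (ProbabilityTheory.cond M E).map φ +
        ENNReal.ofReal (1 - M.real E) • (ProbabilityTheory.cond M Eᶜ).map φ := by
    intro φ hφ
    have h2 : M = M E • ProbabilityTheory.cond M E + M Eᶜ • ProbabilityTheory.cond M Eᶜ := by
      rw [ProbabilityTheory.cond, ProbabilityTheory.cond, smul_smul, smul_smul,
        ENNReal.mul_inv_cancel h0 (measure_ne_top _ _),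
        ENNReal.mul_inv_cancel h1 (measure_ne_top _ _), one_smul, one_smul,
        Measure.restrict_add_restrict_compl hEm]
    rw [← probReal_compl_eq_one_sub hEm, ofReal_measureReal, ofReal_measureReal]
    conv_lhs => rw [h2]
    rw [Measure.map_add _ _ hφ, Measure.map_smul, Measure.map_smul]
  have ht0 : 0 < M.real E := ENNReal.toReal_pos h0 (measure_ne_top _ _)
  have ht1 : M.real E < 1 := by
    have := ENNReal.toReal_pos h1 (measure_ne_top _ _)
    have h2 := probReal_compl_eq_one_sub (μ := M) hEm
    rw [Measure.real] at h2
    linarith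
  have e1 := (hμ.2 _ _ _ ht0 ht1
    (exclInvariant_map_cond hp h0 hEI measurable_fstConf fstConf_coupledJump
      fun ω ω' u h => congrArg Prod.fst h)
    (exclInvariant_map_cond hp h1 hcI measurable_fstConf fstConf_coupledJump
      fun ω ω' u h => congrArg Prod.fst h) (hM1 ▸ hsplit _ measurable_fstConf)).1
  have e2 := (hν.2 _ _ _ ht0 ht1
    (exclInvariant_map_cond hp h0 hEI measurable_sndConf sndConf_coupledJump
      fun ω ω' u h => congrArg Prod.snd h)
    (exclInvariant_map_cond hp h1 hcI measurable_sndConf sndConf_coupledJump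
      fun ω ω' u h => congrArg Prod.snd h) (hM2 ▸ hsplit _ measurable_sndConf)).1
  intro F
  rw [← e1, ← e2]
  refine map_apply_le_of_ae measurable_sndConf measurable_fstConf ?_ F
  have h2 : ∀ᵐ ω ∂(ProbabilityTheory.cond M E), ω ∈ E := ProbabilityTheory.ae_cond_mem hEm
  filter_upwards [h2, ProbabilityTheory.cond_absolutelyContinuous.ae_le hposE] with ω h h'
  exact h' h

end Dichotomy

section HalfLine

/-- Weight of the jumps of displacement larger than the distance from `K` to the starting point. -/
noncomputable def coneWeight (q : ℤ → ℝ) (K : ℤ) (e : ℤ × ℤ) : ℝ :=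
  if |e.1 - K| ≤ |e.2 - e.1| then q (e.2 - e.1) else 0

/-- Deviation of `p` from `q` over the jumps which may cross `K` from the right half-line. -/
noncomputable def coneDev (p : ℤ → ℤ → ℝ) (q : ℤ → ℝ) (K : ℤ) (e : ℤ × ℤ) : ℝ :=
  if 0 ≤ e.1 ∧ |e.1 - K| ≤ |e.2 - e.1| then |p e.1 e.2 - q (e.2 - e.1)| else 0

/-- The right half of the asymptotic homogeneity condition. -/
def RightStar (p : ℤ → ℤ → ℝ) (q : ℤ → ℝ) : Prop :=
  Tendsto (fun K : ℕ => ∑' x : ℤ, ∑' z : ℤ,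
      (if 0 ≤ x ∧ |x - (K : ℤ)| ≤ |z| then ENNReal.ofReal |p x (x + z) - q z| else 0))
    atTop (nhds 0)

/-- Passage from a pair `(x, z)` to `(x, x + z)`. -/
def shearEquiv : ℤ × ℤ ≃ ℤ × ℤ := Equiv.prodShear (Equiv.refl ℤ) fun x => Equiv.addLeft x

theorem shearEquiv_apply (e : ℤ × ℤ) : shearEquiv e = (e.1, e.1 + e.2) := rfl

/-- Passage from a pair `(z, x)` to `(x, x + z)`. -/
def shearSwapEquiv : ℤ × ℤ ≃ ℤ × ℤ := (Equiv.prodComm ℤ ℤ).trans shearEquiv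

theorem shearSwapEquiv_apply (e : ℤ × ℤ) : shearSwapEquiv e = (e.2, e.2 + e.1) := rfl

theorem hasSum_ite_abs_sub_le (c : ℝ) (K z : ℤ) :
    HasSum (fun x : ℤ => if |x - K| ≤ |z| then c else 0) ((2 * |(z : ℝ)| + 1) * c) := by
  have h := hasSum_sum_of_ne_finset_zero (L := SummationFilter.unconditional ℤ)
    (f := fun x : ℤ => if |x - K| ≤ |z| then c else 0)
    (s := Finset.Icc (K - |z|) (K + |z|)) fun x hx => if_neg fun h => hx (by
      rw [abs_le] at h; rw [Finset.mem_Icc]; constructor <;> linarith [h.1, h.2])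
  rw [Finset.sum_congr rfl (g := fun _ => c) fun x hx => if_pos (by
    rw [Finset.mem_Icc] at hx; rw [abs_le]; constructor <;> linarith [hx.1, hx.2]),
    Finset.sum_const, Int.card_Icc, nsmul_eq_mul] at h
  convert h using 2
  have h1 : K + |z| + 1 - (K - |z|) = 2 * |z| + 1 := by ring
  rw [h1]
  have h2 : ((2 * |z| + 1).toNat : ℤ) = 2 * |z| + 1 := Int.toNat_of_nonneg (by positivity)
  have h3 : (((2 * |z| + 1).toNat : ℤ) : ℝ) = 2 * |(z : ℝ)| + 1 := by rw [h2]; push_cast; ring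
  rw [← h3, Int.cast_natCast]

theorem _root_.MeanZeroKernel.summable_weight {q : ℤ → ℝ} (hq : MeanZeroKernel q) :
    Summable fun z : ℤ => (2 * |(z : ℝ)| + 1) * q z :=
  ((hq.2.2.1.mul_left 2).add hq.2.1.summable).congr fun z => by ring

theorem _root_.MeanZeroKernel.coneWeight_nonneg {q : ℤ → ℝ} (hq : MeanZeroKernel q) (K : ℤ)
    (e : ℤ × ℤ) :
    0 ≤ coneWeight q K e := by
  unfold coneWeight; split_ifs; exacts [hq.1 _, le_rfl]

theorem coneDev_nonneg (p : ℤ → ℤ → ℝ) (q : ℤ → ℝ) (K : ℤ) (e : ℤ × ℤ) :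
    0 ≤ coneDev p q K e := by
  unfold coneDev; split_ifs; exacts [abs_nonneg _, le_rfl]

theorem _root_.MeanZeroKernel.hasSum_coneWeight {q : ℤ → ℝ} (hq : MeanZeroKernel q) (K : ℤ) :
    HasSum (coneWeight q K) (∑' z : ℤ, (2 * |(z : ℝ)| + 1) * q z) := by
  rw [← shearSwapEquiv.hasSum_iff]
  have h0 : ∀ z : ℤ, HasSum (fun x : ℤ => (coneWeight q K ∘ shearSwapEquiv) (z, x))
      ((2 * |(z : ℝ)| + 1) * q z) := fun z => by
    refine (hasSum_ite_abs_sub_le (q z) K z).congr_fun fun x => ?_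
    simp [shearSwapEquiv_apply, coneWeight]
  have hs : Summable (coneWeight q K ∘ shearSwapEquiv) :=
    (summable_prod_of_nonneg fun e => hq.coneWeight_nonneg K _).2
      ⟨fun z => (h0 z).summable, hq.summable_weight.congr fun z => (h0 z).tsum_eq.symm⟩
  have := hs.hasSum
  rwa [hs.tsum_prod, tsum_congr fun z => (h0 z).tsum_eq] at this

theorem tsum_coneDev (p : ℤ → ℤ → ℝ) (q : ℤ → ℝ) (K : ℤ) :
    ∑' e, ENNReal.ofReal (coneDev p q K e) = ∑' x : ℤ, ∑' z : ℤ,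
      (if 0 ≤ x ∧ |x - K| ≤ |z| then ENNReal.ofReal |p x (x + z) - q z| else 0) := by
  rw [← shearEquiv.tsum_eq, ENNReal.tsum_prod']
  refine tsum_congr fun x => tsum_congr fun z => ?_
  simp only [shearEquiv_apply, coneDev, add_sub_cancel_left]
  split_ifs <;> simp

theorem RightStar.eventually_summable {p : ℤ → ℤ → ℝ} {q : ℤ → ℝ} (h : RightStar p q) :
    ∀ᶠ K : ℕ in atTop, Summable (coneDev p q K) := by
  filter_upwards [h.eventually_lt_const one_pos] with K hK
  rw [← tsum_coneDev] at hK
  have := ENNReal.summable_toReal (hK.trans ENNReal.one_lt_top).ne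
  exact this.congr fun e => ENNReal.toReal_ofReal (coneDev_nonneg p q K e)

theorem RightStar.tendsto_tsum {p : ℤ → ℤ → ℝ} {q : ℤ → ℝ} (h : RightStar p q) :
    Tendsto (fun K : ℕ => ∑' e, coneDev p q K e) atTop (𝓝 0) := by
  have h1 := (ENNReal.tendsto_toReal ENNReal.zero_ne_top).comp h
  refine h1.congr fun K => ?_
  simp only [Function.comp_apply]
  rw [← tsum_coneDev, ENNReal.tsum_toReal_eq fun e => ENNReal.ofReal_ne_top]
  exact tsum_congr fun e => ENNReal.toReal_ofReal (coneDev_nonneg p q K e)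

theorem RightStar.tendsto_apply {p : ℤ → ℤ → ℝ} {q : ℤ → ℝ} (h : RightStar p q) (z : ℤ) :
    Tendsto (fun x : ℤ => p x (x + z)) atTop (𝓝 (q z)) := by
  have h1 : Tendsto (fun K : ℕ => p K (K + z)) atTop (𝓝 (q z)) := by
    rw [tendsto_iff_norm_sub_tendsto_zero]
    refine squeeze_zero' (Eventually.of_forall fun K => norm_nonneg _) ?_ h.tendsto_tsum
    filter_upwards [h.eventually_summable] with K hK
    have := hK.le_tsum ((K : ℤ), (K : ℤ) + z) fun e _ => coneDev_nonneg p q K e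
    simpa [coneDev] using this
  have h2 := h1.comp (tendsto_atTop.2 fun n => (eventually_ge_atTop (n : ℤ)).mono fun x hx =>
    (by omega : n ≤ x.toNat))
  refine h2.congr' ?_
  filter_upwards [eventually_ge_atTop 0] with x hx
  simp [Int.toNat_of_nonneg hx]

theorem RightStar.eventually_lt {p : ℤ → ℤ → ℝ} {q π : ℤ → ℝ}
    (h : RightStar p q) (hp : ∀ x y, 0 ≤ p x y)
    (hrev : IsReversible p π) {z : ℤ} (hz : q (-z) < q z) :
    ∀ᶠ x : ℤ in atTop, π x < π (x + z) := by
  have h1 := h.tendsto_apply z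
  have h2 : Tendsto (fun x : ℤ => p (x + z) x) atTop (𝓝 (q (-z))) :=
    ((h.tendsto_apply (-z)).comp (tendsto_atTop_add_const_right _ z tendsto_id)).congr fun x => by
      simp
  filter_upwards [h2.eventually_lt h1 hz] with x hx
  by_contra hle
  push Not at hle
  have := hrev.2 x (x + z)
  have h3 := mul_lt_mul_of_pos_left hx (hrev.1 x)
  have h4 := mul_le_mul_of_nonneg_right hle (hp (x + z) x)
  linarith

theorem lt_add_mul_of_forall_lt {π : ℤ → ℝ} {N z : ℤ} (hz : 0 < z)
    (h : ∀ x, N ≤ x → π x < π (x + z)) (k : ℕ) {x : ℤ} (hx : N ≤ x) :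
    π x < π (x + (k + 1 : ℕ) * z) := by
  induction k with
  | zero => simpa using h x hx
  | succ k ih =>
    refine ih.trans ?_
    have := h (x + (k + 1 : ℕ) * z)
      (by nlinarith [show (0 : ℤ) ≤ ((k + 1 : ℕ) : ℤ) from by positivity])
    rwa [show x + (k + 1 : ℕ) * z + z = x + (k + 1 + 1 : ℕ) * z from by push_cast; ring] at this

theorem RightStar.le_of_lt {p : ℤ → ℤ → ℝ} {q π : ℤ → ℝ} (h : RightStar p q)
    (hp : ∀ x y, 0 ≤ p x y) (hrev : IsReversible p π) {z w : ℤ} (hz0 : 0 < z) (hw0 : 0 < w)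
    (hz : q (-z) < q z) : q (-w) ≤ q w := by
  by_contra hw
  push Not at hw
  have h1 := h.eventually_lt hp hrev hz
  have h2 := h.eventually_lt hp hrev (z := -w) (by simpa using hw)
  obtain ⟨N, hN⟩ := eventually_atTop.1 (h1.and h2)
  have h3 := lt_add_mul_of_forall_lt hz0 (fun x hx => (hN x hx).1) (w.toNat - 1) (le_refl N)
  have h4 := lt_add_mul_of_forall_lt (π := fun x => - π x) (N := N) hw0 (fun x hx => by
    have := (hN (x + w) (by linarith)).2
    simpa using this) (z.toNat - 1) (le_refl N)
  have e1 : ((w.toNat - 1 + 1 : ℕ) : ℤ) = w := by omega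
  have e2 : ((z.toNat - 1 + 1 : ℕ) : ℤ) = z := by omega
  rw [e1] at h3
  rw [e2, mul_comm] at h4
  linarith

/-- The limiting kernel of a reversible kernel with mean zero limit is symmetric. -/
theorem RightStar.symmetric {p : ℤ → ℤ → ℝ} {q π : ℤ → ℝ} (h : RightStar p q)
    (hp : ∀ x y, 0 ≤ p x y) (hrev : IsReversible p π) (hq : MeanZeroKernel q) (z : ℤ) :
    q (-z) = q z := by
  have hs : HasSum (fun w : ℤ => (w : ℝ) * (q w - q (-w))) 0 := by
    have h1 := hq.2.2.2.add ((Equiv.neg ℤ).hasSum_iff.2 hq.2.2.2)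
    rw [add_zero] at h1
    refine h1.congr_fun fun w => ?_
    simp; ring
  have key : ∀ z : ℤ, 0 < z → q (-z) = q z := by
    intro z hz
    by_contra hne
    rcases lt_or_gt_of_ne hne with hlt | hgt
    · have h0 : ∀ w : ℤ, 0 ≤ (w : ℝ) * (q w - q (-w)) := by
        intro w
        rcases lt_trichotomy w 0 with hw | hw | hw
        · have := h.le_of_lt hp hrev hz (neg_pos.2 hw) hlt
          rw [neg_neg] at this
          have hw' : (w : ℝ) ≤ 0 := by exact_mod_cast hw.le
          exact mul_nonneg_of_nonpos_of_nonpos hw' (by linarith)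
        · simp [hw]
        · have := h.le_of_lt hp hrev hz hw hlt
          exact mul_nonneg (by exact_mod_cast hw.le) (by linarith)
      have h1 := congrFun ((hasSum_zero_iff_of_nonneg h0).1 hs) z
      have hz' : (z : ℝ) ≠ 0 := by exact_mod_cast hz.ne'
      have := (mul_eq_zero.1 h1).resolve_left hz'
      linarith
    · have hle : ∀ w : ℤ, 0 < w → q w ≤ q (-w) := by
        intro w hw
        by_contra hlt
        push Not at hlt
        exact absurd (h.le_of_lt hp hrev hw hz hlt) (not_le.2 hgt)
      have h0 : ∀ w : ℤ, 0 ≤ -((w : ℝ) * (q w - q (-w))) := by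
        intro w
        rw [neg_nonneg]
        rcases lt_trichotomy w 0 with hw | hw | hw
        · have := hle _ (neg_pos.2 hw)
          rw [neg_neg] at this
          have hw' : (w : ℝ) ≤ 0 := by exact_mod_cast hw.le
          exact mul_nonpos_of_nonpos_of_nonneg hw' (by linarith)
        · simp [hw]
        · have := hle _ hw
          exact mul_nonpos_of_nonneg_of_nonpos (by exact_mod_cast hw.le) (by linarith)
      have h1 := congrFun ((hasSum_zero_iff_of_nonneg h0).1 (by simpa using hs.neg)) z
      have hz' : (z : ℝ) ≠ 0 := by exact_mod_cast hz.ne'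
      have := (mul_eq_zero.1 (neg_eq_zero.1 h1)).resolve_left hz'
      linarith
  rcases lt_trichotomy z 0 with hz | rfl | hz
  · have := key (-z) (neg_pos.2 hz)
    rw [neg_neg] at this
    exact this.symm
  · simp
  · exact key z hz

end HalfLine

section Cesaro

/-- The averages of `f` tend to zero. -/
def CesaroNull (f : ℕ → ℝ) : Prop :=
  Tendsto (fun N : ℕ => (∑ n ∈ Finset.range N, f n) / N) atTop (𝓝 0)

theorem CesaroNull.of_tendsto {f : ℕ → ℝ} (h : Tendsto f atTop (𝓝 0)) : CesaroNull f :=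
  h.cesaro.congr fun N => by rw [div_eq_inv_mul]

theorem CesaroNull.add {f g : ℕ → ℝ} (hf : CesaroNull f) (hg : CesaroNull g) :
    CesaroNull fun n => f n + g n := by
  have := Tendsto.add hf hg
  rw [add_zero] at this
  exact this.congr fun N => by rw [Finset.sum_add_distrib, add_div]

theorem CesaroNull.const_mul {f : ℕ → ℝ} (hf : CesaroNull f) (c : ℝ) :
    CesaroNull fun n => c * f n := by
  have := Tendsto.const_mul c hf
  rw [mul_zero] at this
  exact this.congr fun N => by rw [← Finset.mul_sum, mul_div_assoc]

theorem CesaroNull.congr {f g : ℕ → ℝ} (hf : CesaroNull f) (h : f =ᶠ[atTop] g) : CesaroNull g := by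
  have h1 : CesaroNull fun n => g n - f n :=
    .of_tendsto (tendsto_const_nhds.congr' (h.mono fun n hn => (sub_eq_zero.2 hn.symm).symm))
  simpa using hf.add h1

theorem CesaroNull.finsetSum {ι : Type*} (s : Finset ι) {f : ι → ℕ → ℝ}
    (hf : ∀ i, CesaroNull (f i)) :
    CesaroNull fun n => ∑ i ∈ s, f i n := by
  classical
  induction s using Finset.induction_on with
  | empty => simpa using CesaroNull.of_tendsto tendsto_const_nhds
  | insert i s hi ih => simpa only [Finset.sum_insert hi] using (hf i).add ih

theorem abs_sum_range_shift_sub_le {u : ℕ → ℝ} (hu : ∀ n, |u n| ≤ 1) (k N : ℕ) :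
    |∑ n ∈ Finset.range N, (u (n + k) - u n)| ≤ 2 * k := by
  induction k with
  | zero => simp
  | succ k ih =>
    have h1 : ∑ n ∈ Finset.range N, (u (n + (k + 1)) - u n) =
        (u (N + k) - u (0 + k)) + ∑ n ∈ Finset.range N, (u (n + k) - u n) := by
      rw [← Finset.sum_range_sub (fun n => u (n + k)), ← Finset.sum_add_distrib]
      refine Finset.sum_congr rfl fun n _ => ?_
      rw [show n + 1 + k = n + (k + 1) by ring]; ring
    rw [h1]
    have h2 := abs_sub (u (N + k)) (u (0 + k))
    have h3 := abs_add_le (u (N + k) - u (0 + k)) (∑ n ∈ Finset.range N, (u (n + k) - u n))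
    have h4 := hu (N + k)
    have h5 := hu (0 + k)
    push_cast
    linarith

theorem cesaroNull_shift_sub {u : ℕ → ℝ} (hu : ∀ n, |u n| ≤ 1) (k : ℕ) :
    CesaroNull fun n => u (n + k) - u n := by
  refine squeeze_zero_norm (a := fun N : ℕ => 2 * (k : ℝ) / N) (fun N => ?_)
    (tendsto_const_div_atTop_nhds_zero_nat _)
  rw [norm_div, Real.norm_natCast]
  exact div_le_div_of_nonneg_right (abs_sum_range_shift_sub_le hu k N) (Nat.cast_nonneg _)

end Cesaro

section Crossing

/-- The signed indicator of crossing the boundary of `[-K, K]`. -/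
noncomputable def crossing (K : ℤ) (e : ℤ × ℤ) : ℝ :=
  ind (Finset.Icc (-K) K) e.2 - ind (Finset.Icc (-K) K) e.1

theorem abs_crossing_le_one (K : ℤ) (e : ℤ × ℤ) : |crossing K e| ≤ 1 := by
  unfold crossing ind; split_ifs <;> simp

theorem crossing_swap (K : ℤ) (e : ℤ × ℤ) : crossing K e.swap = -crossing K e := by
  unfold crossing; simp

theorem crossing_eq_zero {K : ℤ} {e : ℤ × ℤ} (h0 : 0 ≤ e.1) (h : ¬ |e.1 - K| ≤ |e.2 - e.1|) :
    crossing K e = 0 := by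
  have h1 : e.2 ∈ Finset.Icc (-K) K ↔ e.1 ∈ Finset.Icc (-K) K := by
    simp only [Finset.mem_Icc]
    constructor <;> intro h' <;> constructor <;> by_contra h2 <;> apply h <;>
      rcases abs_cases (e.1 - K) with h3 | h3 <;> rcases abs_cases (e.2 - e.1) with h4 | h4 <;>
      omega
  simp [crossing, ind, h1]

theorem abs_crossing_le {K : ℤ} {e : ℤ × ℤ} (h0 : 0 ≤ e.1) :
    |crossing K e| ≤ if |e.1 - K| ≤ |e.2 - e.1| then 1 else 0 := by
  split_ifs with h
  · exact abs_crossing_le_one K e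
  · rw [crossing_eq_zero h0 h, abs_zero]

theorem eventually_crossing_eq_zero (e : ℤ × ℤ) (m : ℕ) :
    ∀ᶠ n : ℕ in atTop, crossing ((n + m : ℕ) : ℤ) e = 0 := by
  filter_upwards [eventually_ge_atTop (e.1.natAbs + e.2.natAbs)] with n hn
  have h1 : e.2 ∈ Finset.Icc (-((n + m : ℕ) : ℤ)) ((n + m : ℕ) : ℤ) := by
    rw [Finset.mem_Icc]; omega
  have h2 : e.1 ∈ Finset.Icc (-((n + m : ℕ) : ℤ)) ((n + m : ℕ) : ℤ) := by
    rw [Finset.mem_Icc]; omega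
  simp only [crossing, ind, if_pos h1, if_pos h2, sub_self]

theorem mul_abs_crossing_le_coneWeight {q : ℤ → ℝ} (hq : MeanZeroKernel q) {K : ℤ} {e : ℤ × ℤ}
    (h0 : 0 ≤ e.1) : q (e.2 - e.1) * |crossing K e| ≤ coneWeight q K e := by
  have := mul_le_mul_of_nonneg_left (abs_crossing_le (K := K) h0) (hq.1 (e.2 - e.1))
  refine this.trans (le_of_eq ?_)
  unfold coneWeight; split_ifs <;> simp

theorem abs_sub_mul_abs_crossing_le_coneDev (p : ℤ → ℤ → ℝ) (q : ℤ → ℝ) {K : ℤ} {e : ℤ × ℤ}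
    (h0 : 0 ≤ e.1) : |p e.1 e.2 - q (e.2 - e.1)| * |crossing K e| ≤ coneDev p q K e := by
  have := mul_le_mul_of_nonneg_left (abs_crossing_le (K := K) h0)
    (abs_nonneg (p e.1 e.2 - q (e.2 - e.1)))
  refine this.trans (le_of_eq ?_)
  unfold coneDev; simp only [h0, true_and]; split_ifs <;> simp

/-- The displacement-`z` part of the gradient current through the boundary of `[-K, K]`. -/
noncomputable def gradFlux (a : ℤ) (g : ℤ → ℝ) (K z : ℤ) : ℝ :=
  ∑' x : ℤ, if a ≤ x ∧ a ≤ x + z then crossing K (x, x + z) * (g x - g (x + z)) else 0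

theorem gradFlux_neg (a : ℤ) (g : ℤ → ℝ) (K z : ℤ) : gradFlux a g K (-z) = gradFlux a g K z := by
  unfold gradFlux
  rw [← (Equiv.addRight z).tsum_eq]
  refine tsum_congr fun x => ?_
  simp only [Equiv.coe_addRight, add_neg_cancel_right]
  have h := crossing_swap K (x, x + z)
  simp only [Prod.swap_prod_mk] at h
  rw [h]
  simp only [and_comm (a := a ≤ x + z)]
  split_ifs
  · ring
  · rfl

theorem abs_gradFlux_term_le {a : ℤ} (ha : 0 ≤ a) {g : ℤ → ℝ} (hg0 : ∀ x, 0 ≤ g x)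
    (hg1 : ∀ x, g x ≤ 1) (K z x : ℤ) :
    ‖if a ≤ x ∧ a ≤ x + z then crossing K (x, x + z) * (g x - g (x + z)) else 0‖ ≤
      if |x - K| ≤ |z| then (1 : ℝ) else 0 := by
  split_ifs with h1 h2 h2
  · rw [norm_mul]
    exact mul_le_one₀ (abs_crossing_le_one _ _) (norm_nonneg _)
      (abs_le.2 ⟨by linarith [hg0 x, hg1 (x + z)], by linarith [hg1 x, hg0 (x + z)]⟩)
  · rw [crossing_eq_zero (ha.trans h1.1) (by simpa using h2)]; simp
  all_goals simp

theorem abs_gradFlux_le {a : ℤ} (ha : 0 ≤ a) {g : ℤ → ℝ} (hg0 : ∀ x, 0 ≤ g x)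
    (hg1 : ∀ x, g x ≤ 1) (K z : ℤ) : |gradFlux a g K z| ≤ 2 * |(z : ℝ)| + 1 := by
  have := hasSum_ite_abs_sub_le 1 K z
  rw [mul_one] at this
  exact tsum_of_norm_bounded this (abs_gradFlux_term_le ha hg0 hg1 K z)

theorem gradFlux_natCast {a : ℤ} (ha : 0 ≤ a) (g : ℤ → ℝ) {K : ℤ} {k : ℕ} (hK : a + k ≤ K) :
    gradFlux a g K k = ∑ i ∈ Finset.range k, (g (K + k - i) - g (K - i)) := by
  unfold gradFlux
  rw [tsum_eq_sum (s := (Finset.range k).image fun i : ℕ => K - (i : ℤ)), Finset.sum_image]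
  · refine Finset.sum_congr rfl fun i hi => ?_
    rw [Finset.mem_range] at hi
    have h1 : crossing K (K - i, K - i + k) = -1 := by
      have h2 : K - i + k ∉ Finset.Icc (-K) K := by rw [Finset.mem_Icc]; omega
      have h3 : K - i ∈ Finset.Icc (-K) K := by rw [Finset.mem_Icc]; omega
      simp only [crossing, ind, if_neg h2, if_pos h3]; norm_num
    rw [if_pos (by omega), h1, show K - i + (k : ℤ) = K + k - i by ring]
    ring
  · intro i _ i' _ h
    simpa using h
  · intro x hx
    split_ifs with h
    · have h1 : x + k ∈ Finset.Icc (-K) K ↔ x ∈ Finset.Icc (-K) K := by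
        simp only [Finset.mem_Icc]
        constructor
        · intro h'; omega
        · intro h'
          by_contra h2
          refine hx (Finset.mem_image.2 ⟨(K - x).toNat, Finset.mem_range.2 ?_, ?_⟩) <;> omega
      simp [crossing, ind, h1]
    · rfl

theorem cesaroNull_gradFlux {a : ℤ} (ha : 0 ≤ a) {g : ℤ → ℝ} (hg0 : ∀ x, 0 ≤ g x)
    (hg1 : ∀ x, g x ≤ 1) (m : ℕ) (z : ℤ) :
    CesaroNull fun n => gradFlux a g ((n + m : ℕ) : ℤ) z := by
  have key : ∀ k : ℕ, CesaroNull fun n => gradFlux a g ((n + m : ℕ) : ℤ) k := by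
    intro k
    have h1 : CesaroNull fun n : ℕ => ∑ i ∈ Finset.range k,
        (g (((n + k : ℕ) : ℤ) + m - i) - g ((n : ℤ) + m - i)) :=
      .finsetSum _ fun i => cesaroNull_shift_sub (u := fun n : ℕ => g ((n : ℤ) + m - i))
        (fun n => abs_le.2 ⟨by linarith [hg0 ((n : ℤ) + m - i)], hg1 _⟩) k
    refine h1.congr ?_
    filter_upwards [eventually_ge_atTop (a.toNat + k)] with n hn
    rw [gradFlux_natCast ha g (by omega)]
    refine Finset.sum_congr rfl fun i _ => ?_
    push_cast
    rw [show (n : ℤ) + k + m - i = n + m + k - i by ring]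
  rcases Int.eq_nat_or_neg z with ⟨k, rfl | rfl⟩
  · exact key k
  · simpa only [gradFlux_neg] using key k

theorem cesaroNull_tsum_gradient {q : ℤ → ℝ} (hq : MeanZeroKernel q) {a : ℤ} (ha : 0 ≤ a)
    {g : ℤ → ℝ} (hg0 : ∀ x, 0 ≤ g x) (hg1 : ∀ x, g x ≤ 1) (m : ℕ) :
    CesaroNull fun n => ∑' e : ℤ × ℤ, if a ≤ e.1 ∧ a ≤ e.2 then
      q (e.2 - e.1) * (crossing ((n + m : ℕ) : ℤ) e * (g e.1 - g e.2)) else 0 := by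
  have hsum : ∀ K : ℤ, Summable fun e : ℤ × ℤ => if a ≤ e.1 ∧ a ≤ e.2 then
      q (e.2 - e.1) * (crossing K e * (g e.1 - g e.2)) else 0 := by
    intro K
    refine Summable.of_norm_bounded (hq.hasSum_coneWeight K).summable fun e => ?_
    split_ifs with h
    · rw [norm_mul, norm_mul, Real.norm_of_nonneg (hq.1 _), ← mul_assoc]
      refine le_trans (mul_le_of_le_one_right (by positivity [hq.1 (e.2 - e.1)]) ?_)
        (mul_abs_crossing_le_coneWeight hq (ha.trans h.1))
      exact abs_le.2 ⟨by linarith [hg0 e.1, hg1 e.2], by linarith [hg1 e.1, hg0 e.2]⟩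
    · simpa using hq.coneWeight_nonneg K e
  have heq : ∀ K : ℤ, ∑' e : ℤ × ℤ, (if a ≤ e.1 ∧ a ≤ e.2 then
      q (e.2 - e.1) * (crossing K e * (g e.1 - g e.2)) else 0) =
      ∑' z : ℤ, q z * gradFlux a g K z := by
    intro K
    rw [← shearSwapEquiv.tsum_eq]
    have h1 := shearSwapEquiv.summable_iff.2 (hsum K)
    have h2 := h1.tsum_prod
    simp only [Function.comp_def] at h2
    rw [h2]
    refine tsum_congr fun z => ?_
    unfold gradFlux
    rw [← tsum_mul_left]
    refine tsum_congr fun x => ?_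
    simp only [shearSwapEquiv_apply, add_sub_cancel_left, mul_ite, mul_zero]
  simp only [heq]
  have hbd : ∀ K z, ‖q z * gradFlux a g K z‖ ≤ (2 * |(z : ℝ)| + 1) * q z := by
    intro K z
    rw [norm_mul, Real.norm_of_nonneg (hq.1 z), mul_comm]
    exact mul_le_mul_of_nonneg_right (abs_gradFlux_le ha hg0 hg1 K z) (hq.1 z)
  have h1 : Tendsto (fun N : ℕ => ∑' z : ℤ, q z *
      ((∑ n ∈ Finset.range N, gradFlux a g ((n + m : ℕ) : ℤ) z) / N)) atTop
      (𝓝 (∑' z : ℤ, q z * 0)) := by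
    refine tendsto_tsum_of_dominated_convergence hq.summable_weight
      (fun z => Tendsto.const_mul (q z) (cesaroNull_gradFlux ha hg0 hg1 m z)) ?_
    refine Eventually.of_forall fun N z => ?_
    rw [norm_mul, Real.norm_of_nonneg (hq.1 z), mul_comm]
    refine mul_le_mul_of_nonneg_right ?_ (hq.1 z)
    rw [norm_div, Real.norm_natCast]
    refine div_le_of_le_mul₀ (Nat.cast_nonneg _) (by positivity) ?_
    refine (norm_sum_le_of_le _ fun n _ => abs_gradFlux_le ha hg0 hg1 _ z).trans ?_
    rw [Finset.sum_const, Finset.card_range, nsmul_eq_mul, mul_comm]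
  simp only [mul_zero, tsum_zero] at h1
  refine h1.congr fun N => ?_
  rw [← Summable.tsum_finsetSum fun n _ => Summable.of_norm_bounded hq.summable_weight (hbd _),
    ← tsum_div_const]
  refine tsum_congr fun z => ?_
  rw [← Finset.mul_sum, mul_div_assoc]

end Crossing

section RightHalf

variable {p : ℤ → ℤ → ℝ} {q : ℤ → ℝ}

theorem mul_abs_crossing_le (hq : MeanZeroKernel q) {K : ℤ} {e : ℤ × ℤ} (h0 : 0 ≤ e.1) :
    p e.1 e.2 * |crossing K e| ≤ coneDev p q K e + coneWeight q K e := by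
  have h1 := abs_sub_mul_abs_crossing_le_coneDev p q (K := K) h0
  have h2 := mul_abs_crossing_le_coneWeight hq (K := K) h0
  have h3 := mul_le_mul_of_nonneg_right (le_abs_self (p e.1 e.2 - q (e.2 - e.1)))
    (abs_nonneg (crossing K e))
  linarith

/-- The flux through the boundary of `[-K, K]` carried by jumps from `[a, ∞)`. -/
theorem hasSum_right_flux_le (hp : ∀ x y, 0 ≤ p x y) (hq : MeanZeroKernel q) {K : ℤ}
    (hK : Summable (coneDev p q K)) {a : ℤ} (ha : 0 ≤ a) :
    Summable (fun e : ℤ × ℤ => if a ≤ e.1 then p e.1 e.2 * |crossing K e| else 0) ∧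
    ∑' e : ℤ × ℤ, (if a ≤ e.1 then p e.1 e.2 * |crossing K e| else 0) ≤
      ∑' e, coneDev p q K e + ∑' z : ℤ, (2 * |(z : ℝ)| + 1) * q z := by
  have h := hK.hasSum.add (hq.hasSum_coneWeight K)
  have hle : ∀ e : ℤ × ℤ, (if a ≤ e.1 then p e.1 e.2 * |crossing K e| else 0) ≤
      coneDev p q K e + coneWeight q K e := by
    intro e
    split_ifs with h0
    · exact mul_abs_crossing_le hq (ha.trans h0)
    · exact add_nonneg (coneDev_nonneg _ _ _ _) (hq.coneWeight_nonneg _ _)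
  have hs : Summable (fun e : ℤ × ℤ => if a ≤ e.1 then p e.1 e.2 * |crossing K e| else 0) :=
    Summable.of_nonneg_of_le (fun e => by
      split_ifs; exacts [mul_nonneg (hp _ _) (abs_nonneg _), le_rfl]) hle h.summable
  exact ⟨hs, h.tsum_eq ▸ hs.tsum_le_tsum hle h.summable⟩

theorem tendsto_tsum_boundary_terms (hq : MeanZeroKernel q) {m : ℕ} {a : ℤ}
    {j : ℤ → ℤ → ℝ} (hj : ∀ x y, |j x y| ≤ 1) :
    Tendsto (fun n : ℕ => ∑' e : ℤ × ℤ, if a ≤ e.1 ∧ ¬ a ≤ e.2 then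
      q (e.2 - e.1) * (crossing ((n + m : ℕ) : ℤ) e * j e.1 e.2) else 0) atTop (𝓝 0) := by
  rw [show 𝓝 (0 : ℝ) = 𝓝 (∑' _ : ℤ × ℤ, (0 : ℝ)) by rw [tsum_zero]]
  refine tendsto_tsum_of_dominated_convergence (hq.hasSum_coneWeight a).summable (fun e => ?_)
    (Eventually.of_forall fun n e => ?_)
  · refine tendsto_const_nhds.congr' ?_
    filter_upwards [eventually_crossing_eq_zero e m] with n hn
    simp only [hn, zero_mul, mul_zero, ite_self]
  · split_ifs with h
    · have h1 : |e.1 - a| ≤ |e.2 - e.1| := by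
        rw [abs_of_nonneg (by linarith [h.1]), abs_of_nonpos (by linarith [h.1, h.2])]
        linarith [h.2]
      rw [coneWeight, if_pos h1, norm_mul, norm_mul, Real.norm_of_nonneg (hq.1 _)]
      exact mul_le_of_le_one_right (hq.1 _)
        (mul_le_one₀ (abs_crossing_le_one _ _) (norm_nonneg _) (hj _ _))
    · simpa using hq.coneWeight_nonneg a e

theorem tendsto_tsum_annihilation (hp : ∀ x y, 0 ≤ p x y) (hq : MeanZeroKernel q)
    (hstar : RightStar p q) {m : ℕ} (hm : ∀ n : ℕ, Summable (coneDev p q ((n + m : ℕ) : ℤ)))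
    {a : ℤ} (ha : 0 ≤ a) {d : ℤ → ℤ → ℝ} (hd0 : ∀ x y, 0 ≤ d x y)
    (hd3 : ∀ x y, |d y x - d x y| ≤ 3)
    (hd : Summable fun e : ℤ × ℤ => p e.1 e.2 * (d e.1 e.2 + d e.2 e.1)) :
    Tendsto (fun n : ℕ => ∑' e : ℤ × ℤ, if a ≤ e.1 ∧ a ≤ e.2 then
      q (e.2 - e.1) * (crossing ((n + m : ℕ) : ℤ) e * (d e.2 e.1 - d e.1 e.2)) else 0)
      atTop (𝓝 0) := by
  have h1 : Tendsto (fun n : ℕ => ∑' e, coneDev p q ((n + m : ℕ) : ℤ) e) atTop (𝓝 0) :=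
    hstar.tendsto_tsum.comp (tendsto_add_atTop_nat m)
  have hb : ∀ (n : ℕ) (e : ℤ × ℤ), ‖|crossing ((n + m : ℕ) : ℤ) e| *
      (p e.1 e.2 * (d e.1 e.2 + d e.2 e.1))‖ ≤ p e.1 e.2 * (d e.1 e.2 + d e.2 e.1) := by
    intro n e
    have h0 := mul_nonneg (hp e.1 e.2) (add_nonneg (hd0 e.1 e.2) (hd0 e.2 e.1))
    rw [norm_mul, Real.norm_of_nonneg h0, norm_abs_eq_norm]
    exact mul_le_of_le_one_left h0 (abs_crossing_le_one _ _)
  have h2 : Tendsto (fun n : ℕ => ∑' e : ℤ × ℤ, |crossing ((n + m : ℕ) : ℤ) e| *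
      (p e.1 e.2 * (d e.1 e.2 + d e.2 e.1))) atTop (𝓝 0) := by
    rw [← tsum_zero (α := ℝ) (β := ℤ × ℤ)]
    refine tendsto_tsum_of_dominated_convergence hd (fun e => ?_)
      (Eventually.of_forall fun n e => hb n e)
    refine tendsto_const_nhds.congr' ?_
    filter_upwards [eventually_crossing_eq_zero e m] with n hn
    simp only [hn, abs_zero, zero_mul]
  have h3 := (h1.const_mul 3).add h2
  rw [mul_zero, add_zero] at h3
  refine squeeze_zero_norm (fun n => ?_) h3
  have hs1 := (hm n).hasSum.mul_left 3
  have hs2 := (Summable.of_norm_bounded hd (hb n)).hasSum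
  refine tsum_of_norm_bounded (hs1.add hs2) fun e => ?_
  split_ifs with h
  · set c := crossing ((n + m : ℕ) : ℤ) e
    rw [norm_mul, norm_mul, Real.norm_of_nonneg (hq.1 _), Real.norm_eq_abs, Real.norm_eq_abs]
    have a1 := abs_sub_mul_abs_crossing_le_coneDev p q (K := ((n + m : ℕ) : ℤ)) (ha.trans h.1)
    have a2 : q (e.2 - e.1) ≤ p e.1 e.2 + |p e.1 e.2 - q (e.2 - e.1)| := by
      linarith [neg_abs_le (p e.1 e.2 - q (e.2 - e.1))]
    have a3 : |d e.2 e.1 - d e.1 e.2| ≤ d e.1 e.2 + d e.2 e.1 := by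
      rw [abs_le]; constructor <;> linarith [hd0 e.1 e.2, hd0 e.2 e.1]
    have a4 := hd3 e.1 e.2
    have c0 : 0 ≤ |c| := abs_nonneg _
    calc q (e.2 - e.1) * (|c| * |d e.2 e.1 - d e.1 e.2|)
        ≤ (p e.1 e.2 + |p e.1 e.2 - q (e.2 - e.1)|) * (|c| * |d e.2 e.1 - d e.1 e.2|) :=
          mul_le_mul_of_nonneg_right a2 (by positivity)
      _ = |p e.1 e.2 - q (e.2 - e.1)| * |c| * |d e.2 e.1 - d e.1 e.2| +
          |c| * (p e.1 e.2 * |d e.2 e.1 - d e.1 e.2|) := by ring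
      _ ≤ coneDev p q ((n + m : ℕ) : ℤ) e * 3 + |c| * (p e.1 e.2 * (d e.1 e.2 + d e.2 e.1)) := by
          refine add_le_add (mul_le_mul a1 a4 (abs_nonneg _) (coneDev_nonneg _ _ _ _)) ?_
          exact mul_le_mul_of_nonneg_left (mul_le_mul_of_nonneg_left a3 (hp _ _)) c0
      _ = _ := by ring
  · rw [norm_zero]
    exact add_nonneg (mul_nonneg (by norm_num) (coneDev_nonneg _ _ _ _))
      ((norm_nonneg _).trans (le_of_eq (Real.norm_of_nonneg (mul_nonneg (abs_nonneg _)
        (mul_nonneg (hp _ _) (add_nonneg (hd0 _ _) (hd0 _ _)))))))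

theorem cesaroNull_right (hp : ∀ x y, 0 ≤ p x y) (hq : MeanZeroKernel q)
    (hqs : ∀ z, q (-z) = q z) (hstar : RightStar p q) {m : ℕ}
    (hm : ∀ n : ℕ, Summable (coneDev p q ((n + m : ℕ) : ℤ)))
    {a : ℤ} (ha : 0 ≤ a) {g : ℤ → ℝ} {d j : ℤ → ℤ → ℝ} (hg0 : ∀ x, 0 ≤ g x) (hg1 : ∀ x, g x ≤ 1)
    (hj : ∀ x y, |j x y| ≤ 1) (hd0 : ∀ x y, 0 ≤ d x y)
    (hjd : ∀ x y, j x y - j y x = g x - g y - d x y + d y x)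
    (hd : Summable fun e : ℤ × ℤ => p e.1 e.2 * (d e.1 e.2 + d e.2 e.1)) :
    CesaroNull fun n : ℕ => ∑' e : ℤ × ℤ, if a ≤ e.1 then
      p e.1 e.2 * (crossing ((n + m : ℕ) : ℤ) e * j e.1 e.2) else 0 := by
  have hd3 : ∀ x y, |d y x - d x y| ≤ 3 := by
    intro x y
    have h1 := abs_le.1 (hj x y)
    have h2 := abs_le.1 (hj y x)
    rw [abs_le]
    constructor <;> linarith [hjd x y, hg0 x, hg1 x, hg0 y, hg1 y]
  set K : ℕ → ℤ := fun n => ((n + m : ℕ) : ℤ) with hKdef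
  have hcw : ∀ n, Summable (coneWeight q (K n)) := fun n => (hq.hasSum_coneWeight (K n)).summable
  -- replacing `p` by `q`
  have hA1 : ∀ n (e : ℤ × ℤ), ‖if a ≤ e.1 then
      (p e.1 e.2 - q (e.2 - e.1)) * (crossing (K n) e * j e.1 e.2) else 0‖ ≤ coneDev p q (K n) e := by
    intro n e
    split_ifs with h
    · rw [norm_mul, norm_mul, ← mul_assoc]
      exact (mul_le_of_le_one_right (by positivity) (hj _ _)).trans
        (abs_sub_mul_abs_crossing_le_coneDev p q (ha.trans h))
    · simpa using coneDev_nonneg p q (K n) e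
  have hA2 : ∀ n (e : ℤ × ℤ), ∀ P : Prop, [Decidable P] → ∀ v : ℝ, |v| ≤ 1 → (P → a ≤ e.1) →
      ‖if P then q (e.2 - e.1) * (crossing (K n) e * v) else 0‖ ≤ coneWeight q (K n) e := by
    intro n e P _ v hv hP
    split_ifs with h
    · rw [norm_mul, norm_mul, ← mul_assoc, Real.norm_of_nonneg (hq.1 _)]
      exact (mul_le_of_le_one_right (mul_nonneg (hq.1 _) (norm_nonneg _)) hv).trans
        (mul_abs_crossing_le_coneWeight hq (ha.trans (hP h)))
    · simpa using hq.coneWeight_nonneg (K n) e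
  have hs1 := fun n => Summable.of_norm_bounded (hm n) (hA1 n)
  have hs2 := fun n => Summable.of_norm_bounded (hcw n)
    fun e => hA2 n e (a ≤ e.1 ∧ ¬ a ≤ e.2) (j e.1 e.2) (hj _ _) fun h => h.1
  have hs3 := fun n => Summable.of_norm_bounded (hcw n)
    fun e => hA2 n e (a ≤ e.1 ∧ a ≤ e.2) (j e.1 e.2) (hj _ _) fun h => h.1
  have hs3' := fun n => Summable.of_norm_bounded (hcw n)
    fun e => hA2 n e (a ≤ e.1 ∧ a ≤ e.2) (j e.2 e.1) (hj _ _) fun h => h.1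
  have hsg := fun n => Summable.of_norm_bounded (hcw n)
    fun e => hA2 n e (a ≤ e.1 ∧ a ≤ e.2) (g e.1 - g e.2)
      (abs_le.2 ⟨by linarith [hg0 e.1, hg1 e.2], by linarith [hg1 e.1, hg0 e.2]⟩) fun h => h.1
  have hsym : ∀ n, ∑' e : ℤ × ℤ, (if a ≤ e.1 ∧ a ≤ e.2 then
      q (e.2 - e.1) * (crossing (K n) e * j e.1 e.2) else 0) = - ∑' e : ℤ × ℤ,
      (if a ≤ e.1 ∧ a ≤ e.2 then q (e.2 - e.1) * (crossing (K n) e * j e.2 e.1) else 0) := by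
    intro n
    rw [← (Equiv.prodComm ℤ ℤ).tsum_eq, ← tsum_neg]
    refine tsum_congr fun e => ?_
    have h1 := crossing_swap (K n) e
    have h2 : q (e.1 - e.2) = q (e.2 - e.1) := by rw [← hqs]; congr 1; ring
    simp only [Equiv.prodComm_apply, h1, Prod.fst_swap, Prod.snd_swap, h2,
      and_comm (a := a ≤ e.2)]
    split_ifs <;> ring
  have hmain : ∀ n, ∑' e : ℤ × ℤ, (if a ≤ e.1 then
      p e.1 e.2 * (crossing (K n) e * j e.1 e.2) else 0) =
      ∑' e : ℤ × ℤ, (if a ≤ e.1 then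
        (p e.1 e.2 - q (e.2 - e.1)) * (crossing (K n) e * j e.1 e.2) else 0) +
      ∑' e : ℤ × ℤ, (if a ≤ e.1 ∧ ¬ a ≤ e.2 then
        q (e.2 - e.1) * (crossing (K n) e * j e.1 e.2) else 0) +
      2⁻¹ * ∑' e : ℤ × ℤ, (if a ≤ e.1 ∧ a ≤ e.2 then
        q (e.2 - e.1) * (crossing (K n) e * (d e.2 e.1 - d e.1 e.2)) else 0) +
      2⁻¹ * ∑' e : ℤ × ℤ, (if a ≤ e.1 ∧ a ≤ e.2 then
        q (e.2 - e.1) * (crossing (K n) e * (g e.1 - g e.2)) else 0) := by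
    intro n
    have hsd : ∑' e : ℤ × ℤ, (if a ≤ e.1 ∧ a ≤ e.2 then
        q (e.2 - e.1) * (crossing (K n) e * (d e.2 e.1 - d e.1 e.2)) else 0) =
        ∑' e : ℤ × ℤ, (if a ≤ e.1 ∧ a ≤ e.2 then
          q (e.2 - e.1) * (crossing (K n) e * j e.1 e.2) else 0) -
        ∑' e : ℤ × ℤ, (if a ≤ e.1 ∧ a ≤ e.2 then
          q (e.2 - e.1) * (crossing (K n) e * j e.2 e.1) else 0) -
        ∑' e : ℤ × ℤ, (if a ≤ e.1 ∧ a ≤ e.2 then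
          q (e.2 - e.1) * (crossing (K n) e * (g e.1 - g e.2)) else 0) := by
      rw [← (hs3 n).tsum_sub (hs3' n), ← ((hs3 n).sub (hs3' n)).tsum_sub (hsg n)]
      refine tsum_congr fun e => ?_
      have : d e.2 e.1 - d e.1 e.2 = j e.1 e.2 - j e.2 e.1 - (g e.1 - g e.2) := by
        linarith [hjd e.1 e.2]
      rw [this]
      split_ifs <;> ring
    have htot : ∑' e : ℤ × ℤ, (if a ≤ e.1 then
        p e.1 e.2 * (crossing (K n) e * j e.1 e.2) else 0) =
        ∑' e : ℤ × ℤ, (if a ≤ e.1 then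
          (p e.1 e.2 - q (e.2 - e.1)) * (crossing (K n) e * j e.1 e.2) else 0) +
        ∑' e : ℤ × ℤ, (if a ≤ e.1 ∧ ¬ a ≤ e.2 then
          q (e.2 - e.1) * (crossing (K n) e * j e.1 e.2) else 0) +
        ∑' e : ℤ × ℤ, (if a ≤ e.1 ∧ a ≤ e.2 then
          q (e.2 - e.1) * (crossing (K n) e * j e.1 e.2) else 0) := by
      rw [← (hs1 n).tsum_add (hs2 n), ← ((hs1 n).add (hs2 n)).tsum_add (hs3 n)]
      refine tsum_congr fun e => ?_
      by_cases h1 : a ≤ e.1 <;> by_cases h2 : a ≤ e.2 <;> simp only [h1, h2, and_true, and_false,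
        not_true, not_false_iff, if_true, if_false] <;> ring
    rw [htot, hsd]
    linarith [hsym n]
  have hlim1 : Tendsto (fun n => ∑' e : ℤ × ℤ, (if a ≤ e.1 then
      (p e.1 e.2 - q (e.2 - e.1)) * (crossing (K n) e * j e.1 e.2) else 0)) atTop (𝓝 0) :=
    squeeze_zero_norm (fun n => tsum_of_norm_bounded (hm n).hasSum (hA1 n))
      (hstar.tendsto_tsum.comp (tendsto_add_atTop_nat m))
  refine CesaroNull.congr ?_ (Eventually.of_forall fun n => (hmain n).symm)
  exact (((CesaroNull.of_tendsto hlim1).add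
    (.of_tendsto (tendsto_tsum_boundary_terms hq hj))).add
    ((CesaroNull.of_tendsto (tendsto_tsum_annihilation hp hq hstar hm ha hd0 hd3 hd)).const_mul
      2⁻¹)).add ((cesaroNull_tsum_gradient hq ha hg0 hg1 m).const_mul 2⁻¹)

end RightHalf

section Reflection

/-- The kernel seen after the reflection `x ↦ -x`. -/
def reflect (p : ℤ → ℤ → ℝ) (x y : ℤ) : ℝ := p (-x) (-y)

theorem _root_.MeanZeroKernel.comp_neg {q : ℤ → ℝ} (hq : MeanZeroKernel q) :
    MeanZeroKernel fun z => q (-z) := by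
  refine ⟨fun z => hq.1 _, (Equiv.neg ℤ).hasSum_iff.2 hq.2.1, ?_, ?_⟩
  · exact ((Equiv.neg ℤ).summable_iff.2 hq.2.2.1).congr fun z => by simp
  · have := ((Equiv.neg ℤ).hasSum_iff.2 hq.2.2.2).neg
    rw [neg_zero] at this
    exact this.congr_fun fun z => by simp

theorem _root_.IsReversible.reflect {p : ℤ → ℤ → ℝ} {π : ℤ → ℝ} (h : IsReversible p π) :
    IsReversible (reflect p) fun x => π (-x) :=
  ⟨fun _ => h.1 _, fun _ _ => h.2 _ _⟩

theorem _root_.StarCond.right {p : ℤ → ℤ → ℝ} {q₁ q₂ : ℤ → ℝ} (h : StarCond p q₁ q₂) :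
    RightStar p q₁ := h.1

theorem _root_.StarCond.left {p : ℤ → ℤ → ℝ} {q₁ q₂ : ℤ → ℝ} (h : StarCond p q₁ q₂) :
    RightStar (reflect p) fun z => q₂ (-z) := by
  refine h.2.congr fun K => ?_
  rw [← (Equiv.neg ℤ).tsum_eq]
  refine tsum_congr fun x => ?_
  rw [← (Equiv.neg ℤ).tsum_eq]
  refine tsum_congr fun z => ?_
  have h1 : |-x + (K : ℤ)| = |x - K| := by rw [← abs_neg]; congr 1; ring
  simp only [Equiv.neg_apply, abs_neg, h1, reflect, neg_add, Left.neg_nonpos_iff]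

theorem crossing_neg (K : ℤ) (e : ℤ × ℤ) : crossing K (-e) = crossing K e := by
  have h : ∀ x : ℤ, -x ∈ Finset.Icc (-K) K ↔ x ∈ Finset.Icc (-K) K := fun x => by
    simp only [Finset.mem_Icc]; omega
  simp only [crossing, ind, Prod.fst_neg, Prod.snd_neg, h]

/-- Splitting a sum over pairs according to the sign of the first coordinate. -/
theorem tsum_eq_right_add_left {f : ℤ × ℤ → ℝ} (hf : Summable f) :
    ∑' e, f e = ∑' e : ℤ × ℤ, (if 0 ≤ e.1 then f e else 0) +
      ∑' e : ℤ × ℤ, (if 1 ≤ e.1 then f (-e) else 0) := by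
  have h1 : Summable fun e : ℤ × ℤ => if 0 ≤ e.1 then f e else 0 :=
    (hf.indicator {e : ℤ × ℤ | 0 ≤ e.1}).congr fun e => by
      simp [Set.indicator_apply]
  have h2 : Summable fun e : ℤ × ℤ => if ¬ 0 ≤ e.1 then f e else 0 :=
    (hf.indicator {e : ℤ × ℤ | ¬ 0 ≤ e.1}).congr fun e => by
      simp [Set.indicator_apply]
  have h3 : ∑' e : ℤ × ℤ, (if 1 ≤ e.1 then f (-e) else 0) =
      ∑' e : ℤ × ℤ, (if ¬ 0 ≤ e.1 then f e else 0) := by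
    rw [← (Equiv.neg (ℤ × ℤ)).tsum_eq]
    refine tsum_congr fun e => ?_
    simp only [Equiv.neg_apply, neg_neg, Prod.fst_neg]
    have : 1 ≤ -e.1 ↔ ¬ 0 ≤ e.1 := by omega
    simp only [this]
  rw [h3, ← h1.tsum_add h2]
  refine tsum_congr fun e => ?_
  by_cases h : 0 ≤ e.1 <;> simp [h]

variable {p : ℤ → ℤ → ℝ} {π q₁ q₂ : ℤ → ℝ}

/-- Intervals exhausting `ℤ` through whose boundary there is bounded flux and no mean current. -/
theorem exists_noFlux (hp : IsTransition p) (hrev : IsReversible p π) (hq₁ : MeanZeroKernel q₁)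
    (hq₂ : MeanZeroKernel q₂) (hstar : StarCond p q₁ q₂) :
    ∃ (Λ : ℕ → Finset ℤ) (B : ℝ), Monotone Λ ∧ (∀ x, ∃ n, x ∈ Λ n) ∧ (∀ n, flux p (Λ n) ≤ B) ∧
      NoFlux p Λ := by
  have hR := hstar.right
  have hL := hstar.left
  have hq₂' := hq₂.comp_neg
  have hp' : ∀ x y, 0 ≤ reflect p x y := fun x y => hp.1 _ _
  have hs1 := hR.symmetric hp.1 hrev hq₁
  have hs2 := hL.symmetric hp' hrev.reflect hq₂'
  obtain ⟨m, hm⟩ := eventually_atTop.1 (((hR.eventually_summable.and hL.eventually_summable).and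
    (hR.tendsto_tsum.eventually_lt_const one_pos)).and
    (hL.tendsto_tsum.eventually_lt_const one_pos))
  have hm' := fun n : ℕ => hm (n + m) (Nat.le_add_left _ _)
  set Λ : ℕ → Finset ℤ := fun n => Finset.Icc (-((n + m : ℕ) : ℤ)) ((n + m : ℕ) : ℤ) with hΛ
  have hcross : ∀ (n : ℕ) (e : ℤ × ℤ),
      ind (Λ n) e.2 - ind (Λ n) e.1 = crossing ((n + m : ℕ) : ℤ) e := fun _ _ => rfl
  refine ⟨Λ, (1 + ∑' z : ℤ, (2 * |(z : ℝ)| + 1) * q₁ z) +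
    (1 + ∑' z : ℤ, (2 * |(z : ℝ)| + 1) * q₂ (-z)), ?_, ?_, ?_, ?_⟩
  · intro n k hnk
    refine Finset.Icc_subset_Icc ?_ ?_ <;> omega
  · intro x
    refine ⟨x.natAbs, Finset.mem_Icc.2 ?_⟩
    omega
  · intro n
    have h1 := summable_flux hp (Λ n)
    unfold flux
    rw [tsum_eq_right_add_left h1]
    refine add_le_add ?_ ?_
    · have := (hasSum_right_flux_le hp.1 hq₁ (hm' n).1.1.1 le_rfl).2
      exact this.trans (add_le_add (hm' n).1.2.le le_rfl)
    · have := (hasSum_right_flux_le hp' hq₂' (hm' n).1.1.2 zero_le_one).2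
      refine le_trans (le_of_eq ?_) (this.trans (add_le_add (hm' n).2.le le_rfl))
      refine tsum_congr fun e => ?_
      rw [hcross, crossing_neg]
      rfl
  · intro g d j hg0 hg1 hj hd0 hjd hd
    have c1 := cesaroNull_right hp.1 hq₁ hs1 hR (fun n => (hm' n).1.1.1) le_rfl hg0 hg1 hj hd0 hjd hd
    have c2 := cesaroNull_right hp' hq₂' hs2 hL (fun n => (hm' n).1.1.2) zero_le_one
      (g := fun x => g (-x)) (d := reflect d) (j := reflect j) (fun x => hg0 _) (fun x => hg1 _)
      (fun x y => hj _ _) (fun x y => hd0 _ _) (fun x y => hjd _ _)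
      ((Equiv.neg (ℤ × ℤ)).summable_iff.2 hd)
    refine (c1.add c2).congr (Eventually.of_forall fun n => ?_)
    have hs : Summable fun e : ℤ × ℤ =>
        p e.1 e.2 * ((ind (Λ n) e.2 - ind (Λ n) e.1) * j e.1 e.2) := by
      refine Summable.of_norm_bounded (summable_flux hp (Λ n)) fun e => ?_
      rw [norm_mul, norm_mul, Real.norm_of_nonneg (hp.1 _ _)]
      exact mul_le_mul_of_nonneg_left (mul_le_of_le_one_right (norm_nonneg _) (hj _ _)) (hp.1 _ _)
    refine Eq.trans ?_ (tsum_eq_right_add_left hs).symm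
    refine congrArg₂ (· + ·) rfl (tsum_congr fun e => ?_)
    rw [hcross, crossing_neg]
    rfl

end Reflection

section DetailedBalance

variable {S : Type*}

section Cylinder

theorem _root_.DependsOn.mul' {f g : (S → Bool) → ℝ} {F : Finset S} (hf : DependsOn f (F : Set S))
    (hg : DependsOn g (F : Set S)) : DependsOn (fun η => f η * g η) (F : Set S) :=
  fun _ _ h => congrArg₂ (· * ·) (hf h) (hg h)

theorem _root_.DependsOn.sub' {f g : (S → Bool) → ℝ} {F : Finset S} (hf : DependsOn f (F : Set S))
    (hg : DependsOn g (F : Set S)) : DependsOn (fun η => f η - g η) (F : Set S) :=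
  fun _ _ h => congrArg₂ (· - ·) (hf h) (hg h)

theorem _root_.DependsOn.mono' {f : (S → Bool) → ℝ} {F G : Finset S} (hf : DependsOn f (F : Set S))
    (h : F ⊆ G) : DependsOn f (G : Set S) :=
  fun _ _ hG => hf fun i hi => hG i (h hi)

/-- A measure dominated by a multiple of `ν` has a bounded density on the coordinates in `F`. -/
theorem exists_cylinder_density {ν ν₁ : Measure (S → Bool)} [IsProbabilityMeasure ν]
    [IsProbabilityMeasure ν₁] {C : ℝ} (hC : 0 ≤ C)
    (h : ∀ s, MeasurableSet s → ν₁.real s ≤ C * ν.real s) (F : Finset S) :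
    ∃ f : (S → Bool) → ℝ, DependsOn f (F : Set S) ∧ (∀ η, 0 ≤ f η ∧ f η ≤ C) ∧
      ∀ k : (S → Bool) → ℝ, DependsOn k (F : Set S) → ∫ η, k η ∂ν₁ = ∫ η, k η * f η ∂ν := by
  classical
  have hr : Measurable (Set.domRestrict (F : Set S) : (S → Bool) → _) :=
    measurable_pi_lambda _ fun i => measurable_pi_apply _
  set r : (S → Bool) → (↥(F : Set S) → Bool) := Set.domRestrict (F : Set S) with hrdef
  have hm : ∀ b, MeasurableSet (r ⁻¹' {b}) := fun b => hr (measurableSet_singleton b)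
  have hint : ∀ (M : Measure (S → Bool)) [IsProbabilityMeasure M] (g : (↥(F : Set S) → Bool) → ℝ),
      ∫ η, g (r η) ∂M = ∑ b, M.real (r ⁻¹' {b}) * g b := by
    intro M _ g
    have : IsProbabilityMeasure (M.map r) := Measure.isProbabilityMeasure_map hr.aemeasurable
    rw [← integral_map (φ := r) hr.aemeasurable
      (measurable_of_countable g).aestronglyMeasurable, integral_fintype (.of_finite)]
    refine Finset.sum_congr rfl fun b _ => ?_
    rw [smul_eq_mul, map_measureReal_apply hr (measurableSet_singleton b)]
  refine ⟨fun η => ν₁.real (r ⁻¹' {r η}) / ν.real (r ⁻¹' {r η}), ?_, fun η => ⟨by positivity, ?_⟩,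
    ?_⟩
  · intro η ξ hηξ
    have : r η = r ξ := funext fun i => hηξ i i.2
    simp only [this]
  · exact div_le_of_le_mul₀ measureReal_nonneg hC (h _ (hm _))
  · intro k hk
    obtain ⟨g, rfl⟩ := dependsOn_iff_exists_comp.1 hk
    have e1 := hint ν₁ g
    have e2 := hint ν fun b => g b * (ν₁.real (r ⁻¹' {b}) / ν.real (r ⁻¹' {b}))
    refine e1.trans (Eq.trans (Finset.sum_congr rfl fun b _ => ?_) e2.symm)
    by_cases h0 : ν.real (r ⁻¹' {b}) = 0
    · have := h _ (hm b)
      rw [h0, mul_zero] at this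
      rw [le_antisymm this measureReal_nonneg, h0, zero_mul, zero_mul]
    · field_simp

end Cylinder

/-- Indicator that `x` is occupied and `y` is empty. -/
def occ (x y : S) (η : S → Bool) : ℝ := if η x = true ∧ η y = false then 1 else 0

theorem occ_nonneg (x y : S) (η : S → Bool) : 0 ≤ occ x y η := by
  unfold occ; split_ifs <;> simp

theorem occ_le_one (x y : S) (η : S → Bool) : occ x y η ≤ 1 := by
  unfold occ; split_ifs <;> simp

theorem dependsOn_occ {x y : S} {F : Finset S} (hx : x ∈ F) (hy : y ∈ F) :
    DependsOn (occ x y) (F : Set S) := fun η ξ h => by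
  simp only [occ, h x hx, h y hy]

variable [DecidableEq S]

theorem swapConfig_swapConfig (x y : S) (η : S → Bool) :
    swapConfig x y (swapConfig x y η) = η := by
  funext u
  unfold swapConfig
  split_ifs <;> simp_all

theorem swapConfig_comm (x y : S) (η : S → Bool) : swapConfig x y η = swapConfig y x η := by
  funext u
  unfold swapConfig
  split_ifs <;> simp_all

theorem apply_jump_sub (f : (S → Bool) → ℝ) (x y : S) (η : S → Bool) :
    f (jump x y η) - f η = occ x y η * (f (swapConfig x y η) - f η) := by
  unfold jump occ
  split_ifs <;> simp

theorem _root_.DependsOn.comp_swapConfig {f : (S → Bool) → ℝ} {F : Finset S}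
    (hf : DependsOn f (F : Set S)) {x y : S} (hx : x ∈ F) (hy : y ∈ F) :
    DependsOn (fun η => f (swapConfig x y η)) (F : Set S) := by
  intro η ξ h
  refine hf fun i hi => ?_
  unfold swapConfig
  rw [h x hx, h y hy, h i hi]

/-- Detailed balance of `ν` with respect to the exchange of the values at `x` and `y`. -/
def Balanced (π : S → ℝ) (ν : Measure (S → Bool)) (x y : S) : Prop :=
  ∀ f : (S → Bool) → ℝ, Measurable f →
    π y * ∫ η, occ x y η * f (swapConfig x y η) ∂ν = π x * ∫ η, occ y x η * f η ∂ν

theorem _root_.IsBernoulliProduct.balanced {π : S → ℝ} (hπ : ∀ x, 0 < π x)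
    {ν : Measure (S → Bool)} (hν : IsBernoulliProduct ν fun x => π x / (1 + π x)) (x y : S) :
    Balanced π ν x y := by
  intro f hf
  have := hν.1
  by_cases hxy : x = y
  · subst hxy; simp [occ]
  have hmeas : ∀ x y : S, MeasurableSet {η : S → Bool | η x = true ∧ η y = false} := fun x y =>
    (measurableSet_eq_fun (measurable_pi_apply x) measurable_const).inter
      (measurableSet_eq_fun (measurable_pi_apply y) measurable_const)
  have hocc : ∀ (x y : S) (g : (S → Bool) → ℝ), ∫ η, occ x y η * g η ∂ν =
      ∫ η in {η : S → Bool | η x = true ∧ η y = false}, g η ∂ν := by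
    intro x y g
    rw [← integral_indicator (hmeas x y)]
    refine integral_congr_ae (ae_of_all _ fun η => ?_)
    simp only [occ, Set.indicator_apply, Set.mem_ofPred_eq]
    split_ifs <;> simp
  have hmap : ENNReal.ofReal (π y) • (ν.restrict {η | η x = true ∧ η y = false}).map
      (swapConfig x y) = ENNReal.ofReal (π x) • ν.restrict {η | η y = true ∧ η x = false} := by
    have : IsFiniteMeasure (ENNReal.ofReal (π y) •
        (ν.restrict {η : S → Bool | η x = true ∧ η y = false}).map (swapConfig x y)) :=
      Measure.smul_finite _ ENNReal.ofReal_ne_top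
    refine ext_of_forall_true fun F => ?_
    have hF := measurableSet_forall_eq F fun _ => true
    rw [Measure.smul_apply, Measure.smul_apply, Measure.map_apply (measurable_swapConfig x y) hF,
      Measure.restrict_apply (measurable_swapConfig x y hF), Measure.restrict_apply hF]
    by_cases hxF : x ∈ F
    · have e1 : swapConfig x y ⁻¹' {η | ∀ u ∈ F, η u = true} ∩
          {η | η x = true ∧ η y = false} = ∅ := by
        refine Set.eq_empty_of_forall_notMem fun η hη => ?_
        have := hη.1 x hxF
        simp [swapConfig, hη.2.2] at this
      have e2 : {η : S → Bool | ∀ u ∈ F, η u = true} ∩ {η | η y = true ∧ η x = false} = ∅ := by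
        refine Set.eq_empty_of_forall_notMem fun η hη => ?_
        have := hη.1 x hxF
        simp [hη.2.2] at this
      rw [e1, e2, measure_empty, smul_zero, smul_zero]
    · set G := F.erase y with hG
      have hGx : x ∉ G := fun h => hxF (Finset.mem_of_mem_erase h)
      have hGy : y ∉ G := Finset.notMem_erase y F
      have e1 : swapConfig x y ⁻¹' {η | ∀ u ∈ F, η u = true} ∩ {η | η x = true ∧ η y = false} =
          {η | ∀ u ∈ insert x (insert y G), η u = Function.update (fun _ => true) y false u} := by
        ext η
        simp only [Set.mem_inter_iff, Set.mem_preimage, Set.mem_ofPred_eq, Finset.forall_mem_insert,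
          Function.update_self, Function.update_of_ne hxy]
        constructor
        · rintro ⟨h1, h2, h3⟩
          refine ⟨h2, h3, fun u hu => ?_⟩
          have hux : u ≠ x := by rintro rfl; exact hGx hu
          have huy : u ≠ y := Finset.ne_of_mem_erase hu
          simpa [swapConfig, hux, huy] using h1 u (Finset.mem_of_mem_erase hu)
        · rintro ⟨h2, h3, h1⟩
          refine ⟨fun u hu => ?_, h2, h3⟩
          have hux : u ≠ x := by rintro rfl; exact hxF hu
          by_cases huy : u = y
          · simp [swapConfig, huy, Ne.symm hxy, h2]
          · simpa [swapConfig, hux, huy] using h1 u (Finset.mem_erase.2 ⟨huy, hu⟩)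
      have e2 : {η : S → Bool | ∀ u ∈ F, η u = true} ∩ {η | η y = true ∧ η x = false} =
          {η | ∀ u ∈ insert x (insert y G), η u = Function.update (fun _ => true) x false u} := by
        ext η
        simp only [Set.mem_inter_iff, Set.mem_ofPred_eq, Finset.forall_mem_insert,
          Function.update_self, Function.update_of_ne (Ne.symm hxy)]
        constructor
        · rintro ⟨h1, h2, h3⟩
          refine ⟨h3, h2, fun u hu => ?_⟩
          have hux : u ≠ x := by rintro rfl; exact hGx hu
          simpa [hux] using h1 u (Finset.mem_of_mem_erase hu)
        · rintro ⟨h3, h2, h1⟩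
          refine ⟨fun u hu => ?_, h2, h3⟩
          have hux : u ≠ x := by rintro rfl; exact hxF hu
          by_cases huy : u = y
          · rw [huy, h2]
          · simpa [hux] using h1 u (Finset.mem_erase.2 ⟨huy, hu⟩)
      have hins : x ∉ insert y G := by simp [hxy, hGx]
      rw [e1, e2, hν.2, hν.2, Finset.prod_insert hins, Finset.prod_insert hGy,
        Finset.prod_insert hins, Finset.prod_insert hGy]
      have e3 : ∀ z ∉ G, ∀ u ∈ G, ENNReal.ofReal
          (if Function.update (fun _ => true) z false u then π u / (1 + π u) else
            1 - π u / (1 + π u)) = ENNReal.ofReal (π u / (1 + π u)) := by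
        intro z hz u hu
        have : u ≠ z := by rintro rfl; exact hz hu
        simp [this]
      rw [Finset.prod_congr rfl (e3 y hGy), Finset.prod_congr rfl (e3 x hGx)]
      simp only [Function.update_self, Function.update_of_ne hxy,
        Function.update_of_ne (Ne.symm hxy), if_true, Bool.false_eq_true, if_false, smul_eq_mul,
        ← mul_assoc]
      have hx := hπ x
      have hy := hπ y
      congr 1
      rw [← ENNReal.ofReal_mul hy.le, ← ENNReal.ofReal_mul (by positivity),
        ← ENNReal.ofReal_mul hx.le, ← ENNReal.ofReal_mul]
      · congr 1; field_simp; ring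
      · have : 1 - π x / (1 + π x) = 1 / (1 + π x) := by field_simp; ring
        rw [this]; positivity
  have h1 := congrArg (fun M => ∫ η, f η ∂M) hmap
  simp only [integral_smul_measure, ENNReal.toReal_ofReal (hπ _).le, smul_eq_mul] at h1
  rw [integral_map (measurable_swapConfig x y).aemeasurable hf.aestronglyMeasurable] at h1
  rw [hocc, hocc, h1]

theorem Balanced.rate_mul {p : S → S → ℝ} {π : S → ℝ} (hrev : IsReversible p π)
    {ν : Measure (S → Bool)} {x y : S} (h : Balanced π ν x y) {f : (S → Bool) → ℝ}
    (hf : Measurable f) :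
    p x y * ∫ η, occ x y η * f (swapConfig x y η) ∂ν = p y x * ∫ η, occ y x η * f η ∂ν := by
  have h1 := h f hf
  have h2 := hrev.2 x y
  refine mul_left_cancel₀ (mul_pos (hrev.1 x) (hrev.1 y)).ne' ?_
  linear_combination π x * p x y * h1 + π x * (∫ η, occ y x η * f η ∂ν) * h2

theorem exclInvariant_of_balanced [Countable S] {p : S → S → ℝ} (hp : IsTransition p) {π : S → ℝ}
    (hrev : IsReversible p π) {ν : Measure (S → Bool)} [IsProbabilityMeasure ν]
    (hν : ∀ x y, Balanced π ν x y) : ExclInvariant p ν := by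
  refine (exclInvariant_iff hp).2 fun f F hf => ?_
  have ht : ∀ x y, p x y * ∫ η, (f (jump x y η) - f η) ∂ν =
      p y x * ∫ η, occ y x η * f η ∂ν - p x y * ∫ η, occ x y η * f η ∂ν := by
    intro x y
    have hfG : DependsOn f ((insert x (insert y F) : Finset S) : Set S) :=
      hf.mono' ((Finset.subset_insert _ _).trans (Finset.subset_insert _ _))
    have hx : x ∈ insert x (insert y F) := Finset.mem_insert_self _ _
    have hy : y ∈ insert x (insert y F) := Finset.mem_insert_of_mem (Finset.mem_insert_self _ _)
    rw [← (hν x y).rate_mul hrev hf.measurable, ← mul_sub, ← integral_sub]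
    · simp only [apply_jump_sub, mul_sub]
    · exact ((dependsOn_occ hx hy).mul' (hfG.comp_swapConfig hx hy)).integrable ν
    · exact ((dependsOn_occ hx hy).mul' hfG).integrable ν
  have h1 : ∑' e : S × S, p e.1 e.2 * ∫ η, (f (jump e.1 e.2 η) - f η) ∂ν =
      -∑' e : S × S, p e.1 e.2 * ∫ η, (f (jump e.1 e.2 η) - f η) ∂ν := by
    rw [← tsum_neg, ← (Equiv.prodComm S S).tsum_eq]
    refine tsum_congr fun e => ?_
    simp only [Equiv.prodComm_apply, Prod.fst_swap, Prod.snd_swap, ht]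
    ring
  linarith

end DetailedBalance

section Energy

variable {S : Type*} [DecidableEq S]

/-- Bilinear form of the exchange across the bond `(x, y)`. -/
noncomputable def bondForm (ν : Measure (S → Bool)) (x y : S) (f g : (S → Bool) → ℝ) : ℝ :=
  ∫ η, occ x y η * ((f (swapConfig x y η) - f η) * (g (swapConfig x y η) - g η)) ∂ν

theorem bondForm_self_nonneg (ν : Measure (S → Bool)) (x y : S) (f : (S → Bool) → ℝ) :
    0 ≤ bondForm ν x y f f :=
  integral_nonneg fun _ => mul_nonneg (occ_nonneg _ _ _) (mul_self_nonneg _)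

theorem bondForm_self_le {ν : Measure (S → Bool)} [IsProbabilityMeasure ν] (x y : S)
    {f : (S → Bool) → ℝ} {C : ℝ} (hf : ∀ η, 0 ≤ f η ∧ f η ≤ C) : bondForm ν x y f f ≤ C ^ 2 := by
  have h : ∀ η, ‖occ x y η * ((f (swapConfig x y η) - f η) * (f (swapConfig x y η) - f η))‖ ≤
      C ^ 2 := by
    intro η
    rw [Real.norm_of_nonneg (mul_nonneg (occ_nonneg _ _ _) (mul_self_nonneg _))]
    refine (mul_le_of_le_one_left (mul_self_nonneg _) (occ_le_one _ _ _)).trans ?_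
    rw [← pow_two, sq_le_sq]
    refine (abs_le.2 ⟨?_, ?_⟩).trans (le_abs_self C) <;>
      linarith [(hf η).1, (hf η).2, (hf (swapConfig x y η)).1, (hf (swapConfig x y η)).2]
  have := norm_integral_le_of_norm_le_const (μ := ν) (ae_of_all _ h)
  rw [probReal_univ, mul_one] at this
  exact (le_abs_self _).trans this

theorem abs_bondForm_le {ν : Measure (S → Bool)} [IsProbabilityMeasure ν] {x y : S}
    {f g : (S → Bool) → ℝ} {F : Finset S} (hf : DependsOn f (F : Set S))
    (hg : DependsOn g (F : Set S)) (hx : x ∈ F) (hy : y ∈ F) {δ : ℝ} (hδ : 0 < δ) :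
    |bondForm ν x y f g| ≤ δ * bondForm ν x y f f + (4 * δ)⁻¹ * bondForm ν x y g g := by
  have hdf := (hf.comp_swapConfig hx hy).sub' hf
  have hdg := (hg.comp_swapConfig hx hy).sub' hg
  have ho := dependsOn_occ (x := x) (y := y) hx hy
  unfold bondForm
  rw [← integral_const_mul, ← integral_const_mul, ← integral_add
    ((ho.mul' (hdf.mul' hdf)).integrable ν |>.const_mul _)
    ((ho.mul' (hdg.mul' hdg)).integrable ν |>.const_mul _)]
  refine (norm_integral_le_integral_norm _).trans (integral_mono
    ((ho.mul' (hdf.mul' hdg)).integrable ν).norm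
    (((ho.mul' (hdf.mul' hdf)).integrable ν |>.const_mul _).add
      ((ho.mul' (hdg.mul' hdg)).integrable ν |>.const_mul _)) fun η => ?_)
  set a := f (swapConfig x y η) - f η
  set b := g (swapConfig x y η) - g η
  have key : |a * b| ≤ δ * (a * a) + (4 * δ)⁻¹ * (b * b) := by
    have h1 : δ * (a * a) + (4 * δ)⁻¹ * (b * b) - a * b = δ * (a - b / (2 * δ)) ^ 2 := by
      field_simp; ring
    have h2 : δ * (a * a) + (4 * δ)⁻¹ * (b * b) + a * b = δ * (a + b / (2 * δ)) ^ 2 := by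
      field_simp; ring
    have h3 : 0 ≤ δ * (a - b / (2 * δ)) ^ 2 := by positivity
    have h4 : 0 ≤ δ * (a + b / (2 * δ)) ^ 2 := by positivity
    exact abs_le.2 ⟨by linarith, by linarith⟩
  have ho := occ_nonneg x y η
  change ‖occ x y η * (a * b)‖ ≤ δ * (occ x y η * (a * a)) + (4 * δ)⁻¹ * (occ x y η * (b * b))
  rw [norm_mul, Real.norm_of_nonneg ho, Real.norm_eq_abs]
  calc _ ≤ occ x y η * (δ * (a * a) + (4 * δ)⁻¹ * (b * b)) := mul_le_mul_of_nonneg_left key ho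
    _ = _ := by ring

variable {p : S → S → ℝ} {π : S → ℝ} {ν ν₁ : Measure (S → Bool)}

/-- `f` is the density of `ν₁` with respect to `ν` on the coordinates in `F`. -/
def IsDensityOn (ν ν₁ : Measure (S → Bool)) (F : Finset S) (f : (S → Bool) → ℝ) : Prop :=
  DependsOn f (F : Set S) ∧
    ∀ k : (S → Bool) → ℝ, DependsOn k (F : Set S) → ∫ η, k η ∂ν₁ = ∫ η, k η * f η ∂ν

/-- Energy in the bond `e` of the densities `f n` on `Λ n`, counted if the bond is in `Λ n`. -/
noncomputable def bondEnergy (p : S → S → ℝ) (ν : Measure (S → Bool)) (Λ : ℕ → Finset S)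
    (f : ℕ → (S → Bool) → ℝ) (n : ℕ) (e : S × S) : ℝ :=
  if e.1 ∈ Λ n ∧ e.2 ∈ Λ n then p e.1 e.2 * bondForm ν e.1 e.2 (f n) (f n) else 0

variable {Λ : ℕ → Finset S} {f : ℕ → (S → Bool) → ℝ} {C : ℝ}

theorem bondEnergy_nonneg (hp : IsTransition p) (n : ℕ) (e : S × S) :
    0 ≤ bondEnergy p ν Λ f n e := by
  unfold bondEnergy
  split_ifs
  · exact mul_nonneg (hp.1 _ _) (bondForm_self_nonneg _ _ _ _)
  · exact le_rfl

theorem summable_bondEnergy (n : ℕ) : Summable (bondEnergy p ν Λ f n) :=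
  summable_of_ne_finset_zero (s := Λ n ×ˢ Λ n) fun e he => by
    rw [bondEnergy, if_neg (by simpa using he)]

variable [IsProbabilityMeasure ν]

theorem rate_mul_integral_add_eq (hrev : IsReversible p π) (hν : ∀ x y, Balanced π ν x y)
    {x y : S} {F : Finset S} (hx : x ∈ F) (hy : y ∈ F) {h g : (S → Bool) → ℝ}
    (hh : DependsOn h (F : Set S)) (hg : IsDensityOn ν ν₁ F g) :
    p x y * ∫ η, (h (jump x y η) - h η) ∂ν₁ + p y x * ∫ η, (h (jump y x η) - h η) ∂ν₁ =
      -(p x y * bondForm ν x y h g) := by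
  have hd := (hh.comp_swapConfig hx hy).sub' hh
  have ho := dependsOn_occ (x := x) (y := y) hx hy
  have ho' := dependsOn_occ (x := y) (y := x) hy hx
  have hgs := hg.1.comp_swapConfig hx hy
  have h1 := hg.2 _ (ho.mul' hd)
  have h2 := hg.2 _ (ho'.mul' hd)
  have h3 := (hν x y).rate_mul hrev (hd.mul' hg.1).measurable
  simp only [swapConfig_swapConfig] at h3
  simp only [apply_jump_sub]
  have h4 : ∀ η, swapConfig y x η = swapConfig x y η := fun η => swapConfig_comm y x η
  simp only [h4]
  rw [h1, h2]
  have h5 : ∫ η, occ y x η * (h (swapConfig x y η) - h η) * g η ∂ν =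
      ∫ η, occ y x η * ((h (swapConfig x y η) - h η) * g η) ∂ν := by simp only [mul_assoc]
  have hd' := hh.sub' (hh.comp_swapConfig hx hy)
  rw [h5, ← h3, ← mul_add, ← integral_add ((ho.mul' hd).mul' hg.1 |>.integrable ν)
    (ho.mul' (hd'.mul' hgs) |>.integrable ν), ← mul_neg, bondForm, ← integral_neg]
  congr 2
  funext η
  ring

theorem rate_mul_bondForm_eq (hrev : IsReversible p π) (hν : ∀ x y, Balanced π ν x y)
    {x y : S} {F G : Finset S} (hFG : F ⊆ G) (hx : x ∈ F) (hy : y ∈ F) {f g : (S → Bool) → ℝ}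
    (hf : IsDensityOn ν ν₁ F f) (hg : IsDensityOn ν ν₁ G g) :
    p x y * bondForm ν x y f f = p x y * bondForm ν x y f g := by
  have h1 := rate_mul_integral_add_eq hrev hν hx hy hf.1 hf
  have h2 := rate_mul_integral_add_eq hrev hν (hFG hx) (hFG hy) (hf.1.mono' hFG) hg
  linarith

theorem rate_mul_bondForm_mono (hp : IsTransition p) (hrev : IsReversible p π)
    (hν : ∀ x y, Balanced π ν x y)
    {x y : S} {F G : Finset S} (hFG : F ⊆ G) (hx : x ∈ F) (hy : y ∈ F) {f g : (S → Bool) → ℝ}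
    (hf : IsDensityOn ν ν₁ F f) (hg : IsDensityOn ν ν₁ G g) :
    p x y * bondForm ν x y f f ≤ p x y * bondForm ν x y g g := by
  have h1 := rate_mul_bondForm_eq hrev hν hFG hx hy hf hg
  have h2 := abs_bondForm_le (ν := ν) (hf.1.mono' hFG) hg.1 (hFG hx) (hFG hy) (δ := 1 / 2)
    (by norm_num)
  have h3 := mul_le_mul_of_nonneg_left ((le_abs_self _).trans h2) (hp.1 x y)
  norm_num at h3
  linarith

theorem bondEnergy_le (hp : IsTransition p) (hfC : ∀ n η, 0 ≤ f n η ∧ f n η ≤ C) (n : ℕ)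
    (e : S × S) : bondEnergy p ν Λ f n e ≤ p e.1 e.2 * C ^ 2 := by
  unfold bondEnergy
  split_ifs
  · exact mul_le_mul_of_nonneg_left (bondForm_self_le _ _ (hfC n)) (hp.1 _ _)
  · exact mul_nonneg (hp.1 _ _) (sq_nonneg _)

theorem bondEnergy_mono (hp : IsTransition p) (hrev : IsReversible p π)
    (hν : ∀ x y, Balanced π ν x y) (hΛ : Monotone Λ)
    (hf : ∀ n, IsDensityOn ν ν₁ (Λ n) (f n)) (e : S × S) :
    Monotone fun n => bondEnergy p ν Λ f n e := by
  intro n m hnm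
  by_cases h : e.1 ∈ Λ n ∧ e.2 ∈ Λ n
  · have h' : e.1 ∈ Λ m ∧ e.2 ∈ Λ m := ⟨hΛ hnm h.1, hΛ hnm h.2⟩
    simp only [bondEnergy, if_pos h, if_pos h']
    exact rate_mul_bondForm_mono hp hrev hν (hΛ hnm) h.1 h.2 (hf n) (hf m)
  · simp only [bondEnergy, if_neg h]
    exact bondEnergy_nonneg hp m e

variable [Countable S] [IsProbabilityMeasure ν₁]

theorem tsum_bondEnergy_le (hp : IsTransition p) (hrev : IsReversible p π)
    (hν : ∀ x y, Balanced π ν x y) (hν₁ : ExclInvariant p ν₁) (hΛ : Monotone Λ)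
    (hcov : ∀ x, ∃ n, x ∈ Λ n) (hf : ∀ n, IsDensityOn ν ν₁ (Λ n) (f n))
    (hfC : ∀ n η, 0 ≤ f n η ∧ f n η ≤ C) {u : S × S → ℝ}
    (hu : ∀ m e, bondEnergy p ν Λ f m e ≤ u e) {δ : ℝ} (hδ : 0 < δ) (n : ℕ)
    (hs : Summable fun e : S × S => |ind (Λ n) e.2 - ind (Λ n) e.1| * u e) :
    ∑' e, bondEnergy p ν Λ f n e ≤ δ * C ^ 2 * flux p (Λ n) +
      (4 * δ)⁻¹ * ∑' e : S × S, |ind (Λ n) e.2 - ind (Λ n) e.1| * u e := by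
  set b : S × S → ℝ := fun e => p e.1 e.2 * ∫ η, (f n (jump e.1 e.2 η) - f n η) ∂ν₁ with hb
  have hbs : Summable b := summable_rate_mul_integral hp (hf n).1
  have hb0 : ∑' e, b e = 0 := (exclInvariant_iff hp).1 hν₁ _ _ (hf n).1
  have hbs' : Summable fun e : S × S => b e.swap := (Equiv.prodComm S S).summable_iff.2 hbs
  have hb0' : ∑' e : S × S, b e.swap = 0 := by
    rw [← hb0]; exact (Equiv.prodComm S S).tsum_eq b
  have hfl := summable_flux hp (Λ n)
  have hpt : ∀ e, bondEnergy p ν Λ f n e + (b e + b e.swap) ≤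
      δ * C ^ 2 * (p e.1 e.2 * |ind (Λ n) e.2 - ind (Λ n) e.1|) +
        (4 * δ)⁻¹ * (|ind (Λ n) e.2 - ind (Λ n) e.1| * u e) := by
    rintro ⟨x, y⟩
    obtain ⟨m, hnm, hxm, hym⟩ : ∃ m, n ≤ m ∧ x ∈ Λ m ∧ y ∈ Λ m := by
      obtain ⟨i, hi⟩ := hcov x
      obtain ⟨j, hj⟩ := hcov y
      refine ⟨max n (max i j), le_max_left _ _, hΛ ?_ hi, hΛ ?_ hj⟩ <;> simp
    have hbb : b (x, y) + b (y, x) = -(p x y * bondForm ν x y (f n) (f m)) :=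
      rate_mul_integral_add_eq hrev hν hxm hym ((hf n).1.mono' (hΛ hnm)) (hf m)
    simp only [Prod.swap_prod_mk]
    rw [hbb]
    have hu0 : 0 ≤ u (x, y) := (bondEnergy_nonneg hp m _).trans (hu m _)
    have hR : 0 ≤ δ * C ^ 2 * (p x y * |ind (Λ n) y - ind (Λ n) x|) +
        (4 * δ)⁻¹ * (|ind (Λ n) y - ind (Λ n) x| * u (x, y)) := by
      have := hp.1 x y
      positivity
    by_cases h : x ∈ Λ n ∧ y ∈ Λ n
    · rw [bondEnergy, if_pos h,
        rate_mul_bondForm_eq hrev hν (hΛ hnm) h.1 h.2 (hf n) (hf m), add_neg_cancel]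
      exact hR
    rw [bondEnergy, if_neg h, zero_add]
    by_cases h' : x ∉ Λ n ∧ y ∉ Λ n
    · have hz : bondForm ν x y (f n) (f m) = 0 := by
        unfold bondForm
        have : ∀ η, f n (swapConfig x y η) = f n η := fun η => (hf n).1 fun i hi => by
          have hix : i ≠ x := by rintro rfl; exact h'.1 hi
          have hiy : i ≠ y := by rintro rfl; exact h'.2 hi
          simp [swapConfig, hix, hiy]
        simp [this]
      rw [hz, mul_zero, neg_zero]
      exact hR
    · have hc : |ind (Λ n) y - ind (Λ n) x| = 1 := by
        unfold ind
        by_cases hx : x ∈ Λ n <;> by_cases hy : y ∈ Λ n <;> simp_all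
      simp only [hc, mul_one, one_mul]
      have h2 := abs_bondForm_le (ν := ν) ((hf n).1.mono' (hΛ hnm)) (hf m).1 hxm hym hδ
      have h3 := mul_le_mul_of_nonneg_left ((neg_abs_le _).trans' (neg_le_neg h2)) (hp.1 x y)
      have h4 := mul_le_mul_of_nonneg_left (bondForm_self_le (ν := ν) x y (hfC n)) (hp.1 x y)
      have h5 := hu m (x, y)
      rw [bondEnergy, if_pos ⟨hxm, hym⟩] at h5
      have h6 := mul_le_mul_of_nonneg_left h4 hδ.le
      have h7 := mul_le_mul_of_nonneg_left h5 (by positivity : 0 ≤ (4 * δ)⁻¹)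
      simp only at h7
      linarith
  have hB := (summable_bondEnergy (p := p) (ν := ν) (Λ := Λ) (f := f) n)
  have h1 := (hB.add (hbs.add hbs')).tsum_le_tsum hpt
    ((hfl.mul_left (δ * C ^ 2)).add (hs.mul_left (4 * δ)⁻¹))
  rw [hB.tsum_add (hbs.add hbs'), hbs.tsum_add hbs', hb0, hb0',
    (hfl.mul_left (δ * C ^ 2)).tsum_add (hs.mul_left (4 * δ)⁻¹), tsum_mul_left, tsum_mul_left] at h1
  simpa [flux] using h1

/-- With bounded boundary fluxes, densities of invariant measures carry no energy. -/
theorem bondEnergy_eq_zero (hp : IsTransition p) (hrev : IsReversible p π)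
    (hν : ∀ x y, Balanced π ν x y) (hν₁ : ExclInvariant p ν₁) (hΛ : Monotone Λ)
    (hcov : ∀ x, ∃ n, x ∈ Λ n) {B : ℝ} (hB : ∀ n, flux p (Λ n) ≤ B)
    (hf : ∀ n, IsDensityOn ν ν₁ (Λ n) (f n))
    (hfC : ∀ n η, 0 ≤ f n η ∧ f n η ≤ C) (k : ℕ) (e : S × S) :
    bondEnergy p ν Λ f k e = 0 := by
  have hnn := fun n e => bondEnergy_nonneg (p := p) (ν := ν) (Λ := Λ) (f := f) hp n e
  have hle := fun n e => bondEnergy_le (p := p) (ν := ν) (Λ := Λ) (f := f) hp hfC n e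
  have hmono := fun e => bondEnergy_mono hp hrev hν hΛ hf e
  have hB0 : 0 ≤ B := (tsum_nonneg fun e => mul_nonneg (hp.1 _ _) (abs_nonneg _)).trans (hB 0)
  have hpass : ∀ n, ∑' e, bondEnergy p ν Λ f n e ≤ C ^ 2 * B := by
    intro n
    have he : ∀ e : S × S, |ind (Λ n) e.2 - ind (Λ n) e.1| * (p e.1 e.2 * C ^ 2) =
        C ^ 2 * (p e.1 e.2 * |ind (Λ n) e.2 - ind (Λ n) e.1|) := fun e => by ring
    have := tsum_bondEnergy_le hp hrev hν hν₁ hΛ hcov hf hfC (u := fun e => p e.1 e.2 * C ^ 2)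
      (fun m e => hle m e) (δ := 1 / 2) (by norm_num) n
      (((summable_flux hp (Λ n)).mul_left (C ^ 2)).congr fun e => (he e).symm)
    simp only [he, tsum_mul_left] at this
    change _ ≤ _ + _ * (C ^ 2 * flux p (Λ n)) at this
    norm_num at this
    have h2 := mul_le_mul_of_nonneg_left (hB n) (sq_nonneg C)
    linarith
  set w : S × S → ℝ := fun e => ⨆ n, bondEnergy p ν Λ f n e with hw
  have hbdd : ∀ e, BddAbove (Set.range fun n => bondEnergy p ν Λ f n e) := fun e =>
    ⟨_, by rintro _ ⟨n, rfl⟩; exact hle n e⟩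
  have hwle : ∀ n e, bondEnergy p ν Λ f n e ≤ w e := fun n e => le_ciSup (hbdd e) n
  have hw0 : ∀ e, 0 ≤ w e := fun e => (hnn 0 e).trans (hwle 0 e)
  have hws : Summable w := by
    refine summable_of_sum_le hw0 (c := C ^ 2 * B) fun T => ?_
    refine le_of_tendsto' (tendsto_finsetSum T fun e _ => tendsto_atTop_ciSup (hmono e) (hbdd e))
      fun n => ?_
    exact ((summable_bondEnergy n).sum_le_tsum T fun e _ => hnn n e).trans (hpass n)
  have hcw : ∀ n e, ‖|ind (Λ n) e.2 - ind (Λ n) e.1| * w e‖ ≤ w e := by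
    intro n e
    rw [norm_mul, Real.norm_of_nonneg (hw0 e), norm_abs_eq_norm]
    refine mul_le_of_le_one_left (hw0 e) (abs_le.2 ⟨?_, ?_⟩) <;>
      linarith [ind_nonneg (Λ n) e.1, ind_le_one (Λ n) e.1, ind_nonneg (Λ n) e.2,
        ind_le_one (Λ n) e.2]
  have hlim : Tendsto (fun n => ∑' e : S × S, |ind (Λ n) e.2 - ind (Λ n) e.1| * w e) atTop
      (𝓝 0) := by
    rw [← tsum_zero (α := ℝ) (β := S × S)]
    refine tendsto_tsum_of_dominated_convergence hws (fun e => ?_)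
      (Eventually.of_forall fun n e => hcw n e)
    refine tendsto_const_nhds.congr' ?_
    obtain ⟨i, hi⟩ := hcov e.1
    obtain ⟨j, hj⟩ := hcov e.2
    filter_upwards [eventually_ge_atTop i, eventually_ge_atTop j] with n hn hn'
    simp [ind, hΛ hn hi, hΛ hn' hj]
  have hδ : ∀ δ : ℝ, 0 < δ → bondEnergy p ν Λ f k e ≤ δ * (C ^ 2 * B) := by
    intro δ hδ
    have h1 := (hlim.const_mul (4 * δ)⁻¹).const_add (δ * (C ^ 2 * B))
    rw [mul_zero, add_zero] at h1
    refine ge_of_tendsto h1 ?_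
    filter_upwards [eventually_ge_atTop k] with n hn
    have h2 := tsum_bondEnergy_le hp hrev hν hν₁ hΛ hcov hf hfC hwle hδ n
      (Summable.of_norm_bounded hws (hcw n))
    have h3 := (summable_bondEnergy (p := p) (ν := ν) (Λ := Λ) (f := f) n).le_tsum e
      fun e _ => hnn n e
    have h4 := mul_le_mul_of_nonneg_left (hB n) (mul_nonneg hδ.le (sq_nonneg C))
    have h5 := hmono e hn
    simp only at h5
    linarith
  refine le_antisymm (le_of_forall_pos_le_add fun ε hε => ?_) (hnn k e)
  have hK : 0 ≤ C ^ 2 * B := by positivity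
  have := hδ (ε / (C ^ 2 * B + 1)) (by positivity)
  refine this.trans ?_
  rw [div_mul_eq_mul_div, div_le_iff₀ (by positivity)]
  nlinarith

end Energy

section Bernoulli

variable {S : Type*}

/-- The occupation number of the site `x`. -/
def part (x : S) (η : S → Bool) : ℝ := if η x = true then 1 else 0

theorem part_nonneg (x : S) (η : S → Bool) : 0 ≤ part x η := by unfold part; split_ifs <;> simp

theorem part_le_one (x : S) (η : S → Bool) : part x η ≤ 1 := by unfold part; split_ifs <;> simp

theorem part_mul_self (x : S) (η : S → Bool) : part x η * part x η = part x η := by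
  unfold part; split_ifs <;> simp

theorem occ_eq (x y : S) (η : S → Bool) : occ x y η = part x η * (1 - part y η) := by
  unfold occ part
  cases η x <;> cases η y <;> simp

theorem dependsOn_part {x : S} {F : Finset S} (hx : x ∈ F) : DependsOn (part x) (F : Set S) :=
  fun η ξ h => by simp only [part, h x hx]

theorem dependsOn_one_sub_part {x : S} {F : Finset S} (hx : x ∈ F) :
    DependsOn (fun η => 1 - part x η) (F : Set S) :=
  fun η ξ h => by simp only [part, h x hx]

theorem dependsOn_prod_part (F : Finset S) : DependsOn (fun η => ∏ x ∈ F, part x η) (F : Set S) :=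
  fun _ _ h => Finset.prod_congr rfl fun _ hx => dependsOn_part hx h

theorem integral_prod_part (M : Measure (S → Bool)) (F : Finset S) :
    ∫ η, ∏ x ∈ F, part x η ∂M = M.real {η | ∀ x ∈ F, η x = true} := by
  rw [← integral_indicator_one (measurableSet_forall_eq F fun _ => true)]
  congr 1
  funext η
  simp only [part, Set.indicator_apply, Set.mem_ofPred_eq, Pi.one_apply]
  by_cases h : ∀ x ∈ F, η x = true
  · rw [if_pos h]
    exact Finset.prod_eq_one fun x hx => if_pos (h x hx)
  · rw [if_neg h]
    push Not at h
    obtain ⟨x, hx, hx'⟩ := h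
    exact Finset.prod_eq_zero hx (if_neg hx')

theorem _root_.IsBernoulliProduct.real_forall_true {ν : Measure (S → Bool)} {α : S → ℝ}
    (hν : IsBernoulliProduct ν α) (hα : ∀ x, 0 ≤ α x) (F : Finset S) :
    ν.real {η | ∀ x ∈ F, η x = true} = ∏ x ∈ F, α x := by
  rw [measureReal_def, hν.2 F fun _ => true, ENNReal.toReal_prod]
  exact Finset.prod_congr rfl fun x _ => by simp [ENNReal.toReal_ofReal (hα x)]

variable [DecidableEq S]

theorem _root_.IsBernoulliProduct.integral_sq_le {ν : Measure (S → Bool)} {α : S → ℝ}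
    (hν : IsBernoulliProduct ν α) (hα : ∀ x, 0 ≤ α x) (hα1 : ∀ x, α x ≤ 1) (Y : Finset S)
    {b : S → ℝ} (hb : ∀ y, |b y| ≤ 1) :
    ∫ η, (∑ y ∈ Y, b y * (part y η - α y)) ^ 2 ∂ν ≤ ∑ y ∈ Y, α y * (1 - α y) := by
  have := hν.1
  have hi : ∀ y, Integrable (part y) ν := fun y =>
    (dependsOn_part (F := {y}) (Finset.mem_singleton_self y)).integrable ν
  have hi2 : ∀ y z, Integrable (fun η => part y η * part z η) ν := fun y z =>
    ((dependsOn_part (F := {y, z}) (by simp)).mul' (dependsOn_part (by simp))).integrable ν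
  have h1 : ∀ y, ∫ η, part y η ∂ν = α y := fun y => by
    have := integral_prod_part ν {y}
    rw [hν.real_forall_true hα] at this
    simpa using this
  have h2 : ∀ y z, ∫ η, part y η * part z η ∂ν = if y = z then α y else α y * α z := by
    intro y z
    split_ifs with h
    · subst h; simp only [part_mul_self, h1]
    · have := integral_prod_part ν {y, z}
      rw [hν.real_forall_true hα] at this
      simpa [Finset.prod_pair h] using this
  have h3 : ∀ y z, Integrable (fun η => (part y η - α y) * (part z η - α z)) ν ∧
      ∫ η, (part y η - α y) * (part z η - α z) ∂ν = if y = z then α y * (1 - α y) else 0 := by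
    intro y z
    have e : (fun η => (part y η - α y) * (part z η - α z)) = fun η =>
        part y η * part z η - α z * part y η - α y * part z η + α y * α z := by
      funext η; ring
    have i1 : Integrable (fun η => part y η * part z η - α z * part y η) ν :=
      (hi2 y z).sub ((hi y).const_mul (α z))
    have i2 : Integrable (fun η => part y η * part z η - α z * part y η - α y * part z η) ν :=
      i1.sub ((hi z).const_mul (α y))
    rw [e]
    refine ⟨i2.add (integrable_const _), ?_⟩
    rw [integral_add i2 (integrable_const _), integral_sub i1 ((hi z).const_mul (α y)),
      integral_sub (hi2 y z) ((hi y).const_mul (α z)), integral_const_mul, integral_const_mul, h1,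
      h1, h2, integral_const, probReal_univ]
    split_ifs with h
    · subst h; simp only [one_smul]; ring
    · simp only [one_smul]; ring
  have h4 : ∀ η, (∑ y ∈ Y, b y * (part y η - α y)) ^ 2 = ∑ y ∈ Y, ∑ z ∈ Y,
      (b y * b z) * ((part y η - α y) * (part z η - α z)) := by
    intro η
    rw [pow_two, Finset.sum_mul_sum]
    exact Finset.sum_congr rfl fun y _ => Finset.sum_congr rfl fun z _ => by ring
  simp only [h4]
  rw [integral_finsetSum _ fun y _ => integrable_finsetSum _ fun z _ => (h3 y z).1.const_mul _]
  refine Finset.sum_le_sum fun y hy => ?_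
  rw [integral_finsetSum _ fun z _ => (h3 y z).1.const_mul _]
  simp only [integral_const_mul, (h3 y _).2, mul_ite, mul_zero, Finset.sum_ite_eq, if_pos hy]
  refine mul_le_of_le_one_left (mul_nonneg (hα y) (by linarith [hα1 y])) ?_
  rw [← pow_two, ← sq_abs]
  exact pow_le_one₀ (abs_nonneg _) (hb y)

/-- Detailed balance at `x` and `y` given the configuration elsewhere. -/
def PairBalanced (π : S → ℝ) (M : Measure (S → Bool)) (x y : S) : Prop :=
  ∀ (k : (S → Bool) → ℝ) (F : Finset S), DependsOn k (F : Set S) → x ∉ F → y ∉ F →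
    π y * ∫ η, occ x y η * k η ∂M = π x * ∫ η, occ y x η * k η ∂M

theorem PairBalanced.trans {π : S → ℝ} (hπ : ∀ x, 0 < π x) {M : Measure (S → Bool)}
    [IsProbabilityMeasure M] {x y z : S} (hxy : x ≠ y) (hxz : x ≠ z) (hzy : z ≠ y)
    (h1 : PairBalanced π M x z) (h2 : PairBalanced π M z y) : PairBalanced π M x y := by
  intro k F hk hxF hyF
  set E := F.erase z with hE
  have hxE : x ∉ E := fun h => hxF (Finset.mem_of_mem_erase h)
  have hyE : y ∉ E := fun h => hyF (Finset.mem_of_mem_erase h)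
  have hzE : z ∉ E := Finset.notMem_erase z F
  have hup : ∀ b : Bool, DependsOn (fun η => k (Function.update η z b)) (E : Set S) := by
    intro b η ξ h
    refine hk fun i hi => ?_
    by_cases hiz : i = z
    · subst hiz; simp
    · simp only [Function.update_of_ne hiz]
      exact h i (by simpa [hE, hiz] using hi)
  set k1 : (S → Bool) → ℝ := fun η => k (Function.update η z true) with hk1
  set k0 : (S → Bool) → ℝ := fun η => k (Function.update η z false) with hk0
  have hdec : ∀ η, k η = part z η * k1 η + (1 - part z η) * k0 η := by
    intro η
    have : k η = k (Function.update η z (η z)) := by rw [Function.update_eq_self]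
    rw [this, hk1, hk0]
    cases h : η z <;> simp [part, h]
  have hins : ∀ a : S, E ⊆ insert a E := fun a => Finset.subset_insert a E
  have hA := h2 _ (insert x E)
    ((dependsOn_part (Finset.mem_insert_self x E)).mul' ((hup true).mono' (hins x)))
    (by simp [hxz.symm, hzE]) (by simp [hxy.symm, hyE])
  have hB := h1 _ (insert y E)
    ((dependsOn_part (Finset.mem_insert_self y E)).mul' ((hup true).mono' (hins y)))
    (by simp [hxy, hxE]) (by simp [hzy, hzE])
  have hC := h1 _ (insert y E)
    ((dependsOn_one_sub_part (Finset.mem_insert_self y E)).mul' ((hup false).mono' (hins y)))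
    (by simp [hxy, hxE]) (by simp [hzy, hzE])
  have hD := h2 _ (insert x E)
    ((dependsOn_one_sub_part (Finset.mem_insert_self x E)).mul' ((hup false).mono' (hins x)))
    (by simp [hxz.symm, hzE]) (by simp [hxy.symm, hyE])
  have hsplit : ∀ a b : S, ∫ η, occ a b η * k η ∂M =
      ∫ η, occ a b η * (part z η * k1 η) ∂M + ∫ η, occ a b η * ((1 - part z η) * k0 η) ∂M := by
    intro a b
    have ho : DependsOn (occ a b) ((insert a (insert b (insert z E)) : Finset S) : Set S) :=
      dependsOn_occ (by simp) (by simp)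
    have hsub : E ⊆ insert a (insert b (insert z E)) := fun i hi => by simp [hi]
    rw [← integral_add]
    · refine integral_congr_ae (ae_of_all _ fun η => ?_)
      simp only [hdec η]; ring
    · exact (ho.mul' ((dependsOn_part (by simp)).mul' ((hup true).mono' hsub))).integrable M
    · exact (ho.mul' ((dependsOn_one_sub_part (by simp)).mul'
        ((hup false).mono' hsub))).integrable M
  have r1 : ∀ η, occ z y η * (part x η * k1 η) = occ x y η * (part z η * k1 η) := fun η => by
    simp only [occ_eq]; ring
  have r2 : ∀ η, occ y z η * (part x η * k1 η) = occ x z η * (part y η * k1 η) := fun η => by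
    simp only [occ_eq]; ring
  have r3 : ∀ η, occ z x η * (part y η * k1 η) = occ y x η * (part z η * k1 η) := fun η => by
    simp only [occ_eq]; ring
  have r4 : ∀ η, occ x z η * ((1 - part y η) * k0 η) = occ x y η * ((1 - part z η) * k0 η) :=
    fun η => by simp only [occ_eq]; ring
  have r5 : ∀ η, occ z x η * ((1 - part y η) * k0 η) = occ z y η * ((1 - part x η) * k0 η) :=
    fun η => by simp only [occ_eq]; ring
  have r6 : ∀ η, occ y z η * ((1 - part x η) * k0 η) = occ y x η * ((1 - part z η) * k0 η) :=
    fun η => by simp only [occ_eq]; ring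
  change π y * ∫ η, occ z y η * (part x η * k1 η) ∂M =
    π z * ∫ η, occ y z η * (part x η * k1 η) ∂M at hA
  change π z * ∫ η, occ x z η * (part y η * k1 η) ∂M =
    π x * ∫ η, occ z x η * (part y η * k1 η) ∂M at hB
  change π z * ∫ η, occ x z η * ((1 - part y η) * k0 η) ∂M =
    π x * ∫ η, occ z x η * ((1 - part y η) * k0 η) ∂M at hC
  change π y * ∫ η, occ z y η * ((1 - part x η) * k0 η) ∂M =
    π z * ∫ η, occ y z η * ((1 - part x η) * k0 η) ∂M at hD
  simp only [r1, r2] at hA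
  simp only [r3] at hB
  simp only [r4, r5] at hC
  simp only [r6] at hD
  rw [hsplit, hsplit]
  refine mul_left_cancel₀ (hπ z).ne' ?_
  linear_combination π z * hA + π z * hB + π y * hC + π x * hD

theorem pairBalanced_of_edges {p : S → S → ℝ} (hirr : IrreducibleKernel p) {π : S → ℝ}
    (hπ : ∀ x, 0 < π x) {M : Measure (S → Bool)} [IsProbabilityMeasure M]
    (h : ∀ x y, x ≠ y → 0 < p x y → PairBalanced π M x y) (x y : S) (hxy : x ≠ y) :
    PairBalanced π M x y := by
  obtain ⟨n, c, h0, hn, hc⟩ := hirr x y hxy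
  induction n generalizing y with
  | zero => exact absurd (h0.symm.trans hn) hxy
  | succ n ih =>
    have hlast := hc n n.lt_succ_self
    rw [hn] at hlast
    by_cases hx : c n = x
    · rw [hx] at hlast
      exact h x y hxy hlast
    have h1 := ih (c n) (Ne.symm hx) rfl fun i hi => hc i (hi.trans n.lt_succ_self)
    by_cases hy : c n = y
    · rwa [hy] at h1
    · exact h1.trans hπ hxy (Ne.symm hx) hy (h _ _ hy hlast)

theorem exists_disjoint_sum_ge {v : S → ℝ} (hv : ∀ x, 0 ≤ v x) (hdiv : ¬ Summable v)
    (G : Finset S) (R : ℝ) : ∃ Y : Finset S, Disjoint Y G ∧ R ≤ ∑ y ∈ Y, v y := by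
  by_contra! hcon
  refine hdiv (summable_of_sum_le hv (c := R + ∑ y ∈ G, v y) fun F => ?_)
  rw [← Finset.sum_inter_add_sum_sdiff F G, add_comm]
  exact add_le_add (hcon _ Finset.sdiff_disjoint).le
    (Finset.sum_le_sum_of_subset_of_nonneg Finset.inter_subset_right fun x _ _ => hv x)

end Bernoulli

section Extremality

variable {S : Type*} {π : S → ℝ} {ν M : Measure (S → Bool)} {C : ℝ}

theorem integral_le_mul_integral_of_le [IsProbabilityMeasure ν] [IsProbabilityMeasure M]
    (hC : 0 ≤ C) (hle : ∀ s, MeasurableSet s → M.real s ≤ C * ν.real s)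
    {g : (S → Bool) → ℝ} {F : Finset S} (hg : DependsOn g (F : Set S))
    (hg0 : ∀ η, 0 ≤ g η) : ∫ η, g η ∂M ≤ C * ∫ η, g η ∂ν := by
  obtain ⟨f, hf, hfC, hfk⟩ := exists_cylinder_density hC hle F
  rw [hfk g hg, ← integral_const_mul]
  refine integral_mono ((hg.mul' hf).integrable ν) ((hg.integrable ν).const_mul C) fun η => ?_
  rw [mul_comm C]
  exact mul_le_mul_of_nonneg_left (hfC η).2 (hg0 η)

variable [DecidableEq S] [IsProbabilityMeasure ν]

theorem pairBalanced_of_bondForm_eq_zero {f : (S → Bool) → ℝ} {G : Finset S} {x y : S}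
    (hν : Balanced π ν x y) (hf : IsDensityOn ν M G f) (hx : x ∈ G) (hy : y ∈ G)
    (h0 : bondForm ν x y f f = 0) {k : (S → Bool) → ℝ} {F : Finset S}
    (hk : DependsOn k (F : Set S)) (hFG : F ⊆ G) (hxF : x ∉ F) (hyF : y ∉ F) :
    π y * ∫ η, occ x y η * k η ∂M = π x * ∫ η, occ y x η * k η ∂M := by
  have hkG := hk.mono' hFG
  have hks : ∀ η, k (swapConfig x y η) = k η := fun η => hk fun i hi => by
    have hix : i ≠ x := fun h => hxF (h ▸ hi)
    have hiy : i ≠ y := fun h => hyF (h ▸ hi)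
    simp [swapConfig, hix, hiy]
  have hd := (hf.1.comp_swapConfig hx hy).sub' hf.1
  have hae : ∀ᵐ η ∂ν, occ x y η * f η = occ x y η * f (swapConfig x y η) := by
    have := (integral_eq_zero_iff_of_nonneg (fun η => mul_nonneg (occ_nonneg x y η)
      (mul_self_nonneg _)) (((dependsOn_occ hx hy).mul' (hd.mul' hd)).integrable ν)).1 h0
    filter_upwards [this] with η hη
    rcases mul_eq_zero.1 hη with h | h
    · simp only [h, zero_mul]
    · rw [← sub_eq_zero.1 (mul_self_eq_zero.1 h)]
  rw [hf.2 _ ((dependsOn_occ hx hy).mul' hkG), hf.2 _ ((dependsOn_occ hy hx).mul' hkG)]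
  have hb := hν (fun η => k η * f η) (hkG.mul' hf.1).measurable
  simp only [hks] at hb
  simp only [mul_assoc]
  rw [← hb]
  congr 1
  refine integral_congr_ae ?_
  filter_upwards [hae] with η hη
  linear_combination k η * hη

variable [IsProbabilityMeasure M]

theorem pairBalanced_of_le [Countable S] {p : S → S → ℝ} (hp : IsTransition p)
    (hirr : IrreducibleKernel p) (hrev : IsReversible p π) (hν : ∀ x y, Balanced π ν x y)
    (hM : ExclInvariant p M) {Λ : ℕ → Finset S} (hΛ : Monotone Λ) (hcov : ∀ x, ∃ n, x ∈ Λ n)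
    {B : ℝ} (hB : ∀ n, flux p (Λ n) ≤ B) (hC : 0 ≤ C)
    (hle : ∀ s, MeasurableSet s → M.real s ≤ C * ν.real s) (x y : S) (hxy : x ≠ y) :
    PairBalanced π M x y := by
  choose f hf1 hf2 hf3 using fun n => exists_cylinder_density hC hle (Λ n)
  have hf : ∀ n, IsDensityOn ν M (Λ n) (f n) := fun n => ⟨hf1 n, hf3 n⟩
  refine pairBalanced_of_edges hirr hrev.1 (fun x y _ hpxy k F hk hxF hyF => ?_) x y hxy
  obtain ⟨n, hn⟩ : ∃ n, insert x (insert y F) ⊆ Λ n := by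
    choose m hm using hcov
    exact ⟨(insert x (insert y F)).sup m, fun z hz => hΛ (Finset.le_sup hz) (hm z)⟩
  have hx : x ∈ Λ n := hn (by simp)
  have hy : y ∈ Λ n := hn (by simp)
  have h0 := bondEnergy_eq_zero hp hrev hν hM hΛ hcov hB hf hf2 n (x, y)
  rw [bondEnergy, if_pos ⟨hx, hy⟩] at h0
  exact pairBalanced_of_bondForm_eq_zero (hν x y) (hf n) hx hy
    ((mul_eq_zero.1 h0).resolve_left hpxy.ne') hk (fun z hz => hn (by simp [hz])) hxF hyF

theorem abs_integral_sum_mul_le {α : S → ℝ} (hν : IsBernoulliProduct ν α) (hα : ∀ x, 0 ≤ α x)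
    (hα1 : ∀ x, α x ≤ 1) (hC : 0 ≤ C) (hle : ∀ s, MeasurableSet s → M.real s ≤ C * ν.real s)
    (Y : Finset S) {b : S → ℝ} (hb : ∀ y, |b y| ≤ 1) {g : (S → Bool) → ℝ} {K : ℝ}
    (hg : ∀ η, |g η| ≤ K) {s : ℝ} (hs : 0 < s) :
    |∫ η, (∑ y ∈ Y, b y * (part y η - α y)) * g η ∂M| ≤
      K * (s + C * (∑ y ∈ Y, α y * (1 - α y)) / s) / 2 := by
  have hK : 0 ≤ K := (abs_nonneg _).trans (hg fun _ => true)
  set m : (S → Bool) → ℝ := fun η => ∑ y ∈ Y, b y * (part y η - α y)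
  have hm : DependsOn (fun η => m η ^ 2) (Y : Set S) := fun η ξ h => by
    simp only [m]
    congr 1
    exact Finset.sum_congr rfl fun y hy => by rw [dependsOn_part hy h]
  have hsq : ∫ η, m η ^ 2 ∂M ≤ C * ∑ y ∈ Y, α y * (1 - α y) :=
    (integral_le_mul_integral_of_le hC hle hm fun η => sq_nonneg _).trans
      (mul_le_mul_of_nonneg_left (hν.integral_sq_le hα hα1 Y hb) hC)
  have hpt : ∀ η, ‖m η * g η‖ ≤ K / 2 * s + K / (2 * s) * m η ^ 2 := fun η => by
    rw [norm_mul, Real.norm_eq_abs, Real.norm_eq_abs]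
    have h1 : |m η| ≤ s / 2 + m η ^ 2 / (2 * s) := by
      rw [← sq_abs (m η), div_add_div _ _ two_ne_zero (by positivity), le_div_iff₀ (by positivity)]
      nlinarith [sq_nonneg (s - |m η|)]
    calc _ ≤ (s / 2 + m η ^ 2 / (2 * s)) * K :=
          mul_le_mul h1 (hg η) (abs_nonneg _) ((abs_nonneg _).trans h1)
      _ = _ := by ring
  have hi := (hm.integrable M).const_mul (K / (2 * s))
  rw [← Real.norm_eq_abs]
  refine (norm_integral_le_of_norm_le ((integrable_const (K / 2 * s)).add hi)
    (ae_of_all _ hpt)).trans ?_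
  simp only [Pi.add_apply]
  rw [integral_add (integrable_const _) hi, integral_const, probReal_univ, one_smul,
    integral_const_mul]
  calc _ ≤ K / 2 * s + K / (2 * s) * (C * ∑ y ∈ Y, α y * (1 - α y)) := by gcongr
    _ = _ := by field_simp

/-- Absolutely continuous (with bounded density) measures satisfying detailed balance for all pairs
factorize over single sites. -/
theorem integral_part_mul_eq (hπ : ∀ x, 0 < π x)
    (hν : IsBernoulliProduct ν fun x => π x / (1 + π x))
    (hdiv : ¬ Summable fun x => π x / (1 + π x) ^ 2) (hC : 0 ≤ C)
    (hle : ∀ s, MeasurableSet s → M.real s ≤ C * ν.real s)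
    (hM : ∀ x y, x ≠ y → PairBalanced π M x y) {k : (S → Bool) → ℝ} {F : Finset S}
    (hk : DependsOn k (F : Set S)) {x : S} (hx : x ∉ F) :
    ∫ η, part x η * k η ∂M = π x / (1 + π x) * ∫ η, k η ∂M := by
  set α : S → ℝ := fun x => π x / (1 + π x) with hαdef
  have hα : ∀ x, 0 ≤ α x := fun x => (div_pos (hπ x) (by linarith [hπ x])).le
  have hα1 : ∀ x, α x ≤ 1 := fun x => (div_le_one (by linarith [hπ x])).2 (by linarith [hπ x])
  have h1α : ∀ x, 1 - α x = 1 / (1 + π x) := fun x => by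
    have := hπ x
    simp only [hαdef]; field_simp; ring
  have hv : ∀ x, π x / (1 + π x) ^ 2 = α x * (1 - α x) := fun x => by
    have := hπ x
    rw [h1α]; simp only [hαdef]; field_simp
  simp only [hv] at hdiv
  have hv0 : ∀ x, 0 ≤ α x * (1 - α x) := fun x => mul_nonneg (hα x) (by linarith [hα1 x])
  obtain ⟨K, hK0, hK⟩ := hk.exists_bound
  set P := ∫ η, part x η * k η ∂M with hP
  set Q := ∫ η, k η ∂M with hQ
  set g₁ : (S → Bool) → ℝ := fun η => (1 - α x) * (part x η * k η) with hg₁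
  set g₂ : (S → Bool) → ℝ := fun η => α x * ((1 - part x η) * k η) with hg₂
  have hb1 : ∀ η, |g₁ η| ≤ K := fun η => by
    rw [hg₁, abs_mul, abs_mul, abs_of_nonneg (part_nonneg x η),
      abs_of_nonneg (by linarith [hα1 x] : 0 ≤ 1 - α x)]
    have := mul_le_of_le_one_left (abs_nonneg (k η)) (part_le_one x η)
    exact (mul_le_of_le_one_left (mul_nonneg (part_nonneg x η) (abs_nonneg _))
      (by linarith [hα x])).trans (this.trans (hK η))
  have hb2 : ∀ η, |g₂ η| ≤ K := fun η => by
    have hp0 : 0 ≤ 1 - part x η := by linarith [part_le_one x η]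
    rw [hg₂, abs_mul, abs_mul, abs_of_nonneg hp0, abs_of_nonneg (hα x)]
    have := mul_le_of_le_one_left (abs_nonneg (k η))
      (by linarith [part_nonneg x η] : 1 - part x η ≤ 1)
    exact (mul_le_of_le_one_left (mul_nonneg hp0 (abs_nonneg _)) (hα1 x)).trans
      (this.trans (hK η))
  have hpair : ∀ y, y ∉ insert x F → α y * (1 - α y) * (P - α x * Q) =
      ∫ η, α y * (part y η - α y) * g₁ η ∂M + ∫ η, (1 - α y) * (part y η - α y) * g₂ η ∂M := by
    intro y hy
    have hyx : y ≠ x := fun h => hy (by simp [h])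
    have hyF : y ∉ F := fun h => hy (by simp [h])
    have hbal := hM x y hyx.symm k F hk hx hyF
    have hkG := hk.mono' ((Finset.subset_insert x F).trans (Finset.subset_insert y _))
    have hpx : DependsOn (part x) ((insert y (insert x F) : Finset S) : Set S) :=
      dependsOn_part (by simp)
    have hpy : DependsOn (part y) ((insert y (insert x F) : Finset S) : Set S) :=
      dependsOn_part (by simp)
    have iQ := hkG.integrable M
    have iP := (hpx.mul' hkG).integrable M
    have iR := (hpy.mul' hkG).integrable M
    have iT := (hpy.mul' (hpx.mul' hkG)).integrable M
    have e1 : ∫ η, occ x y η * k η ∂M =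
        P - ∫ η, part y η * (part x η * k η) ∂M := by
      rw [hP, ← integral_sub iP iT]
      exact integral_congr_ae (ae_of_all _ fun η => by simp only [occ_eq]; ring)
    have e2 : ∫ η, occ y x η * k η ∂M =
        ∫ η, part y η * k η ∂M - ∫ η, part y η * (part x η * k η) ∂M := by
      rw [← integral_sub iR iT]
      exact integral_congr_ae (ae_of_all _ fun η => by simp only [occ_eq]; ring)
    have e3 : ∫ η, α y * (part y η - α y) * g₁ η ∂M =
        α y * (1 - α x) * (∫ η, part y η * (part x η * k η) ∂M - α y * P) := by
      rw [hP, ← integral_const_mul (α y), ← integral_sub iT (iP.const_mul _), ← integral_const_mul]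
      exact integral_congr_ae (ae_of_all _ fun η => by simp only [hg₁]; ring)
    have e4 : ∫ η, (1 - α y) * (part y η - α y) * g₂ η ∂M =
        (1 - α y) * α x * ((∫ η, part y η * k η ∂M - ∫ η, part y η * (part x η * k η) ∂M) -
          α y * (Q - P)) := by
      have i1 : Integrable (fun η => part y η * k η - part y η * (part x η * k η)) M := iR.sub iT
      have i2 : Integrable (fun η => k η - part x η * k η) M := iQ.sub iP
      rw [hP, hQ, ← integral_sub iR iT, ← integral_sub iQ iP, ← integral_const_mul (α y),
        ← integral_sub i1 (i2.const_mul _), ← integral_const_mul]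
      exact integral_congr_ae (ae_of_all _ fun η => by simp only [hg₂]; ring)
    rw [e1, e2] at hbal
    rw [e3, e4]
    generalize ∫ η, part y η * (part x η * k η) ∂M = T at hbal ⊢
    generalize ∫ η, part y η * k η ∂M = R at hbal ⊢
    have hbal' : α y * (1 - α x) * (P - T) = α x * (1 - α y) * (R - T) := by
      have h1 := hπ x
      have h2 := hπ y
      rw [h1α, h1α]
      simp only [hαdef]
      field_simp
      linear_combination hbal
    linear_combination hbal'
  have hest : ∀ δ : ℝ, 0 < δ → |P - α x * Q| ≤ 2 * K * δ := by
    intro δ hδ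
    obtain ⟨Y, hYd, hY⟩ := exists_disjoint_sum_ge hv0 hdiv (insert x F) (C / δ ^ 2 + 1)
    set V := ∑ y ∈ Y, α y * (1 - α y) with hV
    have hCV : C ≤ V * δ ^ 2 := (div_le_iff₀ (by positivity)).1 (by linarith)
    have hVpos : 0 < V := lt_of_lt_of_le (by positivity) hY
    have hint : ∀ (b : S → ℝ) (g : (S → Bool) → ℝ), DependsOn g ((insert x F : Finset S) : Set S) →
        ∫ η, (∑ y ∈ Y, b y * (part y η - α y)) * g η ∂M =
          ∑ y ∈ Y, ∫ η, b y * (part y η - α y) * g η ∂M := by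
      intro b g hg
      simp only [Finset.sum_mul]
      refine integral_finsetSum _ fun y _ => DependsOn.integrable (F := insert y (insert x F)) ?_ M
      refine DependsOn.mul' (fun η ξ h => ?_) (hg.mono' (Finset.subset_insert _ _))
      rw [dependsOn_part (Finset.mem_insert_self y _) h]
    have hkG := hk.mono' (Finset.subset_insert x F)
    have hg1d : DependsOn g₁ ((insert x F : Finset S) : Set S) := fun η ξ h => by
      simp only [hg₁, hkG h, dependsOn_part (Finset.mem_insert_self x F) h]
    have hg2d : DependsOn g₂ ((insert x F : Finset S) : Set S) := fun η ξ h => by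
      simp only [hg₂, hkG h, dependsOn_part (Finset.mem_insert_self x F) h]
    have hsum : V * (P - α x * Q) =
        ∫ η, (∑ y ∈ Y, α y * (part y η - α y)) * g₁ η ∂M +
          ∫ η, (∑ y ∈ Y, (1 - α y) * (part y η - α y)) * g₂ η ∂M := by
      rw [hint α g₁ hg1d, hint (fun y => 1 - α y) g₂ hg2d, ← Finset.sum_add_distrib, hV,
        Finset.sum_mul]
      exact Finset.sum_congr rfl fun y hy => hpair y fun h => Finset.disjoint_left.1 hYd hy h
    have hs : 0 < δ * V := by positivity
    have hA := abs_integral_sum_mul_le hν hα hα1 hC hle Y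
      (fun y => abs_le.2 ⟨by linarith [hα y], hα1 y⟩) hb1 hs
    have hB := abs_integral_sum_mul_le hν hα hα1 hC hle Y (b := fun y => 1 - α y)
      (fun y => abs_le.2 ⟨by linarith [hα1 y], by linarith [hα y]⟩) hb2 hs
    have hq : C * V / (δ * V) ≤ δ * V := by
      rw [div_le_iff₀ hs]
      nlinarith
    have htot : V * |P - α x * Q| ≤ V * (2 * K * δ) := by
      rw [← abs_of_pos hVpos, ← abs_mul, abs_of_pos hVpos, hsum]
      refine (abs_add_le _ _).trans ((add_le_add hA hB).trans ?_)
      rw [← hV]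
      nlinarith [mul_le_mul_of_nonneg_left hq hK0]
    exact le_of_mul_le_mul_left htot hVpos
  have h0 : |P - α x * Q| ≤ 0 := by
    refine le_of_forall_pos_le_add fun ε hε => ?_
    refine (hest (ε / (2 * K + 1)) (by positivity)).trans ?_
    rw [zero_add, ← mul_div_assoc, div_le_iff₀ (by positivity)]
    nlinarith
  exact sub_eq_zero.1 (abs_nonpos_iff.1 h0)

theorem eq_of_pairBalanced (hπ : ∀ x, 0 < π x)
    (hν : IsBernoulliProduct ν fun x => π x / (1 + π x))
    (hdiv : ¬ Summable fun x => π x / (1 + π x) ^ 2) (hC : 0 ≤ C)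
    (hle : ∀ s, MeasurableSet s → M.real s ≤ C * ν.real s)
    (hM : ∀ x y, x ≠ y → PairBalanced π M x y) : M = ν := by
  have hprod : ∀ F : Finset S, ∫ η, ∏ x ∈ F, part x η ∂M = ∏ x ∈ F, π x / (1 + π x) := by
    intro F
    induction F using Finset.induction_on with
    | empty => simp
    | insert x F hx ih =>
      simp only [Finset.prod_insert hx]
      rw [integral_part_mul_eq hπ hν hdiv hC hle hM (dependsOn_prod_part F) hx, ih]
  refine ext_of_forall_true fun F => ?_
  have h := integral_prod_part M F
  rw [hprod, ← hν.real_forall_true fun x => (div_pos (hπ x) (by linarith [hπ x])).le] at h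
  exact (measureReal_eq_measureReal_iff).1 h.symm

end Extremality

section Extremal

variable {S : Type*}

theorem real_le_of_eq_smul_add_smul {μ ν₁ ν₂ : Measure (S → Bool)} [IsFiniteMeasure ν₁]
    [IsFiniteMeasure ν₂] {t : ℝ} (ht0 : 0 < t) (ht1 : t < 1)
    (h : μ = ENNReal.ofReal t • ν₁ + ENNReal.ofReal (1 - t) • ν₂) (s : Set (S → Bool)) :
    ν₁.real s ≤ t⁻¹ * μ.real s ∧ ν₂.real s ≤ (1 - t)⁻¹ * μ.real s := by
  have h1t : 0 < 1 - t := by linarith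
  have e : μ.real s = t * ν₁.real s + (1 - t) * ν₂.real s := by
    rw [h, measureReal_def, Measure.add_apply, Measure.smul_apply, Measure.smul_apply, smul_eq_mul,
      smul_eq_mul, ENNReal.toReal_add (by finiteness) (by finiteness), ENNReal.toReal_mul,
      ENNReal.toReal_mul, ENNReal.toReal_ofReal ht0.le, ENNReal.toReal_ofReal h1t.le]
    rfl
  have h1 : 0 ≤ ν₁.real s := measureReal_nonneg
  have h2 : 0 ≤ ν₂.real s := measureReal_nonneg
  constructor
  · rw [inv_mul_eq_div, le_div_iff₀ ht0]
    nlinarith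
  · rw [inv_mul_eq_div, le_div_iff₀ h1t]
    nlinarith

theorem eq_dirac_of_real_le {ν : Measure (S → Bool)} [IsProbabilityMeasure ν] {η₀ : S → Bool}
    {C : ℝ} (h : ∀ s, ν.real s ≤ C * (Measure.dirac η₀).real s) : ν = Measure.dirac η₀ := by
  have h0 : ∀ s, MeasurableSet s → η₀ ∉ s → ν s = 0 := by
    intro s hs hη
    have := h s
    rw [measureReal_def (Measure.dirac η₀), Measure.dirac_apply' _ hs,
      Set.indicator_of_notMem hη] at this
    simp only [ENNReal.toReal_zero, mul_zero] at this
    exact (measureReal_eq_zero_iff).1 (this.antisymm measureReal_nonneg)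
  ext s hs
  rw [Measure.dirac_apply' _ hs]
  by_cases hη : η₀ ∈ s
  · rw [Set.indicator_of_mem hη, Pi.one_apply, ← prob_compl_eq_zero_iff hs]
    exact h0 _ hs.compl fun h => h hη
  · rw [Set.indicator_of_notMem hη, h0 s hs hη]

variable [DecidableEq S]

theorem isExtremalInvariant_dirac_const [Countable S] {p : S → S → ℝ} (hp : IsTransition p)
    (b : Bool) : IsExtremalInvariant p (Measure.dirac fun _ : S => b) := by
  refine ⟨(exclInvariant_iff hp).2 fun f F hf => ?_, fun t ν₁ ν₂ ht0 ht1 hν₁ hν₂ h => ?_⟩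
  · have h0 : ∀ x y : S, ∫ η, (f (jump x y η) - f η) ∂Measure.dirac (fun _ : S => b) = 0 := by
      intro x y
      have hm : Measurable fun η => f (jump x y η) - f η :=
        (hf.measurable.comp (measurable_jump x y)).sub hf.measurable
      rw [integral_dirac' _ _ hm.stronglyMeasurable]
      have : jump x y (fun _ : S => b) = fun _ => b := by
        rw [jump, if_neg (by cases b <;> simp)]
      rw [this, sub_self]
    simp only [h0, mul_zero, tsum_zero]
  · have := hν₁.1
    have := hν₂.1
    have hle := real_le_of_eq_smul_add_smul ht0 ht1 h
    exact ⟨eq_dirac_of_real_le fun s => (hle s).1, eq_dirac_of_real_le fun s => (hle s).2⟩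

theorem isExtremalInvariant_of_isBernoulliProduct [Countable S] {p : S → S → ℝ} {π : S → ℝ}
    (hp : IsTransition p) (hirr : IrreducibleKernel p) (hrev : IsReversible p π)
    (hdiv : ¬ Summable fun x => π x / (1 + π x) ^ 2) {Λ : ℕ → Finset S} (hΛ : Monotone Λ)
    (hcov : ∀ x, ∃ n, x ∈ Λ n) {B : ℝ} (hB : ∀ n, flux p (Λ n) ≤ B) {ν : Measure (S → Bool)}
    (hν : IsBernoulliProduct ν fun x => π x / (1 + π x)) : IsExtremalInvariant p ν := by
  have := hν.1
  have hbal := hν.balanced hrev.1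
  have key : ∀ (M : Measure (S → Bool)) (C : ℝ), 0 ≤ C → ExclInvariant p M →
      (∀ s, M.real s ≤ C * ν.real s) → M = ν := by
    intro M C hC hM hle
    have := hM.1
    exact eq_of_pairBalanced hrev.1 hν hdiv hC (fun s _ => hle s)
      (pairBalanced_of_le hp hirr hrev hbal hM hΛ hcov hB hC fun s _ => hle s)
  refine ⟨exclInvariant_of_balanced hp hrev hbal, fun t ν₁ ν₂ ht0 ht1 hν₁ hν₂ h => ?_⟩
  have := hν₁.1
  have := hν₂.1
  have hle := real_le_of_eq_smul_add_smul ht0 ht1 h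
  exact ⟨key ν₁ _ (inv_nonneg.2 ht0.le) hν₁ fun s => (hle s).1,
    key ν₂ _ (inv_nonneg.2 (by linarith)) hν₂ fun s => (hle s).2⟩

end Extremal

section Family

variable {S : Type*}

theorem exists_isBernoulliProduct {α : S → ℝ} (hα : ∀ x, 0 ≤ α x) (hα1 : ∀ x, α x ≤ 1) :
    ∃ ν : Measure (S → Bool), IsBernoulliProduct ν α := by
  set m : S → Measure Bool := fun x =>
    ENNReal.ofReal (α x) • Measure.dirac true + ENNReal.ofReal (1 - α x) • Measure.dirac false
    with hm
  have : ∀ x, IsProbabilityMeasure (m x) := fun x => ⟨by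
    simp only [hm, Measure.add_apply, Measure.smul_apply, measure_univ, smul_eq_mul, mul_one]
    rw [← ENNReal.ofReal_add (hα x) (by linarith [hα1 x])]
    simp⟩
  refine ⟨Measure.infinitePi m, inferInstance, fun F a => ?_⟩
  have hset : {η : S → Bool | ∀ x ∈ F, η x = a x} = Set.pi F fun x => {a x} := by
    ext η; simp [Set.mem_pi]
  rw [hset, Measure.infinitePi_pi _ fun x _ => measurableSet_singleton _]
  refine Finset.prod_congr rfl fun x _ => ?_
  cases h : a x <;> simp [hm]

variable {π : S → ℝ}

theorem not_summable_mul_div_sq (hπ : ∀ x, 0 < π x)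
    (hdiv : ¬ Summable fun x => π x / (1 + π x) ^ 2) {c : ℝ} (hc : 0 < c) :
    ¬ Summable fun x => c * π x / (1 + c * π x) ^ 2 := by
  refine fun h => hdiv (Summable.of_nonneg_of_le (fun x => ?_) (fun x => ?_)
    (h.mul_left ((max 1 c) ^ 2 / c)))
  · have := hπ x; positivity
  · have hx := hπ x
    have h1 : (1 + c * π x) ^ 2 ≤ (max 1 c) ^ 2 * (1 + π x) ^ 2 := by
      rw [← mul_pow]
      refine pow_le_pow_left₀ (by positivity) ?_ 2
      nlinarith [le_max_left 1 c, mul_le_mul_of_nonneg_right (le_max_right 1 c) hx.le]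
    have e : (max 1 c) ^ 2 / c * (c * π x / (1 + c * π x) ^ 2) =
        (max 1 c) ^ 2 * π x / (1 + c * π x) ^ 2 := by
      field_simp
    rw [e, div_le_div_iff₀ (by positivity) (by positivity)]
    nlinarith [mul_le_mul_of_nonneg_left h1 hx.le]

/-- A measure comparable with every member of the family of product measures belongs to it, or is
one of its two limits. -/
theorem eq_dirac_or_isBernoulliProduct_of_comparable (hπ : ∀ x, 0 < π x)
    {μ : Measure (S → Bool)} [IsProbabilityMeasure μ]
    (h : ∀ c : ℝ, 0 < c →
      (∀ F : Finset S, ∏ x ∈ F, c * π x / (1 + c * π x) ≤ μ.real {η | ∀ x ∈ F, η x = true}) ∨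
      ∀ F : Finset S, μ.real {η | ∀ x ∈ F, η x = true} ≤ ∏ x ∈ F, c * π x / (1 + c * π x)) :
    μ = Measure.dirac (fun _ => false) ∨ μ = Measure.dirac (fun _ => true) ∨
      ∃ c : ℝ, 0 < c ∧ IsBernoulliProduct μ (fun x => c * π x / (1 + c * π x)) := by
  set A : ℝ → Finset S → ℝ := fun u F => ∏ x ∈ F, Real.exp u * π x / (1 + Real.exp u * π x)
    with hA
  set w : Finset S → ℝ := fun F => μ.real {η | ∀ x ∈ F, η x = true} with hw
  have hcont : ∀ F, Continuous fun u => A u F := fun F => by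
    refine continuous_finsetProd _ fun x _ => Continuous.div (by fun_prop) (by fun_prop) fun u => ?_
    have := hπ x
    positivity
  have hL : IsClosed {u : ℝ | ∀ F, A u F ≤ w F} := by
    simp only [Set.ofPred_forall]
    exact isClosed_iInter fun F => isClosed_le (hcont F) continuous_const
  have hU : IsClosed {u : ℝ | ∀ F, w F ≤ A u F} := by
    simp only [Set.ofPred_forall]
    exact isClosed_iInter fun F => isClosed_le continuous_const (hcont F)
  have hLU : ∀ u : ℝ, (∀ F, A u F ≤ w F) ∨ ∀ F, w F ≤ A u F := fun u => h _ (Real.exp_pos u)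
  have hmu : ∀ F : Finset S, μ {η | ∀ x ∈ F, η x = true} = ENNReal.ofReal (w F) := fun F =>
    (ofReal_measureReal).symm
  have hdirac : ∀ (b : Bool) (F : Finset S),
      Measure.dirac (fun _ : S => b) {η | ∀ x ∈ F, η x = true} =
        if ∀ x ∈ F, b = true then 1 else 0 := fun b F => by
    rw [Measure.dirac_apply' _ (measurableSet_forall_eq F fun _ => true), Set.indicator_apply]
    rfl
  by_cases h1 : ∃ u : ℝ, ∀ F, A u F ≤ w F
  · by_cases h2 : ∃ u : ℝ, ∀ F, w F ≤ A u F
    · obtain ⟨u, -, hu1, hu2⟩ := isPreconnected_closed_iff.1 (isPreconnected_univ (α := ℝ)) _ _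
        hL hU (fun u _ => hLU u)
        (by rwa [Set.univ_inter]) (by rwa [Set.univ_inter])
      refine Or.inr (Or.inr ⟨Real.exp u, Real.exp_pos u, ?_⟩)
      have hα : ∀ x, 0 ≤ Real.exp u * π x / (1 + Real.exp u * π x) := fun x => by
        have := hπ x
        positivity
      obtain ⟨ν, hν⟩ := exists_isBernoulliProduct hα fun x => by
        have := hπ x
        rw [div_le_one (by positivity)]
        linarith
      have := hν.1
      have : μ = ν := ext_of_forall_true fun F => by
        rw [← measureReal_eq_measureReal_iff, hν.real_forall_true hα]
        exact le_antisymm (hu2 F) (hu1 F)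
      rwa [this]
    · right; left
      push Not at h2
      have hall : ∀ u F, A u F ≤ w F := fun u => (hLU u).resolve_right fun h => by
        obtain ⟨F, hF⟩ := h2 u
        exact absurd (h F) hF.not_ge
      refine ext_of_forall_true fun F => ?_
      have hlim : Tendsto (fun u => A u F) atTop (𝓝 1) := by
        rw [← Finset.prod_const_one (s := F)]
        refine tendsto_finsetProd _ fun x _ => ?_
        have hx := hπ x
        have e : (fun u : ℝ => Real.exp u * π x / (1 + Real.exp u * π x)) =
            fun u => 1 - (1 + Real.exp u * π x)⁻¹ := by
          funext u
          have : 0 < 1 + Real.exp u * π x := by positivity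
          field_simp
          ring
        rw [e]
        have := (tendsto_inv_atTop_zero.comp (tendsto_const_nhds (x := (1 : ℝ)).add_atTop
          (Real.tendsto_exp_atTop.atTop_mul_const hx))).const_sub 1
        simpa [Function.comp_def] using this
      have hw1 : w F = 1 :=
        le_antisymm measureReal_le_one (le_of_tendsto hlim (Eventually.of_forall fun u => hall u F))
      rw [hmu, hw1, hdirac, if_pos fun _ _ => rfl, ENNReal.ofReal_one]
  · left
    push Not at h1
    have hall : ∀ u F, w F ≤ A u F := fun u => (hLU u).resolve_left fun h => by
      obtain ⟨F, hF⟩ := h1 u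
      exact absurd (h F) hF.not_ge
    refine ext_of_forall_true fun F => ?_
    rcases F.eq_empty_or_nonempty with rfl | ⟨x, hx⟩
    · simp
    have hx0 := hπ x
    have hle : ∀ u, w F ≤ Real.exp u * π x := fun u => by
      have : w F ≤ w {x} := measureReal_mono fun η hη y hy => hη y (by simp_all)
      refine this.trans ((hall u {x}).trans ?_)
      rw [hA]
      simp only [Finset.prod_singleton]
      exact div_le_self (by positivity) (by linarith [mul_pos (Real.exp_pos u) hx0])
    have hlim : Tendsto (fun u => Real.exp u * π x) atBot (𝓝 0) := by
      simpa using Real.tendsto_exp_atBot.mul_const (π x)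
    have hw0 : w F = 0 :=
      le_antisymm (ge_of_tendsto hlim (Eventually.of_forall hle)) measureReal_nonneg
    rw [hmu, hw0, hdirac, if_neg fun h => by simpa using h x hx, ENNReal.ofReal_zero]

end Family

end Exclusion

/-- Under condition (⋆) with mean-zero kernels `q₁, q₂`, if
`∑ₓ π(x)/(1+π(x))² = ∞` then the extremal invariant measures of the exclusion process
are exactly the reversible product measures `{ν^c : 0 ≤ c ≤ ∞}`. -/
theorem extremal_set_eq_reversible_of_asymptotically_mean_zero
    (p : ℤ → ℤ → ℝ) (π : ℤ → ℝ) (q₁ q₂ : ℤ → ℝ)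
    (hp : IsTransition p) (hirr : IrreducibleKernel p) (hrev : IsReversible p π)
    (hq₁ : MeanZeroKernel q₁) (hq₂ : MeanZeroKernel q₂) (hstar : StarCond p q₁ q₂)
    (hdiv : ¬ Summable (fun x : ℤ => π x / (1 + π x) ^ 2)) :
    ∀ μ : Measure (ℤ → Bool), IsExtremalInvariant p μ ↔
      (μ = Measure.dirac (fun _ : ℤ => false) ∨ μ = Measure.dirac (fun _ : ℤ => true) ∨
        ∃ c : ℝ, 0 < c ∧ IsBernoulliProduct μ (fun x => c * π x / (1 + c * π x))) := by
  obtain ⟨Λ, B, hΛ, hcov, hB, hno⟩ := Exclusion.exists_noFlux hp hrev hq₁ hq₂ hstar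
  have hsym : ∀ x y, 0 < p x y → 0 < p y x := fun x y hxy =>
    pos_of_mul_pos_right ((hrev.2 x y).symm ▸ mul_pos (hrev.1 x) hxy) (hrev.1 y).le
  have hext : ∀ c : ℝ, 0 < c → ∀ ν : Measure (ℤ → Bool),
      IsBernoulliProduct ν (fun x => c * π x / (1 + c * π x)) → IsExtremalInvariant p ν := by
    intro c hc ν hν
    have hrev' : IsReversible p fun x => c * π x :=
      ⟨fun x => mul_pos hc (hrev.1 x), fun x y => by rw [mul_assoc, mul_assoc, hrev.2 x y]⟩
    exact Exclusion.isExtremalInvariant_of_isBernoulliProduct hp hirr hrev'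
      (Exclusion.not_summable_mul_div_sq hrev.1 hdiv hc) hΛ hcov hB hν
  intro μ
  refine ⟨fun hμ => ?_, ?_⟩
  · have := hμ.1.1
    refine Exclusion.eq_dirac_or_isBernoulliProduct_of_comparable hrev.1 fun c hc => ?_
    have hα : ∀ x, 0 ≤ c * π x / (1 + c * π x) := fun x => by
      have := hrev.1 x
      positivity
    obtain ⟨ν, hν⟩ := Exclusion.exists_isBernoulliProduct hα fun x => by
      have := hrev.1 x
      rw [div_le_one (by positivity)]
      linarith
    have := hν.1
    simp only [← hν.real_forall_true hα]
    refine (Exclusion.IsExtremalInvariant.le_or_le hp hirr hsym hΛ hcov hB hno hμ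
      (hext c hc ν hν)).imp (fun h F => ?_) fun h F => ?_
    · exact ENNReal.toReal_mono (measure_ne_top _ _) (h F)
    · exact ENNReal.toReal_mono (measure_ne_top _ _) (h F)
  · rintro (rfl | rfl | ⟨c, hc, hν⟩)
    · exact Exclusion.isExtremalInvariant_dirac_const hp false
    · exact Exclusion.isExtremalInvariant_dirac_const hp true
    · exact hext c hc μ hν
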